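/- Under Assumption (H1), there exists a unique continuous viscosity solution V to the forward parabolic system of quasi variational inequalities min{ ∂V/∂T − inf_{u∈U}[L^{i,u}V + f(x,i,u)], V(T,x,i) − max_{j≠i}[V(T,x,j) − c(x,i,j)] } = 0 on (0,∞)×ℝ^d×I_m with initial condition V(0,x,i)=g(x,i), within the class of functions satisfying: for any T>0 there exist C_T ≥ 0 and q_T ≥ 1 such that |V(t,x,i)| ≤ C_T(1+|x|^{q_T}) for all (t,x,i) ∈ [0,T]×ℝ^d×I_m. -/

import Mathlib

open MeasureTheory Set Filter
open scoped RealInnerProductSpace ENNReal NNReal Topology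

noncomputable section

/-- Squared Frobenius norm of a matrix. -/
def frobSq {d : ℕ} (A : Matrix (Fin d) (Fin d) ℝ) : ℝ := ∑ i, ∑ j, (A i j) ^ 2

/-- The second order differential operator
`L^{i,u} ψ (x) = b(x,i,u) · D_x ψ(x) + ½ tr(σσᵀ(x,i,u) D_x² ψ(x))`,
where the trace term is computed as `½ Σ_k D²ψ(x)[σ·k, σ·k]` over the columns `σ·k` of `σ`. -/
def Lop {d q m : ℕ}
    (b : EuclideanSpace ℝ (Fin d) → Fin m → EuclideanSpace ℝ (Fin q) → EuclideanSpace ℝ (Fin d))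
    (σ : EuclideanSpace ℝ (Fin d) → Fin m → EuclideanSpace ℝ (Fin q) → Matrix (Fin d) (Fin d) ℝ)
    (i : Fin m) (u : EuclideanSpace ℝ (Fin q)) (ψ : EuclideanSpace ℝ (Fin d) → ℝ)
    (x : EuclideanSpace ℝ (Fin d)) : ℝ :=
  fderiv ℝ ψ x (b x i u) + (1 / 2) * ∑ k : Fin d,
    fderiv ℝ (fun y => fderiv ℝ ψ y ((EuclideanSpace.equiv (Fin d) ℝ).symm fun l => σ x i u l k)) x
      ((EuclideanSpace.equiv (Fin d) ℝ).symm fun l => σ x i u l k)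

/-- Assumption (H1). -/
structure H1Hyp {d q m : ℕ} (Uset : Set (EuclideanSpace ℝ (Fin q)))
    (b : EuclideanSpace ℝ (Fin d) → Fin m → EuclideanSpace ℝ (Fin q) → EuclideanSpace ℝ (Fin d))
    (σ : EuclideanSpace ℝ (Fin d) → Fin m → EuclideanSpace ℝ (Fin q) → Matrix (Fin d) (Fin d) ℝ)
    (f : EuclideanSpace ℝ (Fin d) → Fin m → EuclideanSpace ℝ (Fin q) → ℝ)
    (c : EuclideanSpace ℝ (Fin d) → Fin m → Fin m → ℝ)
    (g : EuclideanSpace ℝ (Fin d) → Fin m → ℝ)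
    (L1 L2 M2 : ℝ) : Prop where
  Ucompact : IsCompact Uset
  Unonempty : Uset.Nonempty
  bCont : ∀ i, Continuous fun p : EuclideanSpace ℝ (Fin d) × EuclideanSpace ℝ (Fin q) => b p.1 i p.2
  σCont : ∀ i, Continuous fun p : EuclideanSpace ℝ (Fin d) × EuclideanSpace ℝ (Fin q) => σ p.1 i p.2
  L1pos : 0 < L1
  bLip : ∀ x x' i, ∀ u ∈ Uset, ‖b x i u - b x' i u‖ ≤ L1 * ‖x - x'‖
  σLip : ∀ x x' i, ∀ u ∈ Uset, Real.sqrt (frobSq (σ x i u - σ x' i u)) ≤ L1 * ‖x - x'‖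
  fCont : ∀ i, Continuous fun p : EuclideanSpace ℝ (Fin d) × EuclideanSpace ℝ (Fin q) => f p.1 i p.2
  cCont : ∀ i j, Continuous fun x => c x i j
  gCont : ∀ i, Continuous fun x => g x i
  L2pos : 0 < L2
  fLip : ∀ x x' i, ∀ u ∈ Uset, |f x i u - f x' i u| ≤ L2 * ‖x - x'‖
  cLip : ∀ x x' i j, |c x i j - c x' i j| ≤ L2 * ‖x - x'‖
  M2pos : 0 < M2
  gGrowth : ∀ x i, |g x i| ≤ M2 * (1 + ‖x‖ ^ 2)
  gIneq : ∀ x i j, j ≠ i → g x j - c x i j ≤ g x i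
  cNonneg : ∀ x i j, 0 ≤ c x i j
  cDiag : ∀ x i, c x i i = 0
  noFreeLoop : ∀ x, ∀ k : ℕ, 2 ≤ k → ∀ ι : ℕ → Fin m,
    Function.Injective (fun a : Fin k => ι a) → ι k = ι 0 →
    0 < ∑ a ∈ Finset.range k, c x (ι a) (ι (a + 1))

/-- Viscosity supersolution of the forward parabolic system of quasi variational inequalities
`min{ ∂V/∂T - inf_{u∈U}[L^{i,u}V + f(x,i,u)], V(T,x,i) - max_{j≠i}[V(T,x,j) - c(x,i,j)] } = 0`
on `(0,∞) × ℝ^d × I_m`, via C² test functions on `ℝ × ℝ^d`. -/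
def ParabolicSuper {d q m : ℕ} (Uset : Set (EuclideanSpace ℝ (Fin q)))
    (b : EuclideanSpace ℝ (Fin d) → Fin m → EuclideanSpace ℝ (Fin q) → EuclideanSpace ℝ (Fin d))
    (σ : EuclideanSpace ℝ (Fin d) → Fin m → EuclideanSpace ℝ (Fin q) → Matrix (Fin d) (Fin d) ℝ)
    (f : EuclideanSpace ℝ (Fin d) → Fin m → EuclideanSpace ℝ (Fin q) → ℝ)
    (c : EuclideanSpace ℝ (Fin d) → Fin m → Fin m → ℝ)
    (V : ℝ → EuclideanSpace ℝ (Fin d) → Fin m → ℝ) : Prop :=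
  ∀ t : ℝ, 0 < t → ∀ x i, ∀ θ : ℝ × EuclideanSpace ℝ (Fin d) → ℝ, ContDiff ℝ 2 θ →
    (∀ s : ℝ, 0 < s → ∀ y, V t x i - θ (t, x) ≤ V s y i - θ (s, y)) →
    (sInf ((fun u => Lop b σ i u (fun y => θ (t, y)) x + f x i u) '' Uset)
        ≤ fderiv ℝ θ (t, x) (1, 0)) ∧
    (∀ j, j ≠ i → V t x j - c x i j ≤ V t x i)

/-- Viscosity subsolution of the forward parabolic system. -/
def ParabolicSub {d q m : ℕ} (Uset : Set (EuclideanSpace ℝ (Fin q)))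
    (b : EuclideanSpace ℝ (Fin d) → Fin m → EuclideanSpace ℝ (Fin q) → EuclideanSpace ℝ (Fin d))
    (σ : EuclideanSpace ℝ (Fin d) → Fin m → EuclideanSpace ℝ (Fin q) → Matrix (Fin d) (Fin d) ℝ)
    (f : EuclideanSpace ℝ (Fin d) → Fin m → EuclideanSpace ℝ (Fin q) → ℝ)
    (c : EuclideanSpace ℝ (Fin d) → Fin m → Fin m → ℝ)
    (V : ℝ → EuclideanSpace ℝ (Fin d) → Fin m → ℝ) : Prop :=
  ∀ t : ℝ, 0 < t → ∀ x i, ∀ θ : ℝ × EuclideanSpace ℝ (Fin d) → ℝ, ContDiff ℝ 2 θ →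
    (∀ s : ℝ, 0 < s → ∀ y, V s y i - θ (s, y) ≤ V t x i - θ (t, x)) →
    (fderiv ℝ θ (t, x) (1, 0)
        ≤ sInf ((fun u => Lop b σ i u (fun y => θ (t, y)) x + f x i u) '' Uset)) ∨
    (∃ j, j ≠ i ∧ V t x i ≤ V t x j - c x i j)

/-- The class in which existence and uniqueness for the parabolic system holds: continuous
viscosity solutions on `[0,∞) × ℝ^d × I_m` with initial datum `g` satisfying, on every
`[0,T] × ℝ^d × I_m`, a polynomial growth condition `|V(t,x,i)| ≤ C_T (1 + |x|^{q_T})`. -/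
def ParSolClass {d q m : ℕ} (Uset : Set (EuclideanSpace ℝ (Fin q)))
    (b : EuclideanSpace ℝ (Fin d) → Fin m → EuclideanSpace ℝ (Fin q) → EuclideanSpace ℝ (Fin d))
    (σ : EuclideanSpace ℝ (Fin d) → Fin m → EuclideanSpace ℝ (Fin q) → Matrix (Fin d) (Fin d) ℝ)
    (f : EuclideanSpace ℝ (Fin d) → Fin m → EuclideanSpace ℝ (Fin q) → ℝ)
    (c : EuclideanSpace ℝ (Fin d) → Fin m → Fin m → ℝ)
    (g : EuclideanSpace ℝ (Fin d) → Fin m → ℝ)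
    (V : ℝ → EuclideanSpace ℝ (Fin d) → Fin m → ℝ) : Prop :=
  (∀ i, ContinuousOn (fun p : ℝ × EuclideanSpace ℝ (Fin d) => V p.1 p.2 i) {p | 0 ≤ p.1}) ∧
  ParabolicSuper Uset b σ f c V ∧ ParabolicSub Uset b σ f c V ∧
  (∀ x i, V 0 x i = g x i) ∧
  (∀ T : ℝ, 0 < T → ∃ C : ℝ, 0 ≤ C ∧ ∃ qT : ℝ, 1 ≤ qT ∧
    ∀ t ∈ Icc (0 : ℝ) T, ∀ x i, |V t x i| ≤ C * (1 + ‖x‖ ^ qT))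


/-! ### Second order jets -/

/-- `(ℓ, Q)` is a second order superjet of `u` at `z`. -/
def UJet {E : Type*} [NormedAddCommGroup E] [NormedSpace ℝ E] (u : E → ℝ) (z : E)
    (l : E →L[ℝ] ℝ) (Q : E →L[ℝ] E →L[ℝ] ℝ) : Prop :=
  ∀ ε : ℝ, 0 < ε → ∀ᶠ h in 𝓝 (0 : E), u (z + h) ≤ u z + l h + (1 / 2) * Q h h + ε * ‖h‖ ^ 2

/-- `(ℓ, Q)` is a second order subjet of `u` at `z`. -/
def LJet {E : Type*} [NormedAddCommGroup E] [NormedSpace ℝ E] (u : E → ℝ) (z : E)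
    (l : E →L[ℝ] ℝ) (Q : E →L[ℝ] E →L[ℝ] ℝ) : Prop :=
  ∀ ε : ℝ, 0 < ε → ∀ᶠ h in 𝓝 (0 : E), u z + l h + (1 / 2) * Q h h - ε * ‖h‖ ^ 2 ≤ u (z + h)

/-- two sided paraboloid condition -/
def TwoSided {F : Type*} [NormedAddCommGroup F] [InnerProductSpace ℝ F] (f : F → ℝ) (C : ℝ)
    (y p : F) : Prop := ∀ h : F, |f (y + h) - f y - ⟪p, h⟫| ≤ C * ‖h‖ ^ 2

section Alexandrov

variable {F : Type*} [NormedAddCommGroup F] [InnerProductSpace ℝ F]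

theorem TwoSided.lip {f : F → ℝ} {C : ℝ} {y1 y2 p1 p2 : F}
    (h1 : TwoSided f C y1 p1) (h2 : TwoSided f C y2 p2) : ‖p1 - p2‖ ≤ 6 * C * ‖y1 - y2‖ := by
  by_cases hp : p1 - p2 = 0
  · rw [hp, norm_zero]
    have := h1 (y2 - y1)
    have h3 : 0 ≤ C * ‖y2 - y1‖ ^ 2 := (abs_nonneg _).trans this
    by_cases h0 : ‖y1 - y2‖ = 0
    · rw [h0]; simp
    · have h4 : 0 < ‖y1 - y2‖ := lt_of_le_of_ne (norm_nonneg _) (Ne.symm h0)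
      rw [norm_sub_rev] at h3
      have : 0 ≤ C := by
        by_contra hC
        push Not at hC
        nlinarith [mul_pos h4 h4]
      positivity
  have hpp : 0 < ‖p1 - p2‖ := norm_pos_iff.mpr hp
  by_cases he : y1 = y2
  · exfalso
    subst he
    -- uniqueness of gradient
    have key : ∀ s : ℝ, 0 < s → s * ‖p1 - p2‖ ^ 2 ≤ 2 * C * s ^ 2 * ‖p1 - p2‖ ^ 2 := by
      intro s hs
      have a1 := abs_le.mp (h1 (s • (p1 - p2)))
      have a2 := abs_le.mp (h2 (s • (p1 - p2)))
      have e : ⟪p1, s • (p1 - p2)⟫ - ⟪p2, s • (p1 - p2)⟫ = s * ‖p1 - p2‖ ^ 2 := by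
        rw [← inner_sub_left, real_inner_smul_right, real_inner_self_eq_norm_sq]
      have e2 : ‖s • (p1 - p2)‖ ^ 2 = s ^ 2 * ‖p1 - p2‖ ^ 2 := by
        rw [norm_smul, mul_pow, Real.norm_eq_abs, sq_abs]
      rw [e2] at a1 a2
      nlinarith [a1.1, a1.2, a2.1, a2.2]
    have hC : 0 < C := by
      have := key 1 one_pos
      by_contra hC
      push Not at hC
      nlinarith [mul_pos hpp hpp]
    have := key (1 / (4 * C)) (by positivity)
    have e : 2 * C * (1 / (4 * C)) ^ 2 = (1 / (4 * C)) / 2 := by field_simp; ring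
    rw [e] at this
    have : 0 < (1 / (4 * C)) * ‖p1 - p2‖ ^ 2 := by positivity
    nlinarith
  · set e := y2 - y1 with hedef
    have he0 : 0 < ‖e‖ := norm_pos_iff.mpr (sub_ne_zero.mpr (Ne.symm he))
    set s := ‖e‖ / ‖p1 - p2‖ with hs
    have hs0 : 0 < s := by positivity
    set h := s • (p1 - p2) with hh
    have hn : ‖h‖ = ‖e‖ := by
      rw [hh, norm_smul, Real.norm_eq_abs, abs_of_pos hs0, hs]; field_simp
    have a1 := abs_le.mp (h1 (e + h))
    have a2 := abs_le.mp (h1 e)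
    have a3 := abs_le.mp (h2 h)
    have e1 : y1 + (e + h) = y2 + h := by rw [hedef]; abel
    have e2 : y1 + e = y2 := by rw [hedef]; abel
    rw [e1, inner_add_right] at a1
    rw [e2] at a2
    have hC : 0 ≤ C := by
      have : 0 ≤ C * ‖e‖ ^ 2 := (abs_nonneg _).trans (h1 e)
      by_contra hC
      push Not at hC
      nlinarith [mul_pos he0 he0]
    have tri : ‖e + h‖ ^ 2 ≤ 4 * ‖e‖ ^ 2 := by
      have : ‖e + h‖ ≤ 2 * ‖e‖ := (norm_add_le _ _).trans (by rw [hn]; linarith)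
      nlinarith [norm_nonneg (e + h)]
    have tri' := mul_le_mul_of_nonneg_left tri hC
    rw [hn] at a3
    have e3 : ⟪p1, h⟫ - ⟪p2, h⟫ = ‖e‖ * ‖p1 - p2‖ := by
      rw [← inner_sub_left, hh, real_inner_smul_right, real_inner_self_eq_norm_sq, hs]; field_simp
    have : ‖e‖ * ‖p1 - p2‖ ≤ 6 * C * ‖e‖ ^ 2 := by
      rw [← e3]; nlinarith [a1.1, a1.2, a2.1, a2.2, a3.1, a3.2]
    have e4 : ‖y1 - y2‖ = ‖e‖ := by rw [norm_sub_rev]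
    rw [e4]
    have : ‖e‖ * ‖p1 - p2‖ ≤ ‖e‖ * (6 * C * ‖e‖) := by nlinarith
    exact le_of_mul_le_mul_left this he0

theorem TwoSided.exists_lip [FiniteDimensional ℝ F] (f : F → ℝ) {C : ℝ} (hC : 0 ≤ C) :
    ∃ (K : ℝ≥0) (G : F → F), LipschitzWith K G ∧ ∀ y p, TwoSided f C y p → G y = p := by
  classical
  let S : Set F := {y | ∃ p, TwoSided f C y p}
  let g : F → F := fun y => if h : ∃ p, TwoSided f C y p then h.choose else 0
  have hg : ∀ y ∈ S, TwoSided f C y (g y) := by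
    intro y hy
    have hy' : ∃ p, TwoSided f C y p := hy
    simp only [g, dif_pos hy']
    exact hy'.choose_spec
  have hl : LipschitzOnWith (Real.toNNReal (6 * C)) g S := by
    apply LipschitzOnWith.of_dist_le_mul
    intro x hx y hy
    rw [dist_eq_norm, dist_eq_norm, Real.coe_toNNReal _ (by positivity)]
    exact (hg x hx).lip (hg y hy)
  obtain ⟨G, hG, hE⟩ := hl.extend_finite_dimension
  refine ⟨_, G, hG, fun y p hp => ?_⟩
  have hy : y ∈ S := ⟨p, hp⟩
  rw [← hE hy]
  have := (hg y hy).lip hp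
  simp only [sub_self, norm_zero, mul_zero] at this
  exact sub_eq_zero.mp (norm_le_zero_iff.mp this)

variable [FiniteDimensional ℝ F] [MeasurableSpace F] [BorelSpace F]

theorem density_ae (μ : Measure F) [μ.IsAddHaarMeasure] (S : Set F) :
    ∀ᵐ x ∂μ, x ∈ S → ∀ η : ℝ, 0 < η → ∀ᶠ h in 𝓝 (0 : F), ∃ y ∈ S, ‖y - (x + h)‖ ≤ η * ‖h‖ := by
  have h1 := Besicovitch.ae_tendsto_measure_inter_div μ (toMeasurable μ S)
  have h1' : ∀ᵐ (x : F) ∂μ.restrict S, Tendsto (fun r => μ (S ∩ Metric.closedBall x r) /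
      μ (Metric.closedBall x r)) (𝓝[>] 0) (𝓝 1) := Besicovitch.ae_tendsto_measure_inter_div μ S
  have h2 : ∀ᵐ x ∂μ, x ∈ S → Tendsto (fun r => μ (S ∩ Metric.closedBall x r) /
      μ (Metric.closedBall x r)) (𝓝[>] 0) (𝓝 1) := by
    exact ae_imp_of_ae_restrict h1'
  filter_upwards [h2] with x hx hxS η hη
  have hd := hx hxS
  have key : ∀ v : F, ∀ᶠ r in 𝓝[>] (0 : ℝ), ∃ y ∈ S, ‖y - (x + r • v)‖ ≤ r * (η / 2) := by
    intro v
    have := Measure.eventually_nonempty_inter_smul_of_density_one μ S x hd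
      (Metric.closedBall v (η / 2)) Metric.isClosed_closedBall.measurableSet
      (Metric.measure_closedBall_pos μ v (by positivity)).ne'
    filter_upwards [this, self_mem_nhdsWithin] with r hr hr0
    have hr0' : 0 < r := hr0
    obtain ⟨y, hyS, hy⟩ := hr
    refine ⟨y, hyS, ?_⟩
    rw [Set.mem_add] at hy
    obtain ⟨x', hx', b, hb, rfl⟩ := hy
    rw [Set.mem_singleton_iff] at hx'
    subst hx'
    obtain ⟨w, hw, rfl⟩ := hb
    have : x' + r • w - (x' + r • v) = r • (w - v) := by rw [smul_sub]; abel
    simp only [this]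
    rw [norm_smul, Real.norm_eq_abs, abs_of_pos hr0']
    rw [mem_closedBall_iff_norm] at hw
    exact mul_le_mul_of_nonneg_left hw hr0'.le
  obtain ⟨t, -, htf, htc⟩ := (isCompact_sphere (0 : F) 1).finite_cover_balls (half_pos hη)
  have hall : ∀ᶠ r in 𝓝[>] (0 : ℝ), ∀ v ∈ t, ∃ y ∈ S, ‖y - (x + r • v)‖ ≤ r * (η / 2) := by
    rw [Filter.eventually_all_finite htf]
    exact fun v _ => key v
  rw [eventually_nhdsWithin_iff, Metric.eventually_nhds_iff] at hall
  obtain ⟨ρ, hρ, hall⟩ := hall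
  rw [Metric.eventually_nhds_iff]
  refine ⟨ρ, hρ, fun h hh => ?_⟩
  rw [dist_zero_right] at hh
  by_cases h0 : h = 0
  · exact ⟨x, hxS, by simp [h0]⟩
  have hn : 0 < ‖h‖ := norm_pos_iff.mpr h0
  have hs : (‖h‖⁻¹ • h) ∈ Metric.sphere (0 : F) 1 := by
    simp [norm_smul, hn.ne']
  have := htc hs
  simp only [Set.mem_iUnion, Metric.mem_ball] at this
  obtain ⟨v, hv, hvd⟩ := this
  obtain ⟨y, hyS, hy⟩ := hall (y := ‖h‖) (by simpa using hh) hn v hv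
  refine ⟨y, hyS, ?_⟩
  have e1 : y - (x + h) = (y - (x + ‖h‖ • v)) + ‖h‖ • (v - ‖h‖⁻¹ • h) := by
    rw [smul_sub, smul_smul, mul_inv_cancel₀ hn.ne', one_smul]; abel
  rw [e1]
  refine (norm_add_le _ _).trans ?_
  rw [norm_smul, norm_norm]
  rw [dist_comm, dist_eq_norm] at hvd
  nlinarith

theorem TwoSided.expansion {f : F → ℝ} {C : ℝ} (hC : 0 ≤ C) {K : ℝ≥0} {G : F → F}
    (hG : LipschitzWith K G)
    (hGp : ∀ y p, TwoSided f C y p → G y = p) {y0 : F} (hy0 : TwoSided f C y0 (G y0))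
    (hdens : ∀ η : ℝ, 0 < η → ∀ᶠ h in 𝓝 (0 : F),
      ∃ y ∈ {y | ∃ p, TwoSided f C y p}, ‖y - (y0 + h)‖ ≤ η * ‖h‖)
    {D : F →L[ℝ] F} (hD : HasFDerivAt G D y0) :
    ∀ ε : ℝ, 0 < ε → ∀ᶠ h in 𝓝 (0 : F),
      |f (y0 + h) - f y0 - ⟪G y0, h⟫ - (1 / 2) * ⟪D h, h⟫| ≤ ε * ‖h‖ ^ 2 := by
  intro ε hε
  set M : ℝ := 5 * C + K + 1 + ‖D‖ with hM
  have hMpos : 0 < M := by positivity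
  obtain ⟨N, hN⟩ := exists_nat_gt (M / ε)
  have hNpos : 0 < (N : ℝ) := lt_of_le_of_lt (by positivity) hN
  set η : ℝ := 1 / N with hη
  have hηpos : 0 < η := by positivity
  have hNη : (N : ℝ) * η = 1 := by rw [hη]; field_simp
  have hηM : η * M ≤ ε := by
    rw [hη]; rw [div_lt_iff₀ hε] at hN; rw [one_div, inv_mul_le_iff₀ hNpos]; linarith
  have hD' : ∀ᶠ h in 𝓝 (0 : F), ‖G (y0 + h) - G y0 - D h‖ ≤ η * ‖h‖ := by
    rw [hasFDerivAt_iff_isLittleO_nhds_zero] at hD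
    exact hD.def hηpos
  obtain ⟨ρ, hρ, hall⟩ := Metric.eventually_nhds_iff.mp ((hdens η hηpos).and hD')
  rw [Metric.eventually_nhds_iff]
  refine ⟨ρ, hρ, fun h hh => ?_⟩
  rw [dist_zero_right] at hh
  set r := ‖h‖ with hr
  have hr0 : 0 ≤ r := norm_nonneg _
  have step : ∀ j : ℕ, j ≤ N →
      |f (y0 + ((j : ℝ) * η) • h) - f y0 - (j * η) * ⟪G y0, h⟫ - (1 / 2) * (j * η) ^ 2 * ⟪D h, h⟫|
        ≤ j * (M * η ^ 2 * r ^ 2) := by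
    intro j
    induction j with
    | zero => intro _; simp
    | succ j ih =>
      intro hj
      have ih := ih (by omega)
      have hj1 : (j : ℝ) * η ≤ 1 := by
        rw [← hNη]; gcongr; omega
      have hj0 : 0 ≤ (j : ℝ) * η := by positivity
      set k := ((j : ℝ) * η) • h with hk
      have hkn : ‖k‖ ≤ r := by
        rw [hk, norm_smul, Real.norm_eq_abs, abs_of_nonneg hj0]
        exact mul_le_of_le_one_left hr0 hj1
      obtain ⟨⟨s, ⟨p, hsp⟩, hs⟩, hGk⟩ := hall (y := k) (by rw [dist_zero_right]; linarith)
      have hps := hGp s p hsp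
      subst hps
      have hs' : ‖(y0 + k) - s‖ ≤ η * r := by
        rw [norm_sub_rev]; exact hs.trans (by gcongr)
      have hGk' : ‖G (y0 + k) - G y0 - D k‖ ≤ η * r := hGk.trans (by gcongr)
      have hGs : ‖G s - G (y0 + k)‖ ≤ K * (η * r) := by
        have := hG.dist_le_mul s (y0 + k)
        rw [dist_eq_norm, dist_eq_norm, norm_sub_rev s] at this
        exact this.trans (by gcongr)
      have t1 := hsp ((y0 + k) - s)
      have t2 := hsp ((y0 + k) - s + η • h)
      rw [show s + (y0 + k - s) = y0 + k by abel] at t1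
      rw [show s + (y0 + k - s + η • h) = y0 + k + η • h by abel, inner_add_right] at t2
      have n1 : C * ‖(y0 + k) - s‖ ^ 2 ≤ C * (η * r) ^ 2 := by gcongr
      have n2 : C * ‖(y0 + k) - s + η • h‖ ^ 2 ≤ C * (2 * (η * r)) ^ 2 := by
        gcongr
        refine (norm_add_le _ _).trans ?_
        rw [norm_smul, Real.norm_eq_abs, abs_of_pos hηpos]
        linarith
      have e1 : y0 + (((j + 1 : ℕ) : ℝ) * η) • h = y0 + k + η • h := by
        rw [hk]; push_cast; rw [add_mul, add_smul, one_mul]; abel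
      have hin : |⟪G s, η • h⟫ - η * ⟪G y0, h⟫ - j * η ^ 2 * ⟪D h, h⟫| ≤ (K + 1) * η ^ 2 * r ^ 2 := by
        have : ⟪G s, η • h⟫ - η * ⟪G y0, h⟫ - j * η ^ 2 * ⟪D h, h⟫
            = η * ⟪(G s - G (y0 + k)) + (G (y0 + k) - G y0 - D k), h⟫ := by
          rw [hk, map_smul, real_inner_smul_right, inner_add_left, inner_sub_left, inner_sub_left,
            inner_sub_left, real_inner_smul_left]
          ring
        rw [this, abs_mul, abs_of_pos hηpos]
        have h3 := abs_real_inner_le_norm ((G s - G (y0 + k)) + (G (y0 + k) - G y0 - D k)) h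
        have h4 : ‖(G s - G (y0 + k)) + (G (y0 + k) - G y0 - D k)‖ ≤ (K + 1) * (η * r) :=
          (norm_add_le _ _).trans (by linarith)
        calc η * _ ≤ η * (((K + 1) * (η * r)) * r) := by
              gcongr; exact h3.trans (by gcongr)
          _ = _ := by ring
      have hDh : |⟪D h, h⟫| ≤ ‖D‖ * r ^ 2 := by
        refine (abs_real_inner_le_norm _ _).trans ?_
        have := D.le_opNorm h
        nlinarith
      rw [e1]
      have ih' := abs_le.mp ih
      have t1' := abs_le.mp t1
      have t2' := abs_le.mp t2
      have hin' := abs_le.mp hin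
      have hDh' := abs_le.mp hDh
      have d1 : η ^ 2 * ⟪D h, h⟫ ≤ η ^ 2 * (‖D‖ * r ^ 2) := by gcongr; exact hDh'.2
      have d2 : η ^ 2 * (-(‖D‖ * r ^ 2)) ≤ η ^ 2 * ⟪D h, h⟫ := by gcongr; exact hDh'.1
      have d3 : 0 ≤ η ^ 2 * (‖D‖ * r ^ 2) := by positivity
      have hMx : M * η ^ 2 * r ^ 2 = 5 * (C * (η * r) ^ 2) + (K + 1) * η ^ 2 * r ^ 2
          + η ^ 2 * (‖D‖ * r ^ 2) := by rw [hM]; ring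
      have n2' : C * (2 * (η * r)) ^ 2 = 4 * (C * (η * r) ^ 2) := by ring
      rw [n2'] at n2
      have sq1 : (1 / 2 : ℝ) * ((j + 1) * η) ^ 2 * ⟪D h, h⟫ = (1 / 2) * (j * η) ^ 2 * ⟪D h, h⟫
          + j * η ^ 2 * ⟪D h, h⟫ + (1 / 2) * (η ^ 2 * ⟪D h, h⟫) := by ring
      have sq2 : ((j : ℝ) + 1) * η * ⟪G y0, h⟫ = j * η * ⟪G y0, h⟫ + η * ⟪G y0, h⟫ := by ring
      have sq3 : ((j : ℝ) + 1) * (M * η ^ 2 * r ^ 2) = j * (M * η ^ 2 * r ^ 2) + M * η ^ 2 * r ^ 2 := by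
        ring
      push_cast
      rw [abs_le, sq1, sq2, sq3]
      obtain ⟨i1, i2⟩ := ih'
      obtain ⟨a1, a2⟩ := t1'
      obtain ⟨b1, b2⟩ := t2'
      obtain ⟨c1, c2⟩ := hin'
      generalize (M * η ^ 2 * r ^ 2) = X0 at *
      constructor <;> linarith
  have := step N le_rfl
  rw [hNη, one_smul, one_mul, one_pow, mul_one] at this
  refine this.trans ?_
  have : (N : ℝ) * (M * η ^ 2 * r ^ 2) = (N * η) * (η * M) * r ^ 2 := by ring
  rw [this, hNη, one_mul]
  gcongr

theorem TwoSided.alexandrov (μ : Measure F) [μ.IsAddHaarMeasure] (f : F → ℝ) {C : ℝ} (hC : 0 ≤ C) :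
    ∃ N : Set F, μ N = 0 ∧ ∀ y p, y ∉ N → TwoSided f C y p →
      ∃ Q : F →L[ℝ] F →L[ℝ] ℝ, UJet f y (innerSL ℝ p) Q ∧ LJet f y (innerSL ℝ p) Q := by
  obtain ⟨K, G, hG, hGp⟩ := TwoSided.exists_lip f hC
  have h1 := density_ae μ {y | ∃ p, TwoSided f C y p}
  have h2 := hG.ae_differentiableAt (μ := μ)
  have h3 := h1.and h2
  refine ⟨_, h3, fun y p hy hp => ?_⟩
  simp only [Set.mem_compl_iff, Set.mem_ofPred_eq, not_not] at hy
  have hp' := hGp y p hp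
  subst hp'
  have := TwoSided.expansion hC hG hGp hp (hy.1 ⟨_, hp⟩) hy.2.hasFDerivAt
  refine ⟨(innerSL ℝ).comp (fderiv ℝ G y), fun ε hε => ?_, fun ε hε => ?_⟩
  · filter_upwards [this ε hε] with h hh
    have := abs_le.mp hh
    simp only [innerSL_apply_apply, ContinuousLinearMap.comp_apply]
    linarith [this.2]
  · filter_upwards [this ε hε] with h hh
    have := abs_le.mp hh
    simp only [innerSL_apply_apply, ContinuousLinearMap.comp_apply]
    linarith [this.1]

end Alexandrov

/-! ### The theorem on sums -/

section Sums

variable {F : Type*} [NormedAddCommGroup F] [InnerProductSpace ℝ F]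

/-- the quadruple penalised functional -/
def quadFun (u1 u2 : F → ℝ) (a : ℝ) (c p1 p2 w w' x x' : F) : ℝ :=
  u1 w + u2 w' - a / 2 * (‖w - x‖ ^ 2 + ‖w' - x'‖ ^ 2 + ‖x - x'‖ ^ 2)
    - ⟪p1, x - c⟫ - ⟪p2, x' - c⟫

theorem usc_comp_on {α β : Type*} [TopologicalSpace α] [TopologicalSpace β] {u : β → ℝ} {s : Set α}
    {B : Set β} (hu : UpperSemicontinuousOn u B) {φ : α → β} (hφ : Continuous φ)
    (hm : MapsTo φ s B) : UpperSemicontinuousOn (fun a => u (φ a)) s := by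
  intro a ha y hy
  have := hu (φ a) (hm ha) y hy
  exact (hφ.continuousWithinAt.tendsto_nhdsWithin hm).eventually this

theorem quadFun_exists_max [FiniteDimensional ℝ F] {u1 u2 : F → ℝ} {c : F} {r : ℝ} (hr : 0 < r)
    (h1 : UpperSemicontinuousOn u1 (Metric.closedBall c r))
    (h2 : UpperSemicontinuousOn u2 (Metric.closedBall c r)) {a : ℝ} (ha : 4 ≤ a) {p1 p2 : F}
    (hp1 : ‖p1‖ ≤ 1) (hp2 : ‖p2‖ ≤ 1) :
    ∃ z ∈ Metric.closedBall c r, ∃ z' ∈ Metric.closedBall c r, ∃ y y' : F,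
      ∀ w ∈ Metric.closedBall c r, ∀ w' ∈ Metric.closedBall c r, ∀ x x' : F,
        quadFun u1 u2 a c p1 p2 w w' x x' ≤ quadFun u1 u2 a c p1 p2 z z' y y' := by
  set B := Metric.closedBall c r with hB
  have hBc : IsCompact B := isCompact_closedBall c r
  have hcB : c ∈ B := Metric.mem_closedBall_self hr.le
  obtain ⟨m1, hm1, hM1⟩ := h1.exists_isMaxOn ⟨c, hcB⟩ hBc
  obtain ⟨m2, hm2, hM2⟩ := h2.exists_isMaxOn ⟨c, hcB⟩ hBc
  set M := u1 m1 + u2 m2 + 2 * a * r ^ 2 + 2 + |u1 c + u2 c| with hM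
  set R := |M| + 2 with hR
  have hR2 : 2 ≤ R := by rw [hR]; linarith [abs_nonneg M]
  -- bound outside
  have lin : ∀ w ∈ B, ∀ x p : F, ‖p‖ ≤ 1 →
      - (a / 2) * ‖w - x‖ ^ 2 - ⟪p, x - c⟫ ≤ a * r ^ 2 - ‖x - c‖ ^ 2 + ‖x - c‖ := by
    intro w hw x p hp
    have h3 : ‖w - c‖ ≤ r := by rwa [hB, mem_closedBall_iff_norm] at hw
    have h4 : ‖x - c‖ ≤ ‖w - x‖ + ‖w - c‖ := by
      have : x - c = -(w - x) + (w - c) := by abel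
      rw [this]; exact (norm_add_le _ _).trans (by rw [norm_neg])
    have h5 := (abs_le.mp (abs_real_inner_le_norm p (x - c))).1
    have h6 : ‖p‖ * ‖x - c‖ ≤ 1 * ‖x - c‖ := by gcongr
    have h7 : ‖x - c‖ ^ 2 ≤ 2 * ‖w - x‖ ^ 2 + 2 * r ^ 2 := by
      have : ‖x - c‖ ≤ ‖w - x‖ + r := by linarith
      nlinarith [norm_nonneg (x - c), sq_nonneg (‖w - x‖ - r)]
    nlinarith [sq_nonneg ‖w - x‖, sq_nonneg ‖x - c‖, norm_nonneg (x - c)]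
  have hout : ∀ w ∈ B, ∀ w' ∈ B, ∀ x x' : F, (R < ‖x - c‖ ∨ R < ‖x' - c‖) →
      quadFun u1 u2 a c p1 p2 w w' x x' ≤ u1 c + u2 c := by
    intro w hw w' hw' x x' hx
    have l1 := lin w hw x p1 hp1
    have l2 := lin w' hw' x' p2 hp2
    have b1 : u1 w ≤ u1 m1 := hM1 hw
    have b2 : u2 w' ≤ u2 m2 := hM2 hw'
    have b3 : 0 ≤ a / 2 * ‖x - x'‖ ^ 2 := by positivity
    have g : ∀ s : ℝ, R < s → M + 1 ≤ s ^ 2 - s + 1 := by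
      intro s hs
      have : M ≤ R := by rw [hR]; linarith [le_abs_self M]
      nlinarith
    have g' : ∀ s : ℝ, -1 ≤ s ^ 2 - s := fun s => by nlinarith [sq_nonneg (s - 1 / 2)]
    have b4 := neg_abs_le (u1 c + u2 c)
    unfold quadFun
    rcases hx with hx | hx
    · have := g _ hx; have := g' ‖x' - c‖; nlinarith
    · have := g _ hx; have := g' ‖x - c‖; nlinarith
  set R' := Metric.closedBall c R
  set S : Set ((F × F) × (F × F)) := (B ×ˢ B) ×ˢ (R' ×ˢ R') with hS
  have hSc : IsCompact S := (hBc.prod hBc).prod ((isCompact_closedBall c R).prod (isCompact_closedBall c R))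
  have hcR : c ∈ R' := Metric.mem_closedBall_self (by linarith)
  have hne : S.Nonempty := ⟨((c, c), (c, c)), ⟨⟨hcB, hcB⟩, ⟨hcR, hcR⟩⟩⟩
  have husc : UpperSemicontinuousOn (fun q : (F × F) × (F × F) =>
      quadFun u1 u2 a c p1 p2 q.1.1 q.1.2 q.2.1 q.2.2) S := by
    have e : (fun q : (F × F) × (F × F) => quadFun u1 u2 a c p1 p2 q.1.1 q.1.2 q.2.1 q.2.2)
        = fun q => (u1 q.1.1 + u2 q.1.2) +
          (- (a / 2 * (‖q.1.1 - q.2.1‖ ^ 2 + ‖q.1.2 - q.2.2‖ ^ 2 + ‖q.2.1 - q.2.2‖ ^ 2))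
            - ⟪p1, q.2.1 - c⟫ - ⟪p2, q.2.2 - c⟫) := by
      funext q; unfold quadFun; ring
    rw [e]
    refine UpperSemicontinuousOn.add (UpperSemicontinuousOn.add ?_ ?_) ?_
    · exact usc_comp_on h1 (by fun_prop) (fun q hq => hq.1.1)
    · exact usc_comp_on h2 (by fun_prop) (fun q hq => hq.1.2)
    · refine (Continuous.upperSemicontinuous ?_).upperSemicontinuousOn _
      fun_prop
  obtain ⟨q, hq, hmax⟩ := husc.exists_isMaxOn hne hSc
  refine ⟨q.1.1, hq.1.1, q.1.2, hq.1.2, q.2.1, q.2.2, fun w hw w' hw' x x' => ?_⟩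
  by_cases hx : R < ‖x - c‖ ∨ R < ‖x' - c‖
  · refine (hout w hw w' hw' x x' hx).trans ?_
    have := hmax (show ((c, c), (c, c)) ∈ S from ⟨⟨hcB, hcB⟩, ⟨hcR, hcR⟩⟩)
    simp only [Set.mem_ofPred_eq] at this
    refine le_trans (le_of_eq ?_) this
    unfold quadFun; simp
  · push Not at hx
    exact hmax (show ((w, w'), (x, x')) ∈ S from
      ⟨⟨hw, hw'⟩, ⟨mem_closedBall_iff_norm.mpr hx.1, mem_closedBall_iff_norm.mpr hx.2⟩⟩)

/-- sup-convolution facts -/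
theorem supconv_exists [FiniteDimensional ℝ F] {u : F → ℝ} {c : F} {r : ℝ} (hr : 0 < r)
    (h1 : UpperSemicontinuousOn u (Metric.closedBall c r)) (a : ℝ) :
    ∃ s : F → ℝ, (∀ y, ∃ z ∈ Metric.closedBall c r, s y = u z - a / 2 * ‖z - y‖ ^ 2) ∧
      ∀ y, ∀ z ∈ Metric.closedBall c r, u z - a / 2 * ‖z - y‖ ^ 2 ≤ s y := by
  have : ∀ y, ∃ z ∈ Metric.closedBall c r, ∀ w ∈ Metric.closedBall c r,
      u w - a / 2 * ‖w - y‖ ^ 2 ≤ u z - a / 2 * ‖z - y‖ ^ 2 := by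
    intro y
    have husc : UpperSemicontinuousOn (fun z => u z + (- (a / 2 * ‖z - y‖ ^ 2)))
        (Metric.closedBall c r) := by
      refine h1.add ?_
      refine (Continuous.upperSemicontinuous ?_).upperSemicontinuousOn _
      fun_prop
    obtain ⟨z, hz, hm⟩ := husc.exists_isMaxOn ⟨c, Metric.mem_closedBall_self hr.le⟩
      (isCompact_closedBall c r)
    refine ⟨z, hz, fun w hw => ?_⟩
    have := hm hw
    simp only [Set.mem_ofPred_eq] at this
    linarith
  choose Z hZ hZm using this
  exact ⟨fun y => u (Z y) - a / 2 * ‖Z y - y‖ ^ 2, fun y => ⟨Z y, hZ y, rfl⟩,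
    fun y z hz => hZm y z hz⟩

theorem twoSided_of_max {s u : F → ℝ} {c : F} {r a : ℝ} (ha : 0 < a)
    (hs2 : ∀ y, ∀ z ∈ Metric.closedBall c r, u z - a / 2 * ‖z - y‖ ^ 2 ≤ s y)
    {z y y' p : F} (hz : z ∈ Metric.closedBall c r) (hsy : s y = u z - a / 2 * ‖z - y‖ ^ 2)
    (hmax : ∀ x, s x - a / 2 * ‖x - y'‖ ^ 2 - ⟪p, x - c⟫ ≤ s y - a / 2 * ‖y - y'‖ ^ 2 - ⟪p, y - c⟫) :
    TwoSided s (a / 2) y (a • (y - y') + p) := by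
  have up : ∀ h, s (y + h) ≤ s y + ⟪a • (y - y') + p, h⟫ + a / 2 * ‖h‖ ^ 2 := by
    intro h
    have := hmax (y + h)
    have e1 : y + h - y' = (y - y') + h := by abel
    have e2 : y + h - c = (y - c) + h := by abel
    rw [e1, e2, norm_add_sq_real, inner_add_right] at this
    rw [inner_add_left, real_inner_smul_left]
    linarith
  have lo : ∀ h, s y + ⟪a • (z - y), h⟫ - a / 2 * ‖h‖ ^ 2 ≤ s (y + h) := by
    intro h
    have := hs2 (y + h) z hz
    have e1 : z - (y + h) = (z - y) - h := by abel
    rw [e1, norm_sub_sq_real] at this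
    rw [real_inner_smul_left, hsy]
    linarith
  have heq : a • (z - y) = a • (y - y') + p := by
    set q := a • (z - y) - (a • (y - y') + p) with hq
    by_contra hne
    have hq0 : 0 < ‖q‖ := norm_pos_iff.mpr (sub_ne_zero.mpr hne)
    have h1 := up ((1 / (2 * a)) • q)
    have h2 := lo ((1 / (2 * a)) • q)
    have h3 : ⟪a • (z - y), (1 / (2 * a)) • q⟫ - ⟪a • (y - y') + p, (1 / (2 * a)) • q⟫
        = (1 / (2 * a)) * ‖q‖ ^ 2 := by
      rw [← inner_sub_left, ← hq, real_inner_smul_right, real_inner_self_eq_norm_sq]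
    have h4 : ‖(1 / (2 * a)) • q‖ ^ 2 = (1 / (2 * a)) ^ 2 * ‖q‖ ^ 2 := by
      rw [norm_smul, mul_pow, Real.norm_eq_abs, sq_abs]
    rw [h4] at h1 h2
    have h5 : a / 2 * ((1 / (2 * a)) ^ 2 * ‖q‖ ^ 2) = (1 / (2 * a)) * ‖q‖ ^ 2 / 4 := by
      field_simp; ring
    have h6 : 0 < (1 / (2 * a)) * ‖q‖ ^ 2 := by positivity
    linarith
  intro h
  rw [abs_le]
  have l := lo h
  rw [heq] at l
  constructor <;> linarith [up h]

theorem jet_of_supconv {s u : F → ℝ} {c : F} {r a : ℝ}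
    (hs2 : ∀ y, ∀ z ∈ Metric.closedBall c r, u z - a / 2 * ‖z - y‖ ^ 2 ≤ s y)
    {z y : F} (hz : z ∈ Metric.ball c r) (hsy : s y = u z - a / 2 * ‖z - y‖ ^ 2)
    {l : F →L[ℝ] ℝ} {Q : F →L[ℝ] F →L[ℝ] ℝ} (hJ : UJet s y l Q) : UJet u z l Q := by
  intro ε hε
  have : ∀ᶠ h in 𝓝 (0 : F), z + h ∈ Metric.ball c r := by
    have ht : Tendsto (fun h : F => z + h) (𝓝 0) (𝓝 z) := by
      have : Continuous fun h : F => z + h := by fun_prop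
      simpa using this.tendsto 0
    exact ht.eventually (Metric.isOpen_ball.mem_nhds hz)
  filter_upwards [hJ ε hε, this] with h h1 h2
  have := hs2 (y + h) (z + h) (Metric.ball_subset_closedBall h2)
  rw [show z + h - (y + h) = z - y by abel] at this
  linarith

theorem lipschitz_null [FiniteDimensional ℝ F] [MeasurableSpace F] [BorelSpace F] {K : ℝ≥0}
    {P : F × F → F × F} (hP : LipschitzWith K P)
    {N : Set (F × F)} (hN : Measure.hausdorffMeasure (Module.finrank ℝ (F × F)) N = 0) :
    Measure.hausdorffMeasure (Module.finrank ℝ (F × F)) (P '' N) = 0 := by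
  have := hP.hausdorffMeasure_image_le (d := (Module.finrank ℝ (F × F) : ℝ)) (by positivity) N
  rw [hN, mul_zero] at this
  exact le_antisymm this zero_le

theorem sums_fixed [FiniteDimensional ℝ F] [MeasurableSpace F] [BorelSpace F]
    {u1 u2 : F → ℝ} {c : F} {r : ℝ} (hr : 0 < r)
    (h1 : UpperSemicontinuousOn u1 (Metric.closedBall c r))
    (h2 : UpperSemicontinuousOn u2 (Metric.closedBall c r)) {a : ℝ} (ha : 4 ≤ a) {δ : ℝ}
    (hδ : 0 < δ) (hδ1 : δ ≤ 1) :
    ∃ p1 p2 : F, ‖p1‖ ≤ δ ∧ ‖p2‖ ≤ δ ∧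
    ∃ z ∈ Metric.closedBall c r, ∃ z' ∈ Metric.closedBall c r, ∃ y y' : F,
      (∀ w ∈ Metric.closedBall c r, ∀ w' ∈ Metric.closedBall c r, ∀ x x' : F,
        quadFun u1 u2 a c p1 p2 w w' x x' ≤ quadFun u1 u2 a c p1 p2 z z' y y') ∧
      ∃ Q1 Q2 : F →L[ℝ] F →L[ℝ] ℝ,
        (z ∈ Metric.ball c r → UJet u1 z (innerSL ℝ (a • (y - y') + p1)) Q1) ∧
        (z' ∈ Metric.ball c r → UJet u2 z' (innerSL ℝ (a • (y' - y) + p2)) Q2) ∧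
        ∀ v v', Q1 v v + Q2 v' v' ≤ a * ‖v - v'‖ ^ 2 := by
  have ha0 : 0 < a := by linarith
  obtain ⟨s1, hs1, hs1'⟩ := supconv_exists hr h1 a
  obtain ⟨s2, hs2, hs2'⟩ := supconv_exists hr h2 a
  -- consequences of maximality
  have cons : ∀ {p1 p2 z z' y y' : F}, z ∈ Metric.closedBall c r → z' ∈ Metric.closedBall c r →
      (∀ w ∈ Metric.closedBall c r, ∀ w' ∈ Metric.closedBall c r, ∀ x x' : F,
        quadFun u1 u2 a c p1 p2 w w' x x' ≤ quadFun u1 u2 a c p1 p2 z z' y y') →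
      s1 y = u1 z - a / 2 * ‖z - y‖ ^ 2 ∧ s2 y' = u2 z' - a / 2 * ‖z' - y'‖ ^ 2 ∧
      ∀ x x', s1 x + s2 x' - a / 2 * ‖x - x'‖ ^ 2 - ⟪p1, x - c⟫ - ⟪p2, x' - c⟫
        ≤ s1 y + s2 y' - a / 2 * ‖y - y'‖ ^ 2 - ⟪p1, y - c⟫ - ⟪p2, y' - c⟫ := by
    intro p1 p2 z z' y y' hz hz' hm
    have A : s1 y = u1 z - a / 2 * ‖z - y‖ ^ 2 := by
      apply le_antisymm _ (hs1' y z hz)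
      obtain ⟨w, hw, hws⟩ := hs1 y
      have := hm w hw z' hz' y y'
      unfold quadFun at this
      rw [hws]; linarith
    have A' : s2 y' = u2 z' - a / 2 * ‖z' - y'‖ ^ 2 := by
      apply le_antisymm _ (hs2' y' z' hz')
      obtain ⟨w, hw, hws⟩ := hs2 y'
      have := hm z hz w hw y y'
      unfold quadFun at this
      rw [hws]; linarith
    refine ⟨A, A', fun x x' => ?_⟩
    obtain ⟨w, hw, hws⟩ := hs1 x
    obtain ⟨w', hw', hws'⟩ := hs2 x'
    have := hm w hw w' hw' x x'
    unfold quadFun at this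
    rw [A, A', hws, hws']; linarith
  have two : ∀ {p1 p2 z z' y y' : F}, z ∈ Metric.closedBall c r → z' ∈ Metric.closedBall c r →
      (∀ w ∈ Metric.closedBall c r, ∀ w' ∈ Metric.closedBall c r, ∀ x x' : F,
        quadFun u1 u2 a c p1 p2 w w' x x' ≤ quadFun u1 u2 a c p1 p2 z z' y y') →
      TwoSided s1 (a / 2) y (a • (y - y') + p1) ∧ TwoSided s2 (a / 2) y' (a • (y' - y) + p2) := by
    intro p1 p2 z z' y y' hz hz' hm
    obtain ⟨A, A', B⟩ := cons hz hz' hm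
    refine ⟨twoSided_of_max ha0 hs1' hz A fun x => ?_, twoSided_of_max ha0 hs2' hz' A' fun x => ?_⟩
    · linarith [B x y']
    · have := B y x
      rw [norm_sub_rev y x, norm_sub_rev y y'] at this
      linarith
  obtain ⟨K1, G1, hG1, hG1p⟩ := TwoSided.exists_lip s1 (C := a / 2) (by positivity)
  obtain ⟨K2, G2, hG2, hG2p⟩ := TwoSided.exists_lip s2 (C := a / 2) (by positivity)
  set μ : Measure F := Measure.hausdorffMeasure (Module.finrank ℝ F) with hμ
  obtain ⟨N1, hN1, hA1⟩ := TwoSided.alexandrov μ s1 (C := a / 2) (by positivity)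
  obtain ⟨N2, hN2, hA2⟩ := TwoSided.alexandrov μ s2 (C := a / 2) (by positivity)
  set ν : Measure (F × F) := Measure.hausdorffMeasure (Module.finrank ℝ (F × F)) with hν
  -- null set in the product
  have hnull : ν (N1 ×ˢ univ ∪ univ ×ˢ N2) = 0 := by
    have hac : ν ≪ μ.prod μ := Measure.absolutelyContinuous_isAddHaarMeasure _ _
    apply hac
    rw [measure_union_null_iff]
    constructor
    · rw [Measure.prod_prod, hN1, zero_mul]
    · rw [Measure.prod_prod, hN2, mul_zero]
  set P : F × F → F × F := fun q => (G1 q.1 - a • (q.1 - q.2), G2 q.2 - a • (q.2 - q.1)) with hPdef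
  have hPl : ∃ K, LipschitzWith K P := by
    have l1 : LipschitzWith _ (fun q : F × F => G1 q.1) := hG1.comp LipschitzWith.prod_fst
    have l2 : LipschitzWith _ (fun q : F × F => G2 q.2) := hG2.comp LipschitzWith.prod_snd
    have l3 : LipschitzWith _ (fun q : F × F => a • (q.1 - q.2)) :=
      (a • (ContinuousLinearMap.fst ℝ F F - ContinuousLinearMap.snd ℝ F F)).lipschitz
    have l4 : LipschitzWith _ (fun q : F × F => a • (q.2 - q.1)) :=
      (a • (ContinuousLinearMap.snd ℝ F F - ContinuousLinearMap.fst ℝ F F)).lipschitz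
    exact ⟨_, (l1.sub l3).prodMk (l2.sub l4)⟩
  obtain ⟨K, hPl⟩ := hPl
  have himg := lipschitz_null hPl hnull
  have hball : 0 < ν (Metric.ball (0 : F × F) δ) := Metric.measure_ball_pos ν _ hδ
  obtain ⟨p, hp, hpN⟩ : ∃ p ∈ Metric.ball (0 : F × F) δ, p ∉ P '' (N1 ×ˢ univ ∪ univ ×ˢ N2) := by
    by_contra hcon
    push Not at hcon
    exact absurd (measure_mono_null hcon himg) hball.ne'
  have hpn : ‖p‖ < δ := by simpa using hp
  have hp1 : ‖p.1‖ ≤ δ := (norm_fst_le p).trans hpn.le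
  have hp2 : ‖p.2‖ ≤ δ := (norm_snd_le p).trans hpn.le
  obtain ⟨z, hz, z', hz', y, y', hm⟩ := quadFun_exists_max hr h1 h2 ha (hp1.trans hδ1) (hp2.trans hδ1)
  obtain ⟨A, A', B⟩ := cons hz hz' hm
  obtain ⟨T1, T2⟩ := two hz hz' hm
  have hPy : P (y, y') = p := by
    rw [hPdef]
    ext1
    · simp only [hG1p _ _ T1]; abel
    · simp only [hG2p _ _ T2]; abel
  have hyN : (y, y') ∉ N1 ×ˢ univ ∪ univ ×ˢ N2 := fun h => hpN ⟨_, h, hPy⟩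
  simp only [Set.mem_union, Set.mem_prod, Set.mem_univ, and_true, true_and, not_or] at hyN
  obtain ⟨Q1, U1, L1⟩ := hA1 _ _ hyN.1 T1
  obtain ⟨Q2, U2, L2⟩ := hA2 _ _ hyN.2 T2
  refine ⟨p.1, p.2, hp1, hp2, z, hz, z', hz', y, y', hm, Q1, Q2,
    fun hzb => jet_of_supconv hs1' hzb A U1, fun hzb => jet_of_supconv hs2' hzb A' U2, ?_⟩
  intro v v'
  -- second order condition
  have key : ∀ ε : ℝ, 0 < ε → Q1 v v + Q2 v' v' ≤ a * ‖v - v'‖ ^ 2 + 2 * ε * (‖v‖ ^ 2 + ‖v'‖ ^ 2) := by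
    intro ε hε
    have t1 : Tendsto (fun s : ℝ => s • v) (𝓝[>] 0) (𝓝 0) := by
      have : Continuous fun s : ℝ => s • v := by fun_prop
      have := this.tendsto 0
      rw [zero_smul] at this
      exact this.mono_left nhdsWithin_le_nhds
    have t2 : Tendsto (fun s : ℝ => s • v') (𝓝[>] 0) (𝓝 0) := by
      have : Continuous fun s : ℝ => s • v' := by fun_prop
      have := this.tendsto 0
      rw [zero_smul] at this
      exact this.mono_left nhdsWithin_le_nhds
    have ev := ((t1.eventually (L1 ε hε)).and (t2.eventually (L2 ε hε))).and self_mem_nhdsWithin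
    obtain ⟨s, ⟨e1, e2⟩, hs⟩ := ev.exists
    have hs : 0 < s := hs
    have b := B (y + s • v) (y' + s • v')
    rw [show y + s • v - (y' + s • v') = (y - y') + s • (v - v') by rw [smul_sub]; abel,
      show y + s • v - c = (y - c) + s • v by abel, show y' + s • v' - c = (y' - c) + s • v' by abel,
      norm_add_sq_real, inner_add_right, inner_add_right] at b
    simp only [innerSL_apply_apply, inner_add_left, real_inner_smul_left, real_inner_smul_right,
      map_smul, ContinuousLinearMap.smul_apply, smul_eq_mul, norm_smul, Real.norm_eq_abs, mul_pow, sq_abs]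
      at e1 e2 b
    have e3 : ⟪y' - y, v'⟫ = - ⟪y - y', v'⟫ := by rw [← inner_neg_left, neg_sub]
    rw [inner_sub_right] at b
    rw [e3] at e2
    have : s ^ 2 * (Q1 v v + Q2 v' v') ≤ s ^ 2 * (a * ‖v - v'‖ ^ 2 + 2 * ε * (‖v‖ ^ 2 + ‖v'‖ ^ 2)) := by
      nlinarith
    exact le_of_mul_le_mul_left this (by positivity)
  by_contra hcon
  push Not at hcon
  set D := Q1 v v + Q2 v' v' - a * ‖v - v'‖ ^ 2 with hD
  have hD0 : 0 < D := by linarith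
  have hS : 0 ≤ ‖v‖ ^ 2 + ‖v'‖ ^ 2 := by positivity
  have := key (D / (4 * (‖v‖ ^ 2 + ‖v'‖ ^ 2 + 1))) (by positivity)
  have h8 : 2 * (D / (4 * (‖v‖ ^ 2 + ‖v'‖ ^ 2 + 1))) * (‖v‖ ^ 2 + ‖v'‖ ^ 2) ≤ D / 2 := by
    rw [show 2 * (D / (4 * (‖v‖ ^ 2 + ‖v'‖ ^ 2 + 1))) * (‖v‖ ^ 2 + ‖v'‖ ^ 2)
      = (D / 2) * ((‖v‖ ^ 2 + ‖v'‖ ^ 2) / (‖v‖ ^ 2 + ‖v'‖ ^ 2 + 1)) by field_simp; ring]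
    apply mul_le_of_le_one_right (by positivity)
    rw [div_le_one (by positivity)]; linarith
  linarith

end Sums

section SumsLimit

variable {F : Type*} [NormedAddCommGroup F] [InnerProductSpace ℝ F]

theorem sums_inner [FiniteDimensional ℝ F] [MeasurableSpace F] [BorelSpace F]
    {u1 u2 : F → ℝ} {c : F} {r : ℝ} (hr : 0 < r)
    (h1 : UpperSemicontinuousOn u1 (Metric.closedBall c r))
    (h2 : UpperSemicontinuousOn u2 (Metric.closedBall c r)) {δ : ℝ} (hδ : 0 < δ)
    (hmax : ∀ z ∈ Metric.closedBall c r, u1 z + u2 z ≤ u1 c + u2 c - δ * ‖z - c‖ ^ 2)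
    {ε : ℝ} (hε : 0 < ε) :
    ∃ (a : ℝ) (z z' : F) (l1 l2 : F →L[ℝ] ℝ) (Q1 Q2 : F →L[ℝ] F →L[ℝ] ℝ), 0 < a ∧
      ‖z - c‖ < ε ∧ ‖z' - c‖ < ε ∧ u1 c - ε < u1 z ∧ UJet u1 z l1 Q1 ∧ UJet u2 z' l2 Q2 ∧
      ‖l1 + l2‖ ≤ ε ∧ ‖l2‖ * ‖z - z'‖ ≤ ε ∧ a * ‖z - z'‖ ^ 2 ≤ ε ∧
      ∀ v v', Q1 v v + Q2 v' v' ≤ a * ‖v - v'‖ ^ 2 := by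
  have hcB : c ∈ Metric.closedBall c r := Metric.mem_closedBall_self hr.le
  have hBc : IsCompact (Metric.closedBall c r) := isCompact_closedBall c r
  obtain ⟨m1, hm1, hM1⟩ := h1.exists_isMaxOn ⟨c, hcB⟩ hBc
  obtain ⟨m2, hm2, hM2⟩ := h2.exists_isMaxOn ⟨c, hcB⟩ hBc
  have hseq := fun n : ℕ => sums_fixed hr h1 h2 (a := (n : ℝ) + 4)
    (by have : (0 : ℝ) ≤ n := n.cast_nonneg; linarith) (δ := 1 / ((n : ℝ) + 4))
    (by positivity) (by rw [div_le_one (by positivity)]; linarith [(n.cast_nonneg : (0 : ℝ) ≤ n)])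
  choose p1 p2 hp1 hp2 z hz z' hz' y y' hm Q1 Q2 hJ1 hJ2 hQ using hseq
  set S : ℕ → ℝ := fun n => ‖z n - y n‖ ^ 2 + ‖z' n - y' n‖ ^ 2 + ‖y n - y' n‖ ^ 2 with hS
  have hS0 : ∀ n, 0 ≤ S n := fun n => by positivity
  have main : ∀ n : ℕ, ((n : ℝ) + 4) / 2 * S n ≤ u1 (z n) + u2 (z' n) - (u1 c + u2 c) +
      1 / ((n : ℝ) + 4) * (2 * (S n + 1 + r)) := by
    intro n
    have a1 := hm n c hcB c hcB c c
    unfold quadFun at a1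
    simp only [sub_self, norm_zero, inner_zero_right] at a1
    have yb : ∀ w x : F, w ∈ Metric.closedBall c r → ‖w - x‖ ^ 2 ≤ S n → ‖x - c‖ ≤ S n + 1 + r := by
      intro w x hw hx
      rw [mem_closedBall_iff_norm] at hw
      have : x - c = -(w - x) + (w - c) := by abel
      rw [this]
      refine (norm_add_le _ _).trans ?_
      rw [norm_neg]
      nlinarith [sq_nonneg (‖w - x‖ - 1 / 2)]
    have y1 := yb (z n) (y n) (hz n) (by simp only [hS]; nlinarith [sq_nonneg ‖z' n - y' n‖, sq_nonneg ‖y n - y' n‖])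
    have y2 := yb (z' n) (y' n) (hz' n) (by simp only [hS]; nlinarith [sq_nonneg ‖z n - y n‖, sq_nonneg ‖y n - y' n‖])
    have i1 := (abs_le.mp (abs_real_inner_le_norm (p1 n) (y n - c))).1
    have i2 := (abs_le.mp (abs_real_inner_le_norm (p2 n) (y' n - c))).1
    have j1 : ‖p1 n‖ * ‖y n - c‖ ≤ 1 / ((n : ℝ) + 4) * (S n + 1 + r) :=
      mul_le_mul (hp1 n) y1 (norm_nonneg _) (by positivity)
    have j2 : ‖p2 n‖ * ‖y' n - c‖ ≤ 1 / ((n : ℝ) + 4) * (S n + 1 + r) :=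
      mul_le_mul (hp2 n) y2 (norm_nonneg _) (by positivity)
    have : ((n : ℝ) + 4) / 2 * S n = ((n : ℝ) + 4) / 2 * (‖z n - y n‖ ^ 2 + ‖z' n - y' n‖ ^ 2 + ‖y n - y' n‖ ^ 2) := rfl
    linarith
  have hub : ∀ n, u1 (z n) + u2 (z' n) ≤ u1 m1 + u2 m2 := fun n => add_le_add (hM1 (hz n)) (hM2 (hz' n))
  set C1 := u1 m1 + u2 m2 - (u1 c + u2 c) + (1 + r) with hC1
  have hinv : Tendsto (fun n : ℕ => 1 / ((n : ℝ) + 4)) atTop (𝓝 0) := by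
    have h3 : Tendsto (fun n : ℕ => (n : ℝ) + 4) atTop atTop :=
      tendsto_atTop_add_const_right _ _ tendsto_natCast_atTop_atTop
    exact tendsto_const_nhds.div_atTop h3
  have hSle : ∀ n : ℕ, S n ≤ C1 * (1 / ((n : ℝ) + 4)) * 4 := by
    intro n
    have hn : (0 : ℝ) ≤ n := n.cast_nonneg
    have d1 : 1 / ((n : ℝ) + 4) ≤ 1 / 4 := by gcongr; linarith
    have d2 : 1 / ((n : ℝ) + 4) * (2 * (S n + 1 + r)) ≤ 1 / 4 * (2 * (S n + 1 + r)) := by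
      have := hS0 n
      gcongr
    have d3 : ((n : ℝ) + 4) / 4 * S n ≤ C1 := by
      have := main n; have := hub n; have := hS0 n
      nlinarith
    have : C1 * (1 / ((n : ℝ) + 4)) * 4 = C1 / (((n : ℝ) + 4) / 4) := by field_simp
    rw [this, le_div_iff₀ (by positivity)]
    linarith
  have hSt : Tendsto S atTop (𝓝 0) := by
    refine squeeze_zero hS0 hSle ?_
    have := (hinv.const_mul C1).mul_const 4
    simpa using this
  obtain ⟨zb, hzb, φ, hφ, hzt⟩ := hBc.tendsto_subseq hz
  have hφt := hφ.tendsto_atTop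
  have hSφ : Tendsto (fun n => S (φ n)) atTop (𝓝 0) := hSt.comp hφt
  have hiφ : Tendsto (fun n : ℕ => 1 / ((φ n : ℝ) + 4)) atTop (𝓝 0) := hinv.comp hφt
  have hzz : ∀ n, ‖z n - z' n‖ ^ 2 ≤ 3 * S n := by
    intro n
    have e : z n - z' n = (z n - y n) + (y n - y' n) + -(z' n - y' n) := by abel
    have t : ‖z n - z' n‖ ≤ ‖z n - y n‖ + ‖y n - y' n‖ + ‖z' n - y' n‖ := by
      rw [e]
      refine (norm_add_le _ _).trans ?_
      rw [norm_neg]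
      gcongr
      exact norm_add_le _ _
    have : ‖z n - z' n‖ ^ 2 ≤ (‖z n - y n‖ + ‖y n - y' n‖ + ‖z' n - y' n‖) ^ 2 := by gcongr
    refine this.trans ?_
    simp only [hS]
    nlinarith [sq_nonneg (‖z n - y n‖ - ‖y n - y' n‖), sq_nonneg (‖z n - y n‖ - ‖z' n - y' n‖),
      sq_nonneg (‖y n - y' n‖ - ‖z' n - y' n‖)]
  have hz't : Tendsto (fun n => z' (φ n)) atTop (𝓝 zb) := by
    have hd : Tendsto (fun n => ‖z (φ n) - z' (φ n)‖) atTop (𝓝 0) := by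
      have h3 : Tendsto (fun n => ‖z (φ n) - z' (φ n)‖ ^ 2) atTop (𝓝 0) := by
        refine squeeze_zero (fun n => by positivity) (fun n => hzz (φ n)) ?_
        simpa using hSφ.const_mul 3
      have := h3.sqrt
      simpa using this
    have h4 : Tendsto (fun n => z (φ n) - z' (φ n)) atTop (𝓝 0) := tendsto_zero_iff_norm_tendsto_zero.mpr hd
    have := hzt.sub h4
    simpa using this
  have hrest : Tendsto (fun n : ℕ => 1 / ((φ n : ℝ) + 4) * (2 * (S (φ n) + 1 + r))) atTop (𝓝 0) := by
    have := hiφ.mul (((hSφ.add_const 1).add_const r).const_mul 2)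
    simpa using this
  have ev1 : ∀ η > 0, ∀ᶠ n in atTop, u1 (z (φ n)) < u1 zb + η := by
    intro η hη
    have h5 := h1 zb hzb (u1 zb + η) (by linarith)
    have h6 : Tendsto (fun n => z (φ n)) atTop (𝓝[Metric.closedBall c r] zb) :=
      tendsto_nhdsWithin_iff.mpr ⟨hzt, Eventually.of_forall fun n => hz _⟩
    exact h6.eventually h5
  have ev2 : ∀ η > 0, ∀ᶠ n in atTop, u2 (z' (φ n)) < u2 zb + η := by
    intro η hη
    have h5 := h2 zb hzb (u2 zb + η) (by linarith)
    have h6 : Tendsto (fun n => z' (φ n)) atTop (𝓝[Metric.closedBall c r] zb) :=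
      tendsto_nhdsWithin_iff.mpr ⟨hz't, Eventually.of_forall fun n => hz' _⟩
    exact h6.eventually h5
  have ev3 : ∀ η > 0, ∀ᶠ n in atTop, 1 / ((φ n : ℝ) + 4) * (2 * (S (φ n) + 1 + r)) < η :=
    fun η hη => hrest.eventually_lt_const hη
  have hzbc : zb = c := by
    by_contra hne
    have hpos : 0 < δ * ‖zb - c‖ ^ 2 := by
      have : 0 < ‖zb - c‖ := norm_pos_iff.mpr (sub_ne_zero.mpr hne)
      positivity
    set η := δ * ‖zb - c‖ ^ 2 / 4 with hη
    obtain ⟨n, ⟨e1, e2⟩, e3⟩ := (((ev1 η (by positivity)).and (ev2 η (by positivity))).and (ev3 η (by positivity))).exists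
    have k1 := main (φ n)
    have k2 : 0 ≤ ((φ n : ℝ) + 4) / 2 * S (φ n) := mul_nonneg (by positivity) (hS0 _)
    have k3 := hmax zb hzb
    linarith
  subst hzbc
  set η := ε / 40 with hη
  have hη0 : 0 < η := by positivity
  have hradius : 0 < min r ε := lt_min hr hε
  have ev4 : ∀ᶠ n in atTop, ‖z (φ n) - zb‖ < min r ε := by
    have := (hzt.sub_const zb).norm
    simp only [sub_self, norm_zero] at this
    exact this.eventually_lt_const hradius
  have ev5 : ∀ᶠ n in atTop, ‖z' (φ n) - zb‖ < min r ε := by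
    have := (hz't.sub_const zb).norm
    simp only [sub_self, norm_zero] at this
    exact this.eventually_lt_const hradius
  have ev6 : ∀ᶠ n in atTop, 1 / ((φ n : ℝ) + 4) < min η 1 :=
    hiφ.eventually_lt_const (lt_min hη0 one_pos)
  have ev7 : ∀ᶠ n in atTop, 3 * S (φ n) < η := by
    have := hSφ.const_mul 3
    rw [mul_zero] at this
    exact this.eventually_lt_const hη0
  obtain ⟨n, ⟨⟨⟨⟨⟨e1, e2⟩, e3⟩, e4⟩, e5⟩, e6⟩, e7⟩ := ((((((ev1 η hη0).and (ev2 η hη0)).and (ev3 η hη0)).and ev4).and ev5).and ev6 |>.and ev7).exists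
  set k := φ n with hk
  have k1 := main k
  have k2 : 0 ≤ ((k : ℝ) + 4) / 2 * S k := mul_nonneg (by positivity) (hS0 _)
  have hap : 0 < ((k : ℝ) + 4) := by positivity
  have aS : ((k : ℝ) + 4) * S k ≤ 6 * η := by linarith
  have zz := hzz k
  refine ⟨(k : ℝ) + 4, z k, z' k, _, _, Q1 k, Q2 k, hap, e4.trans_le (min_le_right _ _),
    e5.trans_le (min_le_right _ _), by linarith, hJ1 k (mem_ball_iff_norm.mpr (e4.trans_le (min_le_left _ _))),
    hJ2 k (mem_ball_iff_norm.mpr (e5.trans_le (min_le_left _ _))), ?_, ?_, ?_, hQ k⟩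
  · rw [← map_add, innerSL_apply_norm]
    have : ((k : ℝ) + 4) • (y k - y' k) + p1 k + (((k : ℝ) + 4) • (y' k - y k) + p2 k) = p1 k + p2 k := by
      rw [← neg_sub (y k) (y' k), smul_neg]; abel
    rw [this]
    have := hp1 k; have := hp2 k
    have := e6.trans_le (min_le_left _ _)
    refine (norm_add_le _ _).trans ?_
    linarith
  · rw [innerSL_apply_norm]
    have n1 : ‖((k : ℝ) + 4) • (y' k - y k) + p2 k‖ ≤ ((k : ℝ) + 4) * ‖y k - y' k‖ + 1 / ((k : ℝ) + 4) := by
      refine (norm_add_le _ _).trans ?_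
      rw [norm_smul, Real.norm_eq_abs, abs_of_pos hap, norm_sub_rev (y' k)]
      linarith [hp2 k]
    have n2 : ‖y k - y' k‖ ^ 2 ≤ S k := by
      simp only [hS]; nlinarith [sq_nonneg ‖z k - y k‖, sq_nonneg ‖z' k - y' k‖]
    have n3 : ‖y k - y' k‖ * ‖z k - z' k‖ ≤ 2 * S k := by
      nlinarith [sq_nonneg (‖y k - y' k‖ - ‖z k - z' k‖)]
    have n4 : ‖z k - z' k‖ ≤ 2 * min r ε := by
      have : z k - z' k = (z k - zb) - (z' k - zb) := by abel
      rw [this]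
      refine (norm_sub_le _ _).trans ?_
      linarith
    have n5 : ‖z k - z' k‖ ≤ 2 * ε := n4.trans (by linarith [min_le_right r ε])
    have n6 : 1 / ((k : ℝ) + 4) ≤ 1 / 4 := by gcongr; linarith [(k.cast_nonneg : (0:ℝ) ≤ k)]
    calc _ ≤ (((k : ℝ) + 4) * ‖y k - y' k‖ + 1 / ((k : ℝ) + 4)) * ‖z k - z' k‖ := by gcongr
      _ = ((k : ℝ) + 4) * (‖y k - y' k‖ * ‖z k - z' k‖) + 1 / ((k : ℝ) + 4) * ‖z k - z' k‖ := by ring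
      _ ≤ ((k : ℝ) + 4) * (2 * S k) + 1 / 4 * ‖z k - z' k‖ := by gcongr
      _ ≤ ε := by linarith
  · have : ((k : ℝ) + 4) * ‖z k - z' k‖ ^ 2 ≤ ((k : ℝ) + 4) * (3 * S k) := by gcongr
    linarith

end SumsLimit

section SumsGeneral

variable {E : Type*} [NormedAddCommGroup E] [NormedSpace ℝ E]

theorem UJet.of_equiv {F : Type*} [NormedAddCommGroup F] [NormedSpace ℝ F] (e : E ≃L[ℝ] F)
    {u : E → ℝ} {z : F} {l : F →L[ℝ] ℝ} {Q : F →L[ℝ] F →L[ℝ] ℝ}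
    (h : UJet (fun x => u (e.symm x)) z l Q) :
    UJet u (e.symm z) (l.comp (e : E →L[ℝ] F))
      (((ContinuousLinearMap.compL ℝ E F ℝ).flip (e : E →L[ℝ] F)).comp (Q.comp (e : E →L[ℝ] F))) := by
  intro ε hε
  set K := ‖(e : E →L[ℝ] F)‖ + 1 with hK
  have hK0 : 0 < K := by positivity
  have ht : Tendsto (fun h : E => e h) (𝓝 0) (𝓝 0) := by
    have := e.continuous.tendsto 0
    rwa [map_zero] at this
  filter_upwards [ht.eventually (h (ε / K ^ 2) (by positivity))] with x hx
  simp only [map_add, ContinuousLinearEquiv.symm_apply_apply] at hx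
  have h1 : ‖e x‖ ≤ K * ‖x‖ := by
    refine ((e : E →L[ℝ] F).le_opNorm x).trans ?_
    gcongr; linarith
  have h2 : ε / K ^ 2 * ‖e x‖ ^ 2 ≤ ε * ‖x‖ ^ 2 := by
    calc ε / K ^ 2 * ‖e x‖ ^ 2 ≤ ε / K ^ 2 * (K * ‖x‖) ^ 2 := by gcongr
      _ = ε * ‖x‖ ^ 2 := by field_simp
  simp only [ContinuousLinearMap.comp_apply, ContinuousLinearMap.flip_apply,
    ContinuousLinearMap.compL_apply, ContinuousLinearEquiv.coe_coe]
  linarith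

theorem sums_general [FiniteDimensional ℝ E]
    {u1 u2 : E → ℝ} {c : E} {r : ℝ} (hr : 0 < r)
    (h1 : UpperSemicontinuousOn u1 (Metric.closedBall c r))
    (h2 : UpperSemicontinuousOn u2 (Metric.closedBall c r)) {δ : ℝ} (hδ : 0 < δ)
    (hmax : ∀ z ∈ Metric.closedBall c r, u1 z + u2 z ≤ u1 c + u2 c - δ * ‖z - c‖ ^ 2)
    {ε : ℝ} (hε : 0 < ε) :
    ∃ (a : ℝ) (z z' : E) (l1 l2 : E →L[ℝ] ℝ) (Q1 Q2 : E →L[ℝ] E →L[ℝ] ℝ), 0 < a ∧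
      ‖z - c‖ < ε ∧ ‖z' - c‖ < ε ∧ u1 c - ε < u1 z ∧ UJet u1 z l1 Q1 ∧ UJet u2 z' l2 Q2 ∧
      ‖l1 + l2‖ ≤ ε ∧ ‖l2‖ * ‖z - z'‖ ≤ ε ∧ a * ‖z - z'‖ ^ 2 ≤ ε ∧
      ∀ v v', Q1 v v + Q2 v' v' ≤ a * ‖v - v'‖ ^ 2 := by
  set e : E ≃L[ℝ] EuclideanSpace ℝ (Fin (Module.finrank ℝ E)) := toEuclidean with he
  set K := ‖(e : E →L[ℝ] EuclideanSpace ℝ (Fin (Module.finrank ℝ E)))‖ + ‖(e.symm : EuclideanSpace ℝ (Fin (Module.finrank ℝ E)) →L[ℝ] E)‖ + 1 with hK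
  have hK1 : 1 ≤ K := by
    have := norm_nonneg (e : E →L[ℝ] EuclideanSpace ℝ (Fin (Module.finrank ℝ E)))
    have := norm_nonneg (e.symm : EuclideanSpace ℝ (Fin (Module.finrank ℝ E)) →L[ℝ] E)
    linarith
  have hK0 : 0 < K := by linarith
  have ne : ∀ x, ‖e x‖ ≤ K * ‖x‖ := fun x => by
    refine ((e : E →L[ℝ] EuclideanSpace ℝ (Fin (Module.finrank ℝ E))).le_opNorm x).trans ?_
    gcongr; rw [hK]; linarith [norm_nonneg (e.symm : EuclideanSpace ℝ (Fin (Module.finrank ℝ E)) →L[ℝ] E)]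
  have ns : ∀ x, ‖e.symm x‖ ≤ K * ‖x‖ := fun x => by
    refine ((e.symm : EuclideanSpace ℝ (Fin (Module.finrank ℝ E)) →L[ℝ] E).le_opNorm x).trans ?_
    gcongr; rw [hK]; linarith [norm_nonneg (e : E →L[ℝ] EuclideanSpace ℝ (Fin (Module.finrank ℝ E)))]
  have hmaps : MapsTo (fun x => e.symm x) (Metric.closedBall (e c) (r / K)) (Metric.closedBall c r) := by
    intro x hx
    rw [mem_closedBall_iff_norm] at hx ⊢
    have : e.symm x - c = e.symm (x - e c) := by simp
    rw [this]
    refine (ns _).trans ?_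
    calc K * ‖x - e c‖ ≤ K * (r / K) := by gcongr
      _ = r := by field_simp
  have hK4 : 1 ≤ K ^ 4 := one_le_pow₀ hK1
  obtain ⟨a, z, z', l1, l2, Q1, Q2, ha, hz, hz', hu, hJ1, hJ2, hl, hll, hzz, hQ⟩ :=
    sums_inner (F := EuclideanSpace ℝ (Fin (Module.finrank ℝ E))) (u1 := fun x => u1 (e.symm x))
      (u2 := fun x => u2 (e.symm x)) (c := e c) (r := r / K) (by positivity)
      (usc_comp_on h1 e.symm.continuous hmaps) (usc_comp_on h2 e.symm.continuous hmaps)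
      (δ := δ / K ^ 2) (by positivity) (by
        intro x hx
        have := hmax _ (hmaps hx)
        simp only [ContinuousLinearEquiv.symm_apply_apply] at this ⊢
        have h3 : ‖x - e c‖ ≤ K * ‖e.symm x - c‖ := by
          have : x - e c = e (e.symm x - c) := by simp
          rw [this]; exact ne _
        have h4 : δ / K ^ 2 * ‖x - e c‖ ^ 2 ≤ δ * ‖e.symm x - c‖ ^ 2 := by
          calc δ / K ^ 2 * ‖x - e c‖ ^ 2 ≤ δ / K ^ 2 * (K * ‖e.symm x - c‖) ^ 2 := by gcongr
            _ = _ := by field_simp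
        linarith) (ε := ε / K ^ 4) (by positivity)
  have hε4 : ε / K ^ 4 ≤ ε := div_le_self hε.le hK4
  have hKε : K * (ε / K ^ 4) ≤ ε := by
    rw [mul_div_assoc', div_le_iff₀ (by positivity)]
    have : K ≤ K ^ 4 := le_self_pow₀ hK1 (by norm_num)
    nlinarith
  have hK2ε : K ^ 2 * (ε / K ^ 4) ≤ ε := by
    rw [mul_div_assoc', div_le_iff₀ (by positivity)]
    have : K ^ 2 ≤ K ^ 4 := pow_le_pow_right₀ hK1 (by norm_num)
    nlinarith
  have hK4ε : K ^ 4 * (ε / K ^ 4) ≤ ε := by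
    rw [mul_div_cancel₀ _ (by positivity)]
  have nl : ∀ l : EuclideanSpace ℝ (Fin (Module.finrank ℝ E)) →L[ℝ] ℝ,
      ‖l.comp (e : E →L[ℝ] EuclideanSpace ℝ (Fin (Module.finrank ℝ E)))‖ ≤ K * ‖l‖ := by
    intro l
    refine ContinuousLinearMap.opNorm_le_bound _ (by positivity) fun x => ?_
    refine (l.le_opNorm _).trans ?_
    have := ne x
    calc ‖l‖ * ‖e x‖ ≤ ‖l‖ * (K * ‖x‖) := by gcongr
      _ = _ := by ring
  have nzc : ∀ x, ‖e.symm x - c‖ ≤ K * ‖x - e c‖ := fun x => by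
    have : e.symm x - c = e.symm (x - e c) := by simp
    rw [this]; exact ns _
  have nzz : ‖e.symm z - e.symm z'‖ ≤ K * ‖z - z'‖ := by rw [← map_sub]; exact ns _
  refine ⟨a * K ^ 2, e.symm z, e.symm z', _, _, _, _, by positivity, ?_, ?_, ?_, hJ1.of_equiv, hJ2.of_equiv,
    ?_, ?_, ?_, ?_⟩
  · exact ((nzc z).trans_lt (mul_lt_mul_of_pos_left hz hK0)).trans_le hKε
  · exact ((nzc z').trans_lt (mul_lt_mul_of_pos_left hz' hK0)).trans_le hKε
  · simp only [ContinuousLinearEquiv.symm_apply_apply] at hu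
    linarith
  · rw [← ContinuousLinearMap.add_comp]
    refine (nl _).trans (le_trans ?_ hKε)
    gcongr
  · calc _ ≤ (K * ‖l2‖) * (K * ‖z - z'‖) := by gcongr; exact nl _
      _ = K ^ 2 * (‖l2‖ * ‖z - z'‖) := by ring
      _ ≤ K ^ 2 * (ε / K ^ 4) := by gcongr
      _ ≤ ε := hK2ε
  · calc _ ≤ a * K ^ 2 * (K * ‖z - z'‖) ^ 2 := by gcongr
      _ = K ^ 4 * (a * ‖z - z'‖ ^ 2) := by ring
      _ ≤ K ^ 4 * (ε / K ^ 4) := by gcongr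
      _ ≤ ε := hK4ε
  · intro v v'
    simp only [ContinuousLinearMap.comp_apply, ContinuousLinearMap.flip_apply,
      ContinuousLinearMap.compL_apply, ContinuousLinearEquiv.coe_coe]
    refine (hQ _ _).trans ?_
    rw [← map_sub]
    calc a * ‖e (v - v')‖ ^ 2 ≤ a * (K * ‖v - v'‖) ^ 2 := by gcongr; exact ne _
      _ = _ := by ring

end SumsGeneral

section Core

variable {d q m : ℕ} {Uset : Set (EuclideanSpace ℝ (Fin q))}
    {b : EuclideanSpace ℝ (Fin d) → Fin m → EuclideanSpace ℝ (Fin q) → EuclideanSpace ℝ (Fin d)}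
    {σ : EuclideanSpace ℝ (Fin d) → Fin m → EuclideanSpace ℝ (Fin q) → Matrix (Fin d) (Fin d) ℝ}
    {f : EuclideanSpace ℝ (Fin d) → Fin m → EuclideanSpace ℝ (Fin q) → ℝ}
    {c : EuclideanSpace ℝ (Fin d) → Fin m → Fin m → ℝ}
    {g : EuclideanSpace ℝ (Fin d) → Fin m → ℝ}
    {L1 L2 M2 : ℝ}

/-- The `k`-th column of the diffusion matrix. -/
def scol (σ : EuclideanSpace ℝ (Fin d) → Fin m → EuclideanSpace ℝ (Fin q) → Matrix (Fin d) (Fin d) ℝ)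
    (x : EuclideanSpace ℝ (Fin d)) (i : Fin m) (u : EuclideanSpace ℝ (Fin q)) (k : Fin d) :
    EuclideanSpace ℝ (Fin d) :=
  (EuclideanSpace.equiv (Fin d) ℝ).symm fun l => σ x i u l k

/-- The Hamiltonian evaluated on a jet. -/
def Ham (b : EuclideanSpace ℝ (Fin d) → Fin m → EuclideanSpace ℝ (Fin q) → EuclideanSpace ℝ (Fin d))
    (σ : EuclideanSpace ℝ (Fin d) → Fin m → EuclideanSpace ℝ (Fin q) → Matrix (Fin d) (Fin d) ℝ)
    (f : EuclideanSpace ℝ (Fin d) → Fin m → EuclideanSpace ℝ (Fin q) → ℝ)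
    (i : Fin m) (z : ℝ × EuclideanSpace ℝ (Fin d)) (l : ℝ × EuclideanSpace ℝ (Fin d) →L[ℝ] ℝ)
    (Q : ℝ × EuclideanSpace ℝ (Fin d) →L[ℝ] ℝ × EuclideanSpace ℝ (Fin d) →L[ℝ] ℝ)
    (u : EuclideanSpace ℝ (Fin q)) : ℝ :=
  l (0, b z.2 i u) + (1 / 2) * ∑ k, Q (0, scol σ z.2 i u k) (0, scol σ z.2 i u k) + f z.2 i u

/-- Subsolution in the sense of jets. -/
def JetSub (Uset : Set (EuclideanSpace ℝ (Fin q)))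
    (b : EuclideanSpace ℝ (Fin d) → Fin m → EuclideanSpace ℝ (Fin q) → EuclideanSpace ℝ (Fin d))
    (σ : EuclideanSpace ℝ (Fin d) → Fin m → EuclideanSpace ℝ (Fin q) → Matrix (Fin d) (Fin d) ℝ)
    (f : EuclideanSpace ℝ (Fin d) → Fin m → EuclideanSpace ℝ (Fin q) → ℝ)
    (c : EuclideanSpace ℝ (Fin d) → Fin m → Fin m → ℝ)
    (v : Fin m → ℝ × EuclideanSpace ℝ (Fin d) → ℝ) : Prop :=
  ∀ i z, 0 < z.1 → ∀ l Q, UJet (v i) z l Q →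
    (∀ u ∈ Uset, l (1, 0) ≤ Ham b σ f i z l Q u) ∨ ∃ j, j ≠ i ∧ v i z ≤ v j z - c z.2 i j

/-- Supersolution in the sense of jets. -/
def JetSuper (Uset : Set (EuclideanSpace ℝ (Fin q)))
    (b : EuclideanSpace ℝ (Fin d) → Fin m → EuclideanSpace ℝ (Fin q) → EuclideanSpace ℝ (Fin d))
    (σ : EuclideanSpace ℝ (Fin d) → Fin m → EuclideanSpace ℝ (Fin q) → Matrix (Fin d) (Fin d) ℝ)
    (f : EuclideanSpace ℝ (Fin d) → Fin m → EuclideanSpace ℝ (Fin q) → ℝ)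
    (c : EuclideanSpace ℝ (Fin d) → Fin m → Fin m → ℝ)
    (w : Fin m → ℝ × EuclideanSpace ℝ (Fin d) → ℝ) : Prop :=
  ∀ i z, 0 < z.1 → (∀ j, j ≠ i → w j z - c z.2 i j ≤ w i z) ∧
    ∀ l Q, LJet (w i) z l Q → ∃ u ∈ Uset, Ham b σ f i z l Q u ≤ l (1, 0)

theorem scol_sub_le (h1 : H1Hyp Uset b σ f c g L1 L2 M2) (x x' : EuclideanSpace ℝ (Fin d)) (i : Fin m)
    {u : EuclideanSpace ℝ (Fin q)} (hu : u ∈ Uset) (k : Fin d) :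
    ‖scol σ x i u k - scol σ x' i u k‖ ≤ L1 * ‖x - x'‖ := by
  refine le_trans ?_ (h1.σLip x x' i u hu)
  rw [EuclideanSpace.norm_eq]
  apply Real.sqrt_le_sqrt
  unfold frobSq
  refine Finset.sum_le_sum fun l _ => ?_
  have : ‖(scol σ x i u k - scol σ x' i u k) l‖ ^ 2 = ((σ x i u - σ x' i u) l k) ^ 2 := by
    simp [scol]
  rw [this]
  exact Finset.single_le_sum (f := fun j => ((σ x i u - σ x' i u) l j) ^ 2)
    (fun j _ => sq_nonneg _) (Finset.mem_univ k)

theorem scol_cont (h1 : H1Hyp Uset b σ f c g L1 L2 M2) (i : Fin m) (k : Fin d) :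
    Continuous fun p : EuclideanSpace ℝ (Fin d) × EuclideanSpace ℝ (Fin q) => scol σ p.1 i p.2 k := by
  unfold scol
  refine (EuclideanSpace.equiv (Fin d) ℝ).symm.continuous.comp ?_
  refine continuous_pi fun l => ?_
  have := h1.σCont i
  exact (continuous_apply k).comp ((continuous_apply l).comp this)

theorem bound_at {α : Type*} [NormedAddCommGroup α]
    (hc : IsCompact Uset) (F : Fin m → EuclideanSpace ℝ (Fin q) → α)
    (hF : ∀ i, Continuous (F i)) : ∃ M : ℝ, 0 ≤ M ∧ ∀ i, ∀ u ∈ Uset, ‖F i u‖ ≤ M := by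
  have : ∀ i, ∃ M : ℝ, ∀ u ∈ Uset, ‖F i u‖ ≤ M := fun i =>
    hc.exists_bound_of_continuousOn (hF i).continuousOn
  choose M hM using this
  refine ⟨∑ i, |M i|, Finset.sum_nonneg fun i _ => abs_nonneg _, fun i u hu => ?_⟩
  exact ((hM i u hu).trans (le_abs_self _)).trans
    (Finset.single_le_sum (f := fun i => |M i|) (fun j _ => abs_nonneg _) (Finset.mem_univ i))

theorem coef_growth (h1 : H1Hyp Uset b σ f c g L1 L2 M2) :
    ∃ M : ℝ, 1 ≤ M ∧ ∀ x i, ∀ u ∈ Uset, ‖b x i u‖ ≤ M * (1 + ‖x‖) ∧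
      (∀ k, ‖scol σ x i u k‖ ≤ M * (1 + ‖x‖)) ∧ |f x i u| ≤ M * (1 + ‖x‖) := by
  obtain ⟨Mb, hMb0, hMb⟩ := bound_at h1.Ucompact (fun i u => b 0 i u)
    (fun i => (h1.bCont i).comp (Continuous.prodMk_right 0))
  obtain ⟨Mf, hMf0, hMf⟩ := bound_at h1.Ucompact (fun i u => f 0 i u)
    (fun i => (h1.fCont i).comp (Continuous.prodMk_right 0))
  have hs : ∀ k, ∃ M : ℝ, 0 ≤ M ∧ ∀ i, ∀ u ∈ Uset, ‖scol σ 0 i u k‖ ≤ M := fun k =>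
    bound_at h1.Ucompact (fun i u => scol σ 0 i u k)
    (fun i => (scol_cont h1 i k).comp (Continuous.prodMk_right 0))
  choose Ms hMs0 hMs using hs
  have hS0 : 0 ≤ ∑ k, Ms k := Finset.sum_nonneg fun k _ => hMs0 k
  have hl1 := h1.L1pos
  have hl2 := h1.L2pos
  refine ⟨1 + Mb + Mf + ∑ k, Ms k + L1 + L2, by linarith, fun x i u hu => ⟨?_, ?_, ?_⟩⟩
  · have e1 := h1.bLip x 0 i u hu
    have e2 := hMb i u hu
    have e3 : ‖b x i u‖ ≤ ‖b x i u - b 0 i u‖ + ‖b 0 i u‖ := by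
      simpa using norm_add_le (b x i u - b 0 i u) (b 0 i u)
    rw [sub_zero] at e1
    nlinarith [norm_nonneg x, mul_nonneg hMb0 (norm_nonneg x), mul_nonneg hMf0 (norm_nonneg x), mul_nonneg hS0 (norm_nonneg x), mul_nonneg hl2.le (norm_nonneg x)]
  · intro k
    have e1 := scol_sub_le h1 x 0 i hu k
    have e2 := hMs k i u hu
    have e3 : ‖scol σ x i u k‖ ≤ ‖scol σ x i u k - scol σ 0 i u k‖ + ‖scol σ 0 i u k‖ := by
      simpa using norm_add_le (scol σ x i u k - scol σ 0 i u k) (scol σ 0 i u k)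
    have e4 : Ms k ≤ ∑ k, Ms k := Finset.single_le_sum (fun j _ => hMs0 j) (Finset.mem_univ k)
    rw [sub_zero] at e1
    nlinarith [norm_nonneg x, mul_nonneg hMb0 (norm_nonneg x), mul_nonneg hMf0 (norm_nonneg x), mul_nonneg hS0 (norm_nonneg x), mul_nonneg hl2.le (norm_nonneg x)]
  · have e1 := h1.fLip x 0 i u hu
    have e2 := hMf i u hu
    rw [Real.norm_eq_abs] at e2
    have e3 : |f x i u| ≤ |f x i u - f 0 i u| + |f 0 i u| := by
      simpa using abs_add_le (f x i u - f 0 i u) (f 0 i u)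
    rw [sub_zero] at e1
    nlinarith [norm_nonneg x, mul_nonneg hMb0 (norm_nonneg x), mul_nonneg hMf0 (norm_nonneg x), mul_nonneg hS0 (norm_nonneg x), mul_nonneg hl1.le (norm_nonneg x)]

/-- The Euclidean bilinear form on `ℝ × X`. -/
def euB (d : ℕ) : ℝ × EuclideanSpace ℝ (Fin d) →L[ℝ] ℝ × EuclideanSpace ℝ (Fin d) →L[ℝ] ℝ :=
  ((innerSL ℝ (E := ℝ)).bilinearComp (ContinuousLinearMap.fst ℝ ℝ (EuclideanSpace ℝ (Fin d)))
    (ContinuousLinearMap.fst ℝ ℝ (EuclideanSpace ℝ (Fin d)))) +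
  ((innerSL ℝ (E := EuclideanSpace ℝ (Fin d))).bilinearComp
    (ContinuousLinearMap.snd ℝ ℝ (EuclideanSpace ℝ (Fin d)))
    (ContinuousLinearMap.snd ℝ ℝ (EuclideanSpace ℝ (Fin d))))

theorem euB_apply (h k : ℝ × EuclideanSpace ℝ (Fin d)) :
    euB d h k = h.1 * k.1 + ⟪h.2, k.2⟫ := by
  simp [euB, ContinuousLinearMap.bilinearComp_apply, mul_comm]

theorem euB_symm (h k : ℝ × EuclideanSpace ℝ (Fin d)) : euB d h k = euB d k h := by
  rw [euB_apply, euB_apply, mul_comm, real_inner_comm]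

theorem euB_self (h : ℝ × EuclideanSpace ℝ (Fin d)) : euB d h h = h.1 ^ 2 + ‖h.2‖ ^ 2 := by
  rw [euB_apply, real_inner_self_eq_norm_sq]; ring

theorem euB_ge (h : ℝ × EuclideanSpace ℝ (Fin d)) : ‖h‖ ^ 2 ≤ euB d h h := by
  rw [euB_self, Prod.norm_def]
  rcases max_cases ‖h.1‖ ‖h.2‖ with ⟨e, _⟩ | ⟨e, _⟩ <;> rw [e]
  · rw [Real.norm_eq_abs, sq_abs]; nlinarith [sq_nonneg ‖h.2‖]
  · nlinarith [sq_nonneg h.1]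

theorem euB_le (h k : ℝ × EuclideanSpace ℝ (Fin d)) : |euB d h k| ≤ 2 * (‖h‖ * ‖k‖) := by
  rw [euB_apply]
  have e1 : |h.1 * k.1| ≤ ‖h‖ * ‖k‖ := by
    rw [abs_mul]
    exact mul_le_mul (norm_fst_le h) (norm_fst_le k) (abs_nonneg _) (norm_nonneg _)
  have e2 : |⟪h.2, k.2⟫| ≤ ‖h‖ * ‖k‖ :=
    (abs_real_inner_le_norm _ _).trans
      (mul_le_mul (norm_snd_le h) (norm_snd_le k) (norm_nonneg _) (norm_nonneg _))
  exact (abs_add_le _ _).trans (by linarith)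

theorem euB_le_self (h : ℝ × EuclideanSpace ℝ (Fin d)) : euB d h h ≤ 2 * ‖h‖ ^ 2 := by
  have := (abs_le.mp (euB_le h h)).2
  linarith [sq ‖h‖]

/-- adding an exact quadratic to a jet -/
theorem UJet.add_euB {u : ℝ × EuclideanSpace ℝ (Fin d) → ℝ} {z c0 : ℝ × EuclideanSpace ℝ (Fin d)} {δ : ℝ}
    {l Q} (h : UJet (fun y => u y - δ * euB d (y - c0) (y - c0)) z l Q) :
    UJet u z (l + (2 * δ) • euB d (z - c0)) (Q + (2 * δ) • euB d) := by
  intro ε hε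
  filter_upwards [h ε hε] with k hk
  have e : euB d (z + k - c0) (z + k - c0) = euB d (z - c0) (z - c0) + 2 * euB d (z - c0) k + euB d k k := by
    rw [show z + k - c0 = (z - c0) + k by abel]
    simp only [map_add, _root_.add_apply]
    rw [euB_symm k (z - c0)]; ring
  rw [e] at hk
  simp only [_root_.add_apply, _root_.smul_apply, smul_eq_mul]
  linarith

theorem UJet.neg {E : Type*} [NormedAddCommGroup E] [NormedSpace ℝ E] {w : E → ℝ} {z : E} {l Q}
    (h : UJet (fun y => - w y) z l Q) : LJet w z (-l) (-Q) := by
  intro ε hε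
  filter_upwards [h ε hε] with k hk
  simp only [_root_.neg_apply]
  linarith

theorem core (h1 : H1Hyp Uset b σ f c g L1 L2 M2) (i : Fin m)
    {u w : ℝ × EuclideanSpace ℝ (Fin d) → ℝ} {c0 : ℝ × EuclideanSpace ℝ (Fin d)} {r : ℝ} (hr : 0 < r)
    (husc : UpperSemicontinuousOn u (Metric.closedBall c0 r))
    (hlsc : LowerSemicontinuousOn w (Metric.closedBall c0 r))
    (hmax : ∀ z ∈ Metric.closedBall c0 r, u z - w z ≤ u c0 - w c0)
    {κ ε0 : ℝ} (hκ : 0 < κ) (hε0 : 0 < ε0)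
    (hsub : ∀ z, ‖z - c0‖ < ε0 → u c0 - ε0 < u z → ∀ l Q, UJet u z l Q →
      ∀ v ∈ Uset, l (1, 0) ≤ Ham b σ f i z l Q v)
    (hsup : ∀ z, ‖z - c0‖ < ε0 → ∀ l Q, LJet w z l Q → ∃ v ∈ Uset, Ham b σ f i z l Q v + κ ≤ l (1, 0)) :
    False := by
  obtain ⟨M0, hM01, hM0⟩ := coef_growth h1
  set M := M0 * (2 + ‖c0‖) with hM
  have hMpos : 0 ≤ M := by positivity
  have hl1 := h1.L1pos
  have hl2 := h1.L2pos
  set D : ℝ := 2 + 4 * M + d * M ^ 2 * 2 with hD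
  have hD0 : 0 < D := by positivity
  set δ := κ / (4 * D) with hδ
  have hδ0 : 0 < δ := by positivity
  set G : ℝ := 1 + M + L1 + (d : ℝ) * L1 ^ 2 + 2 * L2 with hG
  have hG0 : 0 < G := by positivity
  set ε := min (min ε0 1) (κ / (4 * G)) with hε
  have hεpos : 0 < ε := by positivity
  have hε1 : ε ≤ 1 := (min_le_left _ _).trans (min_le_right _ _)
  have hεε0 : ε ≤ ε0 := (min_le_left _ _).trans (min_le_left _ _)
  have hεG : ε * G ≤ κ / 4 := by
    calc ε * G ≤ κ / (4 * G) * G := by gcongr; exact min_le_right _ _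
      _ = κ / 4 := by field_simp
  have hδD : δ * D = κ / 4 := by rw [hδ]; field_simp
  have cN : Continuous fun z : ℝ × EuclideanSpace ℝ (Fin d) => - (δ * euB d (z - c0) (z - c0)) := by
    have : Continuous fun z : ℝ × EuclideanSpace ℝ (Fin d) => z - c0 := by fun_prop
    have h3 : Continuous fun z : ℝ × EuclideanSpace ℝ (Fin d) => euB d (z - c0) (z - c0) :=
      ((euB d).continuous.comp this).clm_apply this
    exact (h3.const_mul δ).neg
  have hu1 : UpperSemicontinuousOn (fun z => u z - δ * euB d (z - c0) (z - c0)) (Metric.closedBall c0 r) := by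
    simpa only [sub_eq_add_neg] using husc.add ((Continuous.upperSemicontinuous cN).upperSemicontinuousOn _)
  have hw1 : UpperSemicontinuousOn (fun z => - w z) (Metric.closedBall c0 r) := by
    intro x hx y hy
    have := hlsc x hx (-y) (by simp only at hy; linarith)
    filter_upwards [this] with z hz
    linarith
  obtain ⟨a, z, z', l1, l2, Q1, Q2, ha, hz, hz', hu, hJ1, hJ2, hl, hll, hzz, hQ⟩ :=
    sums_general hr hu1 hw1 hδ0 (by
      intro z hz
      have e1 := hmax z hz
      have e2 := euB_ge (z - c0)
      simp only [sub_self, map_zero, mul_zero, sub_zero]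
      nlinarith) hεpos
  simp only [sub_self, map_zero, mul_zero, sub_zero] at hu
  have hpos : 0 ≤ δ * euB d (z - c0) (z - c0) :=
    mul_nonneg hδ0.le ((sq_nonneg _).trans (euB_ge _))
  have hJ := hJ1.add_euB
  obtain ⟨v, hv, h2⟩ := hsup z' (by linarith) _ _ hJ2.neg
  have h3 := hsub z (by linarith) (by linarith) _ _ hJ v hv
  simp only [Ham, _root_.add_apply, _root_.smul_apply, smul_eq_mul,
    _root_.neg_apply, Finset.sum_neg_distrib, Finset.sum_add_distrib] at h2 h3
  -- estimates
  have zn : ‖z.2‖ ≤ 1 + ‖c0‖ := by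
    have e1 := norm_snd_le z
    have e2 : ‖z‖ ≤ ‖z - c0‖ + ‖c0‖ := by simpa using norm_add_le (z - c0) c0
    linarith
  obtain ⟨gb, gs, -⟩ := hM0 z.2 i v hv
  have hMle : M0 * (1 + ‖z.2‖) ≤ M := by rw [hM]; exact mul_le_mul_of_nonneg_left (by linarith) (by linarith)
  have nzz : ‖z.2 - z'.2‖ ≤ ‖z - z'‖ := norm_snd_le (z - z')
  have nzz2 : ‖z - z'‖ ≤ 2 * ε := by
    have : z - z' = (z - c0) - (z' - c0) := by abel
    rw [this]; exact (norm_sub_le _ _).trans (by linarith)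
  have n10 : ‖((1 : ℝ), (0 : EuclideanSpace ℝ (Fin d)))‖ = 1 := by simp [Prod.norm_def]
  have n0 : ∀ x : EuclideanSpace ℝ (Fin d), ‖((0 : ℝ), x)‖ = ‖x‖ := fun x => by simp [Prod.norm_def]
  have e1 : -(l1 (1, 0) + l2 (1, 0)) ≤ ε := by
    have := (l1 + l2).le_opNorm ((1 : ℝ), (0 : EuclideanSpace ℝ (Fin d)))
    rw [n10, mul_one, Real.norm_eq_abs] at this
    have := (abs_le.mp this).1
    rw [_root_.add_apply] at this
    linarith
  have e2 : l1 (0, b z.2 i v) + l2 (0, b z'.2 i v) ≤ ε * M + L1 * ε := by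
    have a1 : l1 (0, b z.2 i v) + l2 (0, b z'.2 i v) = (l1 + l2) (0, b z.2 i v) + l2 (0, b z'.2 i v - b z.2 i v) := by
      have : ((0 : ℝ), b z'.2 i v - b z.2 i v) = (0, b z'.2 i v) - (0, b z.2 i v) := by simp
      rw [this, map_sub, _root_.add_apply]; ring
    have a2 := (le_abs_self _).trans ((l1 + l2).le_opNorm ((0 : ℝ), b z.2 i v))
    have a3 := (le_abs_self _).trans (l2.le_opNorm ((0 : ℝ), b z'.2 i v - b z.2 i v))
    rw [n0] at a2 a3
    have a4 : ‖l1 + l2‖ * ‖b z.2 i v‖ ≤ ε * M := mul_le_mul hl (gb.trans hMle) (norm_nonneg _) hεpos.le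
    have a5 := h1.bLip z'.2 z.2 i v hv
    rw [norm_sub_rev z'.2] at a5
    have a6 : ‖l2‖ * ‖b z'.2 i v - b z.2 i v‖ ≤ L1 * ε := by
      calc _ ≤ ‖l2‖ * (L1 * ‖z - z'‖) := by gcongr; exact a5.trans (by gcongr)
        _ = L1 * (‖l2‖ * ‖z - z'‖) := by ring
        _ ≤ _ := by gcongr
    linarith
  have e3 : ∑ k, Q1 (0, scol σ z.2 i v k) (0, scol σ z.2 i v k) +
      ∑ k, Q2 (0, scol σ z'.2 i v k) (0, scol σ z'.2 i v k) ≤ d * (L1 ^ 2 * ε) := by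
    rw [← Finset.sum_add_distrib]
    have : ∀ k ∈ (Finset.univ : Finset (Fin d)), Q1 (0, scol σ z.2 i v k) (0, scol σ z.2 i v k) + Q2 (0, scol σ z'.2 i v k) (0, scol σ z'.2 i v k) ≤ L1 ^ 2 * ε := by
      intro k _
      refine (hQ _ _).trans ?_
      rw [Prod.mk_sub_mk, sub_zero, n0]
      have := scol_sub_le h1 z.2 z'.2 i hv k
      calc a * ‖scol σ z.2 i v k - scol σ z'.2 i v k‖ ^ 2 ≤ a * (L1 * ‖z - z'‖) ^ 2 := by
            gcongr; exact this.trans (by gcongr)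
        _ = L1 ^ 2 * (a * ‖z - z'‖ ^ 2) := by ring
        _ ≤ _ := by gcongr
    simpa using Finset.sum_le_card_nsmul _ _ _ this
  have e4 : f z.2 i v - f z'.2 i v ≤ 2 * L2 * ε := by
    have := (le_abs_self _).trans (h1.fLip z.2 z'.2 i v hv)
    have : L2 * ‖z.2 - z'.2‖ ≤ L2 * (2 * ε) := by gcongr; linarith
    linarith
  have e5 : - euB d (z - c0) (1, 0) ≤ 2 := by
    have := (abs_le.mp (euB_le (z - c0) (1, 0))).1
    rw [n10] at this; linarith
  have e5' : - euB d (z - c0) (1, 0) ≤ 1 := by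
    have e := norm_fst_le (z - c0)
    rw [euB_apply]; simp only [inner_zero_right, mul_one, add_zero]
    have := (abs_le.mp ((Real.norm_eq_abs _).symm.le.trans e)).1
    linarith
  have e6 : euB d (z - c0) (0, b z.2 i v) ≤ 2 * M := by
    have := (abs_le.mp (euB_le (z - c0) (0, b z.2 i v))).2
    rw [n0] at this
    have : ‖z - c0‖ * ‖b z.2 i v‖ ≤ 1 * M := mul_le_mul (by linarith) (gb.trans hMle) (norm_nonneg _) (by norm_num)
    linarith
  have e7 : ∑ k, euB d (0, scol σ z.2 i v k) (0, scol σ z.2 i v k) ≤ d * (2 * M ^ 2) := by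
    have : ∀ k ∈ (Finset.univ : Finset (Fin d)), euB d (0, scol σ z.2 i v k) (0, scol σ z.2 i v k) ≤ 2 * M ^ 2 := by
      intro k _
      refine (euB_le_self _).trans ?_
      rw [n0]
      gcongr
      exact (gs k).trans hMle
    simpa using Finset.sum_le_card_nsmul _ _ _ this
  rw [← Finset.mul_sum] at h3
  have e8 : δ * (- euB d (z - c0) (1, 0)) ≤ δ * 1 := by gcongr
  have e9 : δ * (euB d (z - c0) (0, b z.2 i v)) ≤ δ * (2 * M) := by gcongr
  have e10 : δ * ∑ k, euB d (0, scol σ z.2 i v k) (0, scol σ z.2 i v k) ≤ δ * (d * (2 * M ^ 2)) := by gcongr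
  have x1 : δ * D = 2 * (δ * 1) + 2 * (δ * (2 * M)) + δ * (d * (2 * M ^ 2)) := by rw [hD]; ring
  have x2 : ε * G = ε + ε * M + L1 * ε + d * (L1 ^ 2 * ε) + 2 * L2 * ε := by rw [hG]; ring
  have x3 : 0 ≤ (d : ℝ) * (L1 ^ 2 * ε) := by positivity
  linarith

end Core

section JTwo

variable {E : Type*} [NormedAddCommGroup E] [NormedSpace ℝ E]

/-- Second order expansion. -/
def J2 (θ : E → ℝ) (z : E) (l : E →L[ℝ] ℝ) (Q : E →L[ℝ] E →L[ℝ] ℝ) : Prop :=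
  (fun h => θ (z + h) - θ z - l h - (1 / 2) * Q h h) =o[𝓝 0] fun h => ‖h‖ ^ 2

theorem J2.ujet {θ : E → ℝ} {z l Q} (h : J2 θ z l Q) : UJet θ z l Q := by
  intro ε hε
  filter_upwards [h.def hε] with k hk
  rw [norm_pow, norm_norm] at hk
  have := (abs_le.mp hk).2
  linarith

theorem J2.ljet {θ : E → ℝ} {z l Q} (h : J2 θ z l Q) : LJet θ z l Q := by
  intro ε hε
  filter_upwards [h.def hε] with k hk
  rw [norm_pow, norm_norm] at hk
  have := (abs_le.mp hk).1
  linarith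

theorem J2.mk {θ : E → ℝ} {z l Q} (h : UJet θ z l Q) (h' : LJet θ z l Q) : J2 θ z l Q := by
  refine Asymptotics.isLittleO_iff.mpr fun ε hε => ?_
  filter_upwards [h ε hε, h' ε hε] with k hk hk'
  rw [norm_pow, norm_norm, Real.norm_eq_abs, abs_le]
  constructor <;> linarith

theorem UJet.add {u v : E → ℝ} {z l Q l' Q'} (h : UJet u z l Q) (h' : UJet v z l' Q') :
    UJet (fun y => u y + v y) z (l + l') (Q + Q') := by
  intro ε hε
  filter_upwards [h (ε / 2) (by positivity), h' (ε / 2) (by positivity)] with k hk hk'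
  simp only [_root_.add_apply]
  linarith

theorem LJet.add {u v : E → ℝ} {z l Q l' Q'} (h : LJet u z l Q) (h' : LJet v z l' Q') :
    LJet (fun y => u y + v y) z (l + l') (Q + Q') := by
  intro ε hε
  filter_upwards [h (ε / 2) (by positivity), h' (ε / 2) (by positivity)] with k hk hk'
  simp only [_root_.add_apply]
  linarith

theorem UJet.mono {u v : E → ℝ} {z l Q} (h : UJet u z l Q) (hle : ∀ᶠ y in 𝓝 z, v y ≤ u y) (he : v z = u z) :
    UJet v z l Q := by
  intro ε hε
  have ht : Tendsto (fun h : E => z + h) (𝓝 0) (𝓝 z) := by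
    have : Continuous fun h : E => z + h := by fun_prop
    simpa using this.tendsto 0
  filter_upwards [h ε hε, ht.eventually hle] with k hk hk'
  rw [he]; linarith

theorem LJet.mono {u v : E → ℝ} {z l Q} (h : LJet u z l Q) (hle : ∀ᶠ y in 𝓝 z, u y ≤ v y) (he : v z = u z) :
    LJet v z l Q := by
  intro ε hε
  have ht : Tendsto (fun h : E => z + h) (𝓝 0) (𝓝 z) := by
    have : Continuous fun h : E => z + h := by fun_prop
    simpa using this.tendsto 0
  filter_upwards [h ε hε, ht.eventually hle] with k hk hk'
  rw [he]; linarith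

theorem J2.add {u v : E → ℝ} {z l Q l' Q'} (h : J2 u z l Q) (h' : J2 v z l' Q') :
    J2 (fun y => u y + v y) z (l + l') (Q + Q') :=
  J2.mk (h.ujet.add h'.ujet) (h.ljet.add h'.ljet)

theorem J2.const_mul {u : E → ℝ} {z l Q} (h : J2 u z l Q) (a : ℝ) :
    J2 (fun y => a * u y) z (a • l) (a • Q) := by
  refine (Asymptotics.IsLittleO.const_mul_left h a).congr_left fun k => ?_
  simp only [_root_.smul_apply, smul_eq_mul]; ring

theorem J2.const (z : E) (a : ℝ) : J2 (fun _ => a) z 0 0 := by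
  have : (fun _ : E => (0:ℝ)) =o[𝓝 0] fun h : E => ‖h‖ ^ 2 := Asymptotics.isLittleO_zero _ _
  refine this.congr_left fun k => ?_
  simp

theorem J2.neg {u : E → ℝ} {z l Q} (h : J2 u z l Q) : J2 (fun y => - u y) z (-l) (-Q) := by
  refine (Asymptotics.IsLittleO.neg_left h).congr_left fun k => ?_
  simp only [_root_.neg_apply]; ring

/-- comparison of a super and a sub jet at the same point -/
theorem jets_compare {u : E → ℝ} {z l Q l' Q'} (h : UJet u z l Q) (h' : LJet u z l' Q') :
    l = l' ∧ ∀ v, Q' v v ≤ Q v v := by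
  have key : ∀ ε > 0, ∀ v : E, ∀ᶠ s : ℝ in 𝓝[>] 0,
      (l' v - l v) * s ≤ s ^ 2 * ((1 / 2) * (Q v v - Q' v v) + 2 * ε * ‖v‖ ^ 2) := by
    intro ε hε v
    have ht : Tendsto (fun s : ℝ => s • v) (𝓝[>] 0) (𝓝 0) := by
      have : Continuous fun s : ℝ => s • v := by fun_prop
      have := this.tendsto 0
      rw [zero_smul] at this
      exact this.mono_left nhdsWithin_le_nhds
    filter_upwards [ht.eventually (h ε hε), ht.eventually (h' ε hε), self_mem_nhdsWithin] with s h1 h2 hs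
    simp only [map_smul, _root_.smul_apply, smul_eq_mul, norm_smul, Real.norm_eq_abs, mul_pow, sq_abs] at h1 h2
    nlinarith
  have hle : ∀ v, l' v ≤ l v := by
    intro v
    have hc : Tendsto (fun s : ℝ => s * ((1 / 2) * (Q v v - Q' v v) + 2 * 1 * ‖v‖ ^ 2)) (𝓝[>] 0) (𝓝 0) := by
      have : Continuous fun s : ℝ => s * ((1 / 2) * (Q v v - Q' v v) + 2 * 1 * ‖v‖ ^ 2) := by fun_prop
      have := this.tendsto 0
      rw [zero_mul] at this
      exact this.mono_left nhdsWithin_le_nhds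
    have : l' v - l v ≤ 0 := by
      refine ge_of_tendsto hc ?_
      filter_upwards [key 1 one_pos v, self_mem_nhdsWithin] with s h1 hs
      have hs0 : (0 : ℝ) < s := hs
      refine le_of_mul_le_mul_right ?_ hs0
      linarith
    linarith
  have heq : l = l' := by
    ext v
    have h1 := hle v
    have h2 := hle (-v)
    simp only [map_neg] at h2
    linarith
  refine ⟨heq, fun v => ?_⟩
  have : ∀ ε > 0, 0 ≤ (1 / 2) * (Q v v - Q' v v) + 2 * ε * ‖v‖ ^ 2 := by
    intro ε hε
    obtain ⟨s, h1, hs⟩ := ((key ε hε v).and self_mem_nhdsWithin).exists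
    have hs0 : (0 : ℝ) < s := hs
    rw [heq, sub_self, zero_mul] at h1
    by_contra hneg
    push Not at hneg
    nlinarith [pow_pos hs0 2]
  by_contra hlt
  push Not at hlt
  have h2 := this ((Q' v v - Q v v) / (8 * (‖v‖ ^ 2 + 1))) (div_pos (by linarith) (by positivity))
  have h3 : 2 * ((Q' v v - Q v v) / (8 * (‖v‖ ^ 2 + 1))) * ‖v‖ ^ 2 ≤ (Q' v v - Q v v) / 4 := by
    rw [show 2 * ((Q' v v - Q v v) / (8 * (‖v‖ ^ 2 + 1))) * ‖v‖ ^ 2 = (Q' v v - Q v v) / 4 * (‖v‖ ^ 2 / (‖v‖ ^ 2 + 1)) by field_simp; ring]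
    have : ‖v‖ ^ 2 / (‖v‖ ^ 2 + 1) ≤ 1 := by rw [div_le_one (by positivity)]; linarith
    nlinarith
  linarith

theorem J2.of_hasFDerivAt {θ : E → ℝ} {z : E} {D : E → E →L[ℝ] ℝ} {Q : E →L[ℝ] E →L[ℝ] ℝ}
    (h : ∀ᶠ y in 𝓝 z, HasFDerivAt θ (D y) y) (hD : HasFDerivAt D Q z) : J2 θ z (D z) Q := by
  have hsym : ∀ v w, Q v w = Q w v := fun v w => second_derivative_symmetric_of_eventually h hD v w
  refine Asymptotics.isLittleO_iff.mpr fun ε hε => ?_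
  have h2 := (hasFDerivAt_iff_isLittleO_nhds_zero.mp hD).def hε
  have ht : Tendsto (fun h : E => z + h) (𝓝 0) (𝓝 z) := by
    have : Continuous fun h : E => z + h := by fun_prop
    simpa using this.tendsto 0
  obtain ⟨δ, hδ, hball⟩ := Metric.eventually_nhds_iff_ball.mp (h2.and (ht.eventually h))
  filter_upwards [Metric.ball_mem_nhds (0 : E) hδ] with k hk
  have hsub : Metric.closedBall (0 : E) ‖k‖ ⊆ Metric.ball 0 δ := by
    apply Metric.closedBall_subset_ball
    simpa using hk
  have := (convex_closedBall (0 : E) ‖k‖).norm_image_sub_le_of_norm_hasFDerivWithin_le (𝕜 := ℝ)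
    (f := fun h => θ (z + h) - θ z - D z h - (1 / 2) * Q h h)
    (f' := fun h => D (z + h) - D z - Q h) (C := ε * ‖k‖)
    (fun x hx => by
      have e1 : HasFDerivAt (fun h => θ (z + h)) (D (z + x)) x := by
        have := (hball x (hsub hx)).2
        have h3 : HasFDerivAt (fun h : E => z + h) (ContinuousLinearMap.id ℝ E) x :=
          (hasFDerivAt_id x).const_add z
        refine (HasFDerivAt.comp x this h3).congr_fderiv ?_
        ext v; simp
      have e2 : HasFDerivAt (fun h => Q h h) (2 • Q x) x := by
        have := (Q.hasFDerivAt (x := x)).clm_apply (hasFDerivAt_id x)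
        refine HasFDerivAt.congr_fderiv this ?_
        ext v
        simp [hsym v x, two_mul]
      have e3 := (((e1.sub_const (θ z)).sub ((D z).hasFDerivAt (x := x))).sub (e2.const_mul (1 / 2 : ℝ)))
      refine (e3.congr_fderiv ?_).hasFDerivWithinAt
      ext v
      simp) (fun x hx => by
      have := (hball x (hsub hx)).1
      refine this.trans ?_
      gcongr
      simpa using hx) (x := 0) (y := k) (by simp) (by simp)
  simpa [sq, mul_assoc] using this

theorem J2.of_contDiff {θ : E → ℝ} (h : ContDiff ℝ 2 θ) (z : E) :
    J2 θ z (fderiv ℝ θ z) (fderiv ℝ (fderiv ℝ θ) z) := by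
  refine J2.of_hasFDerivAt (D := fderiv ℝ θ) ?_ ?_
  · exact Eventually.of_forall fun y => (h.differentiable (by norm_num) y).hasFDerivAt
  · have : ContDiff ℝ 1 (fderiv ℝ θ) := h.fderiv_right (by norm_num)
    exact (this.differentiable (by norm_num) z).hasFDerivAt

theorem J2.of_hasDerivAt {φ φ1 : ℝ → ℝ} {a φ2 : ℝ} (h : ∀ᶠ y in 𝓝 a, HasDerivAt φ (φ1 y) y)
    (h2 : HasDerivAt φ1 φ2 a) :
    (fun s => φ (a + s) - φ a - φ1 a * s - (1 / 2) * φ2 * s ^ 2) =o[𝓝 0] fun s : ℝ => s ^ 2 := by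
  have := J2.of_hasFDerivAt (θ := φ) (z := a) (D := fun y => φ1 y • (1 : ℝ →L[ℝ] ℝ))
    (Q := (ContinuousLinearMap.toSpanSingleton ℝ (φ2 • (1 : ℝ →L[ℝ] ℝ))))
    (h.mono fun y hy => by
      refine hy.hasFDerivAt.congr_fderiv ?_
      ext; simp)
    (h2.smul_const (1 : ℝ →L[ℝ] ℝ)).hasFDerivAt
  refine (Asymptotics.IsLittleO.congr (Asymptotics.IsLittleO.trans_le this (fun s => ?_)) (fun s => ?_) (fun s => rfl))
  · simp
  · simp; ring

/-- chain rule -/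
theorem J2.comp {θ : E → ℝ} {z l Q} (h : J2 θ z l Q) {φ : ℝ → ℝ} {a φ1 φ2 : ℝ} (ha : θ z = a)
    (hφ : (fun s => φ (a + s) - φ a - φ1 * s - (1 / 2) * φ2 * s ^ 2) =o[𝓝 0] fun s : ℝ => s ^ 2) :
    J2 (fun y => φ (θ y)) z (φ1 • l) (φ1 • Q + φ2 • l.smulRight l) := by
  subst ha
  set s : E → ℝ := fun h => θ (z + h) - θ z with hs
  have hQO : (fun h => (1 / 2) * Q h h) =O[𝓝 0] fun h : E => ‖h‖ ^ 2 := by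
    refine Asymptotics.IsBigO.of_bound ‖Q‖ (Eventually.of_forall fun h => ?_)
    have := Q.le_opNorm₂ h h
    rw [norm_mul, norm_pow, norm_norm]
    have : ‖(1 / 2 : ℝ)‖ = 1 / 2 := by norm_num
    rw [this]
    nlinarith [norm_nonneg (Q h h)]
  have hlO : (fun h => l h) =O[𝓝 0] fun h : E => ‖h‖ := (l.isBigO_id _).norm_right
  have h1 : (fun h => s h - l h) =O[𝓝 0] fun h : E => ‖h‖ ^ 2 := by
    have := (Asymptotics.IsLittleO.isBigO h).add hQO
    refine this.congr_left fun k => ?_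
    simp only [hs]; ring
  have hsq : (fun h : E => ‖h‖ ^ 2) =O[𝓝 0] fun h : E => ‖h‖ := by
    refine Asymptotics.IsBigO.of_bound 1 ?_
    filter_upwards [Metric.ball_mem_nhds (0 : E) one_pos] with k hk
    have : ‖k‖ < 1 := by simpa using hk
    rw [norm_pow, norm_norm]
    nlinarith [norm_nonneg k]
  have h2 : s =O[𝓝 0] fun h : E => ‖h‖ := by
    have := (h1.trans hsq).add hlO
    refine this.congr_left fun k => ?_
    ring
  have hn0 : Tendsto (fun h : E => ‖h‖) (𝓝 0) (𝓝 0) := by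
    have := (continuous_norm (E := E)).tendsto 0
    rwa [norm_zero] at this
  have hst : Tendsto s (𝓝 0) (𝓝 0) := h2.trans_tendsto hn0
  have h3 : (fun h => s h ^ 2) =O[𝓝 0] fun h : E => ‖h‖ ^ 2 := h2.pow 2
  have h4 := (hφ.comp_tendsto hst).trans_isBigO h3
  have h5 : (fun h => (s h - l h) * (s h + l h)) =o[𝓝 0] fun h : E => ‖h‖ ^ 2 := by
    have h6 := h1.mul (h2.add hlO)
    refine h6.trans_isLittleO ?_
    have := (Asymptotics.isBigO_refl (fun h : E => ‖h‖ ^ 2) (𝓝 0)).mul_isLittleO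
      ((Asymptotics.isLittleO_one_iff ℝ).mpr hn0)
    simpa using this
  have h7 := (h4.add (Asymptotics.IsLittleO.const_mul_left h φ1)).add (h5.const_mul_left (1 / 2 * φ2))
  refine h7.congr_left fun k => ?_
  simp only [Function.comp, hs, _root_.smul_apply, smul_eq_mul, _root_.add_apply,
    ContinuousLinearMap.smulRight_apply]
  rw [show θ z + (θ (z + k) - θ z) = θ (z + k) by ring]
  ring

/-- linear functions and quadratic functions -/
theorem J2.clm (L : E →L[ℝ] ℝ) (z : E) : J2 (fun y => L y) z L 0 := by
  have : (fun _ : E => (0:ℝ)) =o[𝓝 0] fun h : E => ‖h‖ ^ 2 := Asymptotics.isLittleO_zero _ _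
  refine this.congr_left fun k => ?_
  simp

theorem J2.quad (B : E →L[ℝ] E →L[ℝ] ℝ) (hB : ∀ v w, B v w = B w v) (c0 z : E) :
    J2 (fun y => B (y - c0) (y - c0)) z ((2 : ℝ) • B (z - c0)) ((2 : ℝ) • B) := by
  have : (fun _ : E => (0:ℝ)) =o[𝓝 0] fun h : E => ‖h‖ ^ 2 := Asymptotics.isLittleO_zero _ _
  refine this.congr_left fun k => ?_
  have : z + k - c0 = (z - c0) + k := by abel
  simp only [this, map_add, _root_.add_apply, _root_.smul_apply, smul_eq_mul]
  rw [hB k (z - c0)]; ring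

end JTwo

section Barrier

variable {d q m : ℕ} {Uset : Set (EuclideanSpace ℝ (Fin q))}
    {b : EuclideanSpace ℝ (Fin d) → Fin m → EuclideanSpace ℝ (Fin q) → EuclideanSpace ℝ (Fin d)}
    {σ : EuclideanSpace ℝ (Fin d) → Fin m → EuclideanSpace ℝ (Fin q) → Matrix (Fin d) (Fin d) ℝ}
    {f : EuclideanSpace ℝ (Fin d) → Fin m → EuclideanSpace ℝ (Fin q) → ℝ}
    {c : EuclideanSpace ℝ (Fin d) → Fin m → Fin m → ℝ}
    {g : EuclideanSpace ℝ (Fin d) → Fin m → ℝ}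
    {L1 L2 M2 : ℝ}

/-- Linear part of the Hamiltonian. -/
def HL (b : EuclideanSpace ℝ (Fin d) → Fin m → EuclideanSpace ℝ (Fin q) → EuclideanSpace ℝ (Fin d))
    (σ : EuclideanSpace ℝ (Fin d) → Fin m → EuclideanSpace ℝ (Fin q) → Matrix (Fin d) (Fin d) ℝ)
    (i : Fin m) (z : ℝ × EuclideanSpace ℝ (Fin d)) (l : ℝ × EuclideanSpace ℝ (Fin d) →L[ℝ] ℝ)
    (Q : ℝ × EuclideanSpace ℝ (Fin d) →L[ℝ] ℝ × EuclideanSpace ℝ (Fin d) →L[ℝ] ℝ)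
    (u : EuclideanSpace ℝ (Fin q)) : ℝ :=
  l (0, b z.2 i u) + (1 / 2) * ∑ k, Q (0, scol σ z.2 i u k) (0, scol σ z.2 i u k)

theorem Ham_eq (i : Fin m) (z : ℝ × EuclideanSpace ℝ (Fin d)) (l Q u) :
    Ham b σ f i z l Q u = HL b σ i z l Q u + f z.2 i u := rfl

theorem HL_add (i : Fin m) (z : ℝ × EuclideanSpace ℝ (Fin d)) (l Q l' Q' u) :
    HL b σ i z (l + l') (Q + Q') u = HL b σ i z l Q u + HL b σ i z l' Q' u := by
  simp only [HL, _root_.add_apply, Finset.sum_add_distrib]; ring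

theorem HL_smul (i : Fin m) (z : ℝ × EuclideanSpace ℝ (Fin d)) (a : ℝ) (l Q u) :
    HL b σ i z (a • l) (a • Q) u = a * HL b σ i z l Q u := by
  simp only [HL, _root_.smul_apply, smul_eq_mul, ← Finset.mul_sum]; ring

theorem HL_neg (i : Fin m) (z : ℝ × EuclideanSpace ℝ (Fin d)) (l Q u) :
    HL b σ i z (-l) (-Q) u = - HL b σ i z l Q u := by
  simp only [HL, _root_.neg_apply, Finset.sum_neg_distrib]; ring

theorem HL_zero (i : Fin m) (z : ℝ × EuclideanSpace ℝ (Fin d)) (u) :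
    HL b σ i z 0 0 u = 0 := by
  simp [HL]

theorem HL_mono (i : Fin m) (z : ℝ × EuclideanSpace ℝ (Fin d)) {l Q Q'} (h : ∀ v, Q v v ≤ Q' v v) (u) :
    HL b σ i z l Q u ≤ HL b σ i z l Q' u := by
  simp only [HL]
  gcongr with k
  exact h _

/-- The spatial bilinear form. -/
def spB (d : ℕ) : ℝ × EuclideanSpace ℝ (Fin d) →L[ℝ] ℝ × EuclideanSpace ℝ (Fin d) →L[ℝ] ℝ :=
  ((innerSL ℝ (E := EuclideanSpace ℝ (Fin d))).bilinearComp
    (ContinuousLinearMap.snd ℝ ℝ (EuclideanSpace ℝ (Fin d)))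
    (ContinuousLinearMap.snd ℝ ℝ (EuclideanSpace ℝ (Fin d))))

theorem spB_apply (h k : ℝ × EuclideanSpace ℝ (Fin d)) : spB d h k = ⟪h.2, k.2⟫ := by
  simp [spB, ContinuousLinearMap.bilinearComp_apply]

/-- `e^{Λ t} (1+|x-x0|²)^p` -/
def eb (x0 : EuclideanSpace ℝ (Fin d)) (Λ p : ℝ) (z : ℝ × EuclideanSpace ℝ (Fin d)) : ℝ :=
  Real.exp (Λ * z.1 + p * Real.log (1 + ‖z.2 - x0‖ ^ 2))

theorem eb_pos (x0 : EuclideanSpace ℝ (Fin d)) (Λ p : ℝ) (z) : 0 < eb x0 Λ p z := Real.exp_pos _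

theorem eb_eq (x0 : EuclideanSpace ℝ (Fin d)) (Λ : ℝ) (p : ℕ) (z) :
    eb x0 Λ p z = Real.exp (Λ * z.1) * (1 + ‖z.2 - x0‖ ^ 2) ^ p := by
  have : 0 < 1 + ‖z.2 - x0‖ ^ 2 := by positivity
  rw [eb, Real.exp_add, mul_comm (p : ℝ), ← Real.rpow_def_of_pos this, Real.rpow_natCast]

theorem eb_cont (x0 : EuclideanSpace ℝ (Fin d)) (Λ p : ℝ) : Continuous (eb x0 Λ p) := by
  unfold eb
  have : Continuous fun z : ℝ × EuclideanSpace ℝ (Fin d) => Real.log (1 + ‖z.2 - x0‖ ^ 2) := by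
    refine Continuous.log (by fun_prop) fun z => ?_
    positivity
  fun_prop

theorem log_taylor {a : ℝ} (ha : 0 < a) :
    (fun s => Real.log (a + s) - Real.log a - a⁻¹ * s - (1 / 2) * (-(a ^ 2)⁻¹) * s ^ 2) =o[𝓝 0]
      fun s : ℝ => s ^ 2 := by
  refine J2.of_hasDerivAt (φ1 := fun y => y⁻¹) ?_ ?_
  · filter_upwards [lt_mem_nhds ha] with y hy
    exact Real.hasDerivAt_log hy.ne'
  · exact hasDerivAt_inv ha.ne'

theorem exp_taylor (a : ℝ) :
    (fun s => Real.exp (a + s) - Real.exp a - Real.exp a * s - (1 / 2) * Real.exp a * s ^ 2) =o[𝓝 0]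
      fun s : ℝ => s ^ 2 :=
  J2.of_hasDerivAt (Eventually.of_forall fun y => Real.hasDerivAt_exp y) (Real.hasDerivAt_exp a)

theorem J2.const_add {E : Type*} [NormedAddCommGroup E] [NormedSpace ℝ E] {u : E → ℝ} {z l Q}
    (h : J2 u z l Q) (a : ℝ) : J2 (fun y => a + u y) z l Q := by
  refine Asymptotics.IsLittleO.congr_left h fun k => ?_
  ring

theorem abs_aux {A B e P S D : ℝ} (hA : |A| ≤ e * P) (hB : |B| ≤ D * (2 * (e * S))) :
    |A + (1 / 2) * B| ≤ (P + D * S) * e := by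
  rw [abs_le] at hA hB ⊢
  constructor <;> linarith

theorem expbar (h1 : H1Hyp Uset b σ f c g L1 L2 M2) (x0 : EuclideanSpace ℝ (Fin d)) (p : ℝ) (hp : 0 ≤ p) :
    ∃ Λ0 : ℝ, 0 ≤ Λ0 ∧ ∀ Λ z, ∃ l Q, J2 (eb x0 Λ p) z l Q ∧ l (1, 0) = Λ * eb x0 Λ p z ∧
      ∀ i, ∀ u ∈ Uset, |HL b σ i z l Q u| ≤ Λ0 * eb x0 Λ p z := by
  obtain ⟨M0, hM01, hM0⟩ := coef_growth h1
  set N := M0 * (1 + ‖x0‖) with hN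
  have hN0 : 0 ≤ N := by positivity
  refine ⟨4 * p * N + d * (20 * p * N ^ 2 + 16 * p ^ 2 * N ^ 2), by positivity, fun Λ z => ?_⟩
  set ρ := 1 + ‖z.2 - x0‖ ^ 2 with hρ
  have hρ0 : 0 < ρ := by positivity
  set lρ := (2 : ℝ) • spB d (z - (0, x0)) with hlρ
  have j1 : J2 (fun y : ℝ × EuclideanSpace ℝ (Fin d) => 1 + ‖y.2 - x0‖ ^ 2) z lρ ((2 : ℝ) • spB d) := by
    have := (J2.quad (spB d) (fun v w => by
      rw [spB_apply, spB_apply, real_inner_comm]) (0, x0) z).const_add 1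
    convert this using 2 with y
    rw [spB_apply, real_inner_self_eq_norm_sq]; rfl
  have j2 := j1.comp (φ := Real.log) rfl (log_taylor hρ0)
  have j3 := ((J2.clm (ContinuousLinearMap.fst ℝ ℝ (EuclideanSpace ℝ (Fin d))) z).const_mul Λ).add (j2.const_mul p)
  have j4 := j3.comp (φ := Real.exp) rfl (exp_taylor _)
  refine ⟨_, _, j4, ?_, ?_⟩
  · simp only [_root_.smul_apply, _root_.add_apply, smul_eq_mul, hlρ, spB_apply]
    simp [eb]
    ring
  · intro i u hu
    obtain ⟨gb, gs, -⟩ := hM0 z.2 i u hu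
    set n := ‖z.2 - x0‖ with hn
    have hn0 : 0 ≤ n := norm_nonneg _
    have hgr : M0 * (1 + ‖z.2‖) ≤ N * (1 + n) := by
      have : ‖z.2‖ ≤ n + ‖x0‖ := by simpa using norm_add_le (z.2 - x0) x0
      have : 1 + ‖z.2‖ ≤ (1 + ‖x0‖) * (1 + n) := by nlinarith [norm_nonneg x0]
      rw [hN, mul_assoc]; gcongr
    have kl : ∀ y : EuclideanSpace ℝ (Fin d), ‖y‖ ≤ N * (1 + n) → |ρ⁻¹ * lρ (0, y)| ≤ 4 * N := by
      intro y hy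
      rw [abs_mul, abs_of_pos (inv_pos.mpr hρ0), inv_mul_le_iff₀ hρ0]
      simp only [hlρ, _root_.smul_apply, smul_eq_mul, spB_apply, Prod.snd_sub]
      rw [abs_mul, abs_two]
      have := abs_real_inner_le_norm (z.2 - x0) y
      have h4 : ‖z.2 - x0‖ * ‖y‖ ≤ n * (N * (1 + n)) := by rw [← hn]; gcongr
      have h5 : n * (N * (1 + n)) ≤ N * (2 * ρ) := by rw [hρ]; nlinarith [mul_nonneg hN0 (sq_nonneg (n - 1)), mul_nonneg hN0 hn0]
      linarith
    set e := Real.exp (Λ * (ContinuousLinearMap.fst ℝ ℝ (EuclideanSpace ℝ (Fin d))) z + p * Real.log (1 + ‖z.2 - x0‖ ^ 2)) with he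
    have he0 : 0 < e := Real.exp_pos _
    have heb : eb x0 Λ p z = e := rfl
    rw [heb]
    have e1 : |e * (p * (ρ⁻¹ * lρ (0, b z.2 i u)))| ≤ e * (4 * p * N) := by
      rw [abs_mul, abs_of_pos he0, abs_mul, abs_of_nonneg hp]
      have := kl _ (gb.trans hgr)
      have : p * |ρ⁻¹ * lρ (0, b z.2 i u)| ≤ p * (4 * N) := by gcongr
      exact mul_le_mul_of_nonneg_left (by linarith) he0.le
    have e2 : ∀ k, |e * (p * (ρ⁻¹ * (2 * ‖scol σ z.2 i u k‖ ^ 2) - (ρ⁻¹ * lρ (0, scol σ z.2 i u k)) ^ 2)) +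
        e * (p * (ρ⁻¹ * lρ (0, scol σ z.2 i u k))) ^ 2| ≤ 2 * (e * (20 * p * N ^ 2 + 16 * p ^ 2 * N ^ 2)) := by
      intro k
      have k1 := kl _ ((gs k).trans hgr)
      set L := ρ⁻¹ * lρ (0, scol σ z.2 i u k)
      have k2 : L ^ 2 ≤ 16 * N ^ 2 := by
        have := sq_le_sq' (by linarith [(abs_le.mp k1).1]) ((abs_le.mp k1).2)
        linarith
      have k3 : ρ⁻¹ * (2 * ‖scol σ z.2 i u k‖ ^ 2) ≤ 4 * N ^ 2 := by
        rw [inv_mul_le_iff₀ hρ0]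
        have : ‖scol σ z.2 i u k‖ ^ 2 ≤ (N * (1 + n)) ^ 2 := by
          gcongr; exact (gs k).trans hgr
        have h6 : (1 + n) ^ 2 ≤ 2 * ρ := by rw [hρ]; nlinarith [sq_nonneg (n - 1)]
        have : (N * (1 + n)) ^ 2 ≤ N ^ 2 * (2 * ρ) := by rw [mul_pow]; gcongr
        linarith
      have k4 : 0 ≤ ρ⁻¹ * (2 * ‖scol σ z.2 i u k‖ ^ 2) := by positivity
      have k5 : e * (p * (ρ⁻¹ * (2 * ‖scol σ z.2 i u k‖ ^ 2) - L ^ 2)) + e * (p * L) ^ 2 = e * (p * (ρ⁻¹ * (2 * ‖scol σ z.2 i u k‖ ^ 2)) - p * L ^ 2 + p ^ 2 * L ^ 2) := by ring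
      rw [k5, abs_mul, abs_of_pos he0]
      have a1 : p * (ρ⁻¹ * (2 * ‖scol σ z.2 i u k‖ ^ 2)) ≤ p * (4 * N ^ 2) := by gcongr
      have a2 : 0 ≤ p * (ρ⁻¹ * (2 * ‖scol σ z.2 i u k‖ ^ 2)) := by positivity
      have a3 : p * L ^ 2 ≤ p * (16 * N ^ 2) := by gcongr
      have a4 : 0 ≤ p * L ^ 2 := by positivity
      have a5 : p ^ 2 * L ^ 2 ≤ p ^ 2 * (16 * N ^ 2) := by gcongr
      have a6 : 0 ≤ p ^ 2 * L ^ 2 := by positivity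
      have a7 : |p * (ρ⁻¹ * (2 * ‖scol σ z.2 i u k‖ ^ 2)) - p * L ^ 2 + p ^ 2 * L ^ 2| ≤ 2 * (20 * p * N ^ 2 + 16 * p ^ 2 * N ^ 2) := by
        rw [abs_le]; constructor <;> nlinarith
      calc _ ≤ e * (2 * (20 * p * N ^ 2 + 16 * p ^ 2 * N ^ 2)) := by gcongr
        _ = _ := by ring
    have e3 : |∑ k, (e * (p * (ρ⁻¹ * (2 * ‖scol σ z.2 i u k‖ ^ 2) - (ρ⁻¹ * lρ (0, scol σ z.2 i u k)) ^ 2)) +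
        e * (p * (ρ⁻¹ * lρ (0, scol σ z.2 i u k))) ^ 2)| ≤ d * (2 * (e * (20 * p * N ^ 2 + 16 * p ^ 2 * N ^ 2))) := by
      refine (Finset.abs_sum_le_sum_abs _ _).trans ?_
      simpa using Finset.sum_le_card_nsmul Finset.univ _ _ (fun k _ => e2 k)
    convert abs_aux e1 e3 using 2
    simp only [HL, _root_.smul_apply, _root_.add_apply, smul_eq_mul, ContinuousLinearMap.smulRight_apply,
      ContinuousLinearMap.coe_fst', mul_zero, zero_add, _root_.zero_apply]
    congr 2
    refine Finset.sum_congr rfl fun k _ => ?_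
    rw [spB_apply, real_inner_self_eq_norm_sq]
    simp only [hρ, ← inv_pow]
    ring

theorem no_loop (h1 : H1Hyp Uset b σ f c g L1 L2 M2) (x : EuclideanSpace ℝ (Fin d)) (A : Set (Fin m))
    (hA : A.Nonempty) (φ : Fin m → ℝ) : ∃ i ∈ A, ∀ j ∈ A, j ≠ i → φ j - c x i j < φ i := by
  classical
  by_contra hcon
  push Not at hcon
  choose! nx hn1 hn2 hn3 using hcon
  obtain ⟨i0, hi0⟩ := hA
  have hmem : ∀ n, nx^[n] i0 ∈ A := by
    intro n
    induction n with
    | zero => exact hi0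
    | succ n ih => rw [Function.iterate_succ_apply']; exact hn1 _ ih
  obtain ⟨a, b', hab, heq⟩ := Finite.exists_ne_map_eq_of_infinite (fun n : ℕ => nx^[n] i0)
  wlog hlt : a < b' generalizing a b'
  · exact this b' a hab.symm heq.symm (lt_of_le_of_ne (not_lt.mp hlt) hab.symm)
  set y := nx^[a] i0 with hy
  have hper : Function.IsPeriodicPt nx (b' - a) y := by
    show nx^[b' - a] (nx^[a] i0) = nx^[a] i0
    rw [← Function.iterate_add_apply, Nat.sub_add_cancel hlt.le]
    exact heq.symm
  set k := Function.minimalPeriod nx y with hk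
  have hk0 : 0 < k := hper.minimalPeriod_pos (by omega)
  have hymem : ∀ n, nx^[n] y ∈ A := by
    intro n; rw [hy, ← Function.iterate_add_apply]; exact hmem _
  have hk1 : k ≠ 1 := by
    intro h
    have := Function.minimalPeriod_eq_one_iff_isFixedPt.mp (hk ▸ h)
    exact hn2 y (hymem 0) this
  have hs := h1.noFreeLoop x k (by omega) (fun n => nx^[n] y) (by
    intro a b hab
    have := Function.iterate_injOn_Iio_minimalPeriod (f := nx) (x := y) (x₁ := (a : ℕ)) (x₂ := (b : ℕ)) a.2 b.2 hab
    exact Fin.ext this) (by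
    simp [hk])
  have hle : ∑ a ∈ Finset.range k, c x (nx^[a] y) (nx^[a + 1] y) ≤
      ∑ a ∈ Finset.range k, (φ (nx^[a + 1] y) - φ (nx^[a] y)) := by
    refine Finset.sum_le_sum fun a _ => ?_
    have := hn3 _ (hymem a)
    rw [Function.iterate_succ_apply']
    linarith
  rw [Finset.sum_range_sub (fun a => φ (nx^[a] y))] at hle
  have := Function.iterate_minimalPeriod (f := nx) (x := y)
  rw [← hk] at this
  rw [this] at hle
  simp only [Function.iterate_zero, id] at hle
  linarith

end Barrier

section Comparison

variable {d q m : ℕ} {Uset : Set (EuclideanSpace ℝ (Fin q))}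
    {b : EuclideanSpace ℝ (Fin d) → Fin m → EuclideanSpace ℝ (Fin q) → EuclideanSpace ℝ (Fin d)}
    {σ : EuclideanSpace ℝ (Fin d) → Fin m → EuclideanSpace ℝ (Fin q) → Matrix (Fin d) (Fin d) ℝ}
    {f : EuclideanSpace ℝ (Fin d) → Fin m → EuclideanSpace ℝ (Fin q) → ℝ}
    {c : EuclideanSpace ℝ (Fin d) → Fin m → Fin m → ℝ}
    {g : EuclideanSpace ℝ (Fin d) → Fin m → ℝ}
    {L1 L2 M2 : ℝ}

theorem inv_taylor {T a : ℝ} (ha : a < T) :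
    (fun s => (T - (a + s))⁻¹ - (T - a)⁻¹ - ((T - a) ^ 2)⁻¹ * s - (1 / 2) * (2 * (T - a) * (((T - a) ^ 2) ^ 2)⁻¹) * s ^ 2) =o[𝓝 0]
      fun s : ℝ => s ^ 2 := by
  refine J2.of_hasDerivAt (φ := fun s => (T - s)⁻¹) (φ1 := fun y => ((T - y) ^ 2)⁻¹) ?_ ?_
  · filter_upwards [gt_mem_nhds ha] with y hy
    have h1 : HasDerivAt (fun s => T - s) (-1) y := by simpa using (hasDerivAt_id y).const_sub T
    have := h1.inv (sub_ne_zero.mpr (ne_of_gt hy))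
    refine HasDerivAt.congr_deriv this ?_
    rw [neg_neg, one_div]
  · have h1 : HasDerivAt (fun s => T - s) (-1) a := by simpa using (hasDerivAt_id a).const_sub T
    have h0 : T - a ≠ 0 := sub_ne_zero.mpr (ne_of_gt ha)
    have := (h1.pow 2).inv (pow_ne_zero 2 h0)
    refine HasDerivAt.congr_deriv this ?_
    simp; ring

/-- the penalty function -/
def pen (η Λ T : ℝ) (k : ℕ) (z : ℝ × EuclideanSpace ℝ (Fin d)) : ℝ :=
  η * (eb 0 Λ ((k + 1 : ℕ) : ℝ) z + (T - z.1)⁻¹)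

theorem pen_jet (h1 : H1Hyp Uset b σ f c g L1 L2 M2) (k : ℕ) : ∃ Λ : ℝ, 0 ≤ Λ ∧
    ∀ (T η : ℝ), 0 < η → ∀ z : ℝ × EuclideanSpace ℝ (Fin d), 0 ≤ z.1 → z.1 < T →
    ∃ l Q, J2 (pen η Λ T k) z l Q ∧ ∀ i, ∀ u ∈ Uset, η ≤ l (1, 0) - HL b σ i z l Q u := by
  obtain ⟨Λ0, hΛ0, H⟩ := expbar h1 0 ((k + 1 : ℕ) : ℝ) (by positivity)
  refine ⟨Λ0 + 1, by linarith, fun T η hη z hz hzT => ?_⟩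
  obtain ⟨l, Q, hJ, hl, hHL⟩ := H (Λ0 + 1) z
  have j2 := (J2.clm (ContinuousLinearMap.fst ℝ ℝ (EuclideanSpace ℝ (Fin d))) z).comp
    (φ := fun s => (T - s)⁻¹) rfl (inv_taylor hzT)
  refine ⟨_, _, (hJ.add j2).const_mul η, fun i u hu => ?_⟩
  rw [HL_smul, HL_add]
  have e1 := (abs_le.mp (hHL i u hu)).2
  have e2 : 1 ≤ eb 0 (Λ0 + 1) ((k + 1 : ℕ) : ℝ) z := by
    rw [eb_eq]
    have a1 : 1 ≤ Real.exp ((Λ0 + 1) * z.1) := Real.one_le_exp (by positivity)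
    have a2 : 1 ≤ (1 + ‖z.2 - 0‖ ^ 2) ^ (k + 1) := one_le_pow₀ (by nlinarith [sq_nonneg ‖z.2 - 0‖])
    nlinarith
  have e3 : ∀ s t : ℝ, HL b σ i z (s • ContinuousLinearMap.fst ℝ ℝ (EuclideanSpace ℝ (Fin d)))
     (s • 0 + t • (ContinuousLinearMap.fst ℝ ℝ (EuclideanSpace ℝ (Fin d))).smulRight (ContinuousLinearMap.fst ℝ ℝ (EuclideanSpace ℝ (Fin d)))) u = 0 := by
    intro s t
    simp [HL]
  rw [e3]
  simp only [_root_.smul_apply, _root_.add_apply, smul_eq_mul, hl, ContinuousLinearMap.coe_fst', mul_one, add_zero]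
  have e4 : 0 ≤ ((T - z.1) ^ 2)⁻¹ := by positivity
  rw [← mul_sub]
  nlinarith

theorem pen_cont {η Λ T : ℝ} {k : ℕ} :
    ContinuousOn (pen (d := d) η Λ T k) {z | z.1 < T} := by
  unfold pen
  refine ContinuousOn.mul continuousOn_const ((eb_cont _ _ _).continuousOn.add ?_)
  refine ContinuousOn.inv₀ (by fun_prop) fun z hz => ?_
  have : z.1 < T := hz
  linarith

theorem pen_ge {η Λ T : ℝ} (hη : 0 < η) (hΛ : 0 ≤ Λ) {k : ℕ} {z : ℝ × EuclideanSpace ℝ (Fin d)} (hz : 0 ≤ z.1) :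
    η * (1 + ‖z.2‖ ^ 2) ^ (k + 1) + η * (T - z.1)⁻¹ ≤ pen η Λ T k z := by
  rw [pen, eb_eq, sub_zero, mul_add]
  have a1 : 1 ≤ Real.exp (Λ * z.1) := Real.one_le_exp (by positivity)
  have : (1 + ‖z.2‖ ^ 2) ^ (k + 1) ≤ Real.exp (Λ * z.1) * (1 + ‖z.2‖ ^ 2) ^ (k + 1) :=
    le_mul_of_one_le_left (by positivity) a1
  gcongr

theorem comparison (h1 : H1Hyp Uset b σ f c g L1 L2 M2)
    {u w : Fin m → ℝ × EuclideanSpace ℝ (Fin d) → ℝ}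
    (hu : ∀ i, UpperSemicontinuous (u i)) (hw : ∀ i, LowerSemicontinuous (w i))
    (hsub : JetSub Uset b σ f c u) (hsup : JetSuper Uset b σ f c w)
    {T C : ℝ} {k : ℕ} 
    (hub : ∀ i z, 0 ≤ z.1 → z.1 ≤ T → u i z ≤ C * (1 + ‖z.2‖ ^ 2) ^ k)
    (hwb : ∀ i z, 0 ≤ z.1 → z.1 ≤ T → -(C * (1 + ‖z.2‖ ^ 2) ^ k) ≤ w i z)
    (h0 : ∀ i x, u i (0, x) ≤ w i (0, x)) :
    ∀ i z, 0 ≤ z.1 → z.1 < T → u i z ≤ w i z := by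
  intro i0 z0 hz0 hz0T
  by_contra hcon
  push Not at hcon
  obtain ⟨Λ, hΛ, hpen⟩ := pen_jet h1 k
  have hT : 0 < T := by linarith
  -- nonnegative constant
  set C' := |C| with hC'
  have hC0 : 0 ≤ C' := abs_nonneg _
  have hdiff : ∀ i z, 0 ≤ z.1 → z.1 ≤ T → u i z - w i z ≤ 2 * C' * (1 + ‖z.2‖ ^ 2) ^ k := by
    intro i z h2 h3
    have := hub i z h2 h3
    have := hwb i z h2 h3
    have : C * (1 + ‖z.2‖ ^ 2) ^ k ≤ C' * (1 + ‖z.2‖ ^ 2) ^ k := by gcongr; exact le_abs_self _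
    linarith
  set γ := u i0 z0 - w i0 z0 with hγ
  have hγ0 : 0 < γ := by linarith
  have hp0 : 0 < pen 1 Λ T k z0 := by
    have := pen_ge (T := T) one_pos hΛ (k := k) hz0
    have h2 : 0 < (1 + ‖z0.2‖ ^ 2) ^ (k + 1) := by positivity
    have h3 : 0 < (T - z0.1)⁻¹ := inv_pos.mpr (by linarith)
    linarith
  set η := γ / (2 * pen 1 Λ T k z0) with hη
  have hη0 : 0 < η := by positivity
  have hpη : pen η Λ T k z0 = γ / 2 := by
    have : pen η Λ T k z0 = η * pen 1 Λ T k z0 := by simp [pen]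
    rw [this, hη]; field_simp
  set F : Fin m → ℝ × EuclideanSpace ℝ (Fin d) → ℝ := fun i z => u i z - w i z - pen η Λ T k z with hF
  have hF0 : 0 < F i0 z0 := by simp only [hF, hpη]; linarith
  set P := 2 * C' / η with hP
  have hP0 : 0 ≤ P := by positivity
  set τ := η / (2 * C' * P ^ k + 1) with hτ
  have hτ0 : 0 < τ := by positivity
  set K : Set (ℝ × EuclideanSpace ℝ (Fin d)) := Icc 0 (T - τ) ×ˢ Metric.closedBall 0 P with hK
  have hKc : IsCompact K := isCompact_Icc.prod (isCompact_closedBall _ _)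
  have hKmem : ∀ i z, 0 ≤ z.1 → z.1 < T → 0 < F i z → z ∈ K := by
    intro i z h2 h3 h4
    have e1 := hdiff i z h2 h3.le
    have e2 := pen_ge (T := T) hη0 hΛ (k := k) h2
    simp only [hF] at h4
    have hTz : 0 < (T - z.1)⁻¹ := inv_pos.mpr (by linarith)
    set ρ := 1 + ‖z.2‖ ^ 2 with hρ
    have hρ0 : 0 < ρ := by positivity
    have e3 : η * ρ ^ (k + 1) + η * (T - z.1)⁻¹ < 2 * C' * ρ ^ k := by linarith
    have e4 : η * ρ * ρ ^ k < 2 * C' * ρ ^ k := by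
      have : η * ρ ^ (k + 1) = η * ρ * ρ ^ k := by ring
      have : 0 < η * (T - z.1)⁻¹ := by positivity
      linarith
    have e5 : η * ρ < 2 * C' := lt_of_mul_lt_mul_right e4 (by positivity)
    have e6 : ρ ≤ P := by rw [hP, le_div_iff₀ hη0]; linarith
    have e7 : ‖z.2‖ ≤ P := by nlinarith [sq_nonneg (‖z.2‖ - 1), norm_nonneg z.2]
    have e8 : η * (T - z.1)⁻¹ < 2 * C' * P ^ k + 1 := by
      have : 2 * C' * ρ ^ k ≤ 2 * C' * P ^ k := by gcongr
      have : 0 < η * ρ ^ (k + 1) := by positivity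
      linarith
    have e9 : τ ≤ T - z.1 := by
      rw [hτ, div_le_iff₀ (by positivity)]
      have h5 : 0 < T - z.1 := by linarith
      rw [← div_eq_mul_inv, div_lt_iff₀ h5] at e8
      linarith
    exact ⟨⟨h2, by linarith⟩, by simpa using e7⟩
  have hz0K := hKmem i0 z0 hz0 hz0T hF0
  have hKT : K ⊆ {z | z.1 < T} := fun z hz => by
    have : z.1 ≤ T - τ := hz.1.2
    show z.1 < T
    linarith
  have huscF : ∀ i, UpperSemicontinuousOn (F i) K := by
    intro i
    have a1 : UpperSemicontinuousOn (u i) K := (hu i).upperSemicontinuousOn _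
    have a2 : UpperSemicontinuousOn (fun z => - w i z) K := by
      intro x hx y hy
      have := (hw i).lowerSemicontinuousOn K x hx (-y) (by simp only at hy; linarith)
      filter_upwards [this] with z hz
      linarith
    have a3 : UpperSemicontinuousOn (fun z => - pen η Λ T k z) K :=
      (pen_cont.mono hKT).neg.upperSemicontinuousOn
    have := (a1.add a2).add a3
    simpa only [hF, sub_eq_add_neg] using this
  have hmaxi : ∀ i, ∃ z ∈ K, ∀ y ∈ K, F i y ≤ F i z := fun i => by
    obtain ⟨z, hz, hm⟩ := UpperSemicontinuousOn.exists_isMaxOn ⟨z0, hz0K⟩ hKc (huscF i)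
    exact ⟨z, hz, fun y hy => hm hy⟩
  choose zm hzmK hzm using hmaxi
  obtain ⟨is, -, his⟩ := Finset.exists_max_image Finset.univ (fun i => F i (zm i)) ⟨i0, Finset.mem_univ _⟩
  set zh := zm is with hzh
  set ms := F is zh with hms
  have hms0 : 0 < ms := hF0.trans_le ((hzm i0 z0 hz0K).trans (his i0 (Finset.mem_univ _)))
  have hglob : ∀ i z, 0 ≤ z.1 → z.1 < T → F i z ≤ ms := by
    intro i z h2 h3
    by_cases h4 : 0 < F i z
    · exact (hzm i z (hKmem i z h2 h3 h4)).trans (his i (Finset.mem_univ _))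
    · linarith
  have hzhK : zh ∈ K := hzmK is
  have hzhT : zh.1 < T := hKT hzhK
  have hzh0 : 0 < zh.1 := by
    have h2 : 0 ≤ zh.1 := hzhK.1.1
    rcases h2.lt_or_eq with h | h
    · exact h
    · exfalso
      have h3 := h0 is zh.2
      have h4 : ((0 : ℝ), zh.2) = zh := by rw [h]
      rw [h4] at h3
      have h5 := pen_ge (T := T) hη0 hΛ (k := k) h2
      have h6 : 0 < η * (1 + ‖zh.2‖ ^ 2) ^ (k + 1) := by positivity
      have h7 : 0 < η * (T - zh.1)⁻¹ := mul_pos hη0 (inv_pos.mpr (by linarith))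
      simp only [hms, hF] at hms0
      linarith
  -- choice of index
  obtain ⟨i, hiA, hi⟩ := no_loop h1 zh.2 {i | F i zh = ms} ⟨is, rfl⟩ (fun i => u i zh)
  have hiA' : F i zh = ms := hiA
  have hstrict : ∀ j, j ≠ i → u j zh - c zh.2 i j < u i zh := by
    intro j hj
    by_contra hc
    push Not at hc
    have h2 := (hsup i zh hzh0).1 j hj
    have h3 : F j zh = ms := by
      refine le_antisymm (hglob j zh hzh0.le hzhT) ?_
      rw [← hiA']; simp only [hF]; linarith
    exact absurd (hi j h3 hj) (not_lt.mpr hc)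
  -- neighbourhood where first alternative holds
  have hnear : ∃ ε1 > 0, ∀ z, ‖z - zh‖ < ε1 → u i zh - ε1 < u i z → ∀ j, j ≠ i → u j z - c z.2 i j < u i z := by
    have : ∀ j, ∃ ε1 > 0, ∀ z, ‖z - zh‖ < ε1 → u i zh - ε1 < u i z → (j ≠ i → u j z - c z.2 i j < u i z) := by
      intro j
      by_cases hj : j ≠ i
      · set gp := u i zh - (u j zh - c zh.2 i j) with hgp
        have hgp0 : 0 < gp := by have := hstrict j hj; linarith
        have e1 := hu j zh (u j zh + gp / 3) (by linarith)
        have e2 : ∀ᶠ z : ℝ × EuclideanSpace ℝ (Fin d) in 𝓝 zh, c zh.2 i j - gp / 3 < c z.2 i j := by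
          have : Continuous fun z : ℝ × EuclideanSpace ℝ (Fin d) => c z.2 i j := (h1.cCont i j).comp continuous_snd
          exact this.continuousAt.eventually_const_lt (by linarith)
        obtain ⟨r, hr, hball⟩ := Metric.eventually_nhds_iff_ball.mp (e1.and e2)
        refine ⟨min r (gp / 3), by positivity, fun z hz hz' _ => ?_⟩
        obtain ⟨a1, a2⟩ := hball z (by rw [mem_ball_iff_norm]; exact hz.trans_le (min_le_left _ _))
        have := min_le_right r (gp / 3)
        linarith
      · exact ⟨1, one_pos, fun z _ _ h => absurd h hj⟩
    choose ε1 hε1 H using this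
    obtain ⟨js, -, hjs⟩ := Finset.exists_min_image Finset.univ ε1 ⟨i, Finset.mem_univ _⟩
    refine ⟨ε1 js, hε1 js, fun z hz hz' j hj => H j z (hz.trans_le (hjs j (Finset.mem_univ _))) ?_ hj⟩
    have := hjs j (Finset.mem_univ _)
    linarith
  obtain ⟨ε1, hε1, hnear⟩ := hnear
  set r := min zh.1 (T - zh.1) / 2 with hr
  have hmin : 0 < min zh.1 (T - zh.1) := lt_min hzh0 (by linarith)
  have hr0 : 0 < r := by positivity
  have hball : ∀ z, ‖z - zh‖ ≤ r → 0 < z.1 ∧ z.1 < T := by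
    intro z hz
    have h2 := (norm_fst_le (z - zh)).trans hz
    rw [Prod.fst_sub, Real.norm_eq_abs, abs_le] at h2
    have h3 := min_le_left zh.1 (T - zh.1)
    have h4 := min_le_right zh.1 (T - zh.1)
    constructor <;> linarith
  have hlscw : LowerSemicontinuousOn (fun z => w i z + pen η Λ T k z) (Metric.closedBall zh r) := by
    refine ((hw i).lowerSemicontinuousOn _).add ?_
    refine (pen_cont.mono ?_).lowerSemicontinuousOn
    intro z hz
    rw [mem_closedBall_iff_norm] at hz
    exact (hball z hz).2
  refine core h1 i (u := u i) (w := fun z => w i z + pen η Λ T k z) (c0 := zh) hr0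
    ((hu i).upperSemicontinuousOn _) hlscw ?_ hη0 (ε0 := min ε1 r) (by positivity) ?_ ?_
  · intro z hz
    rw [mem_closedBall_iff_norm] at hz
    obtain ⟨a1, a2⟩ := hball z hz
    have := hglob i z a1.le a2
    rw [← hiA'] at this
    simp only [hF] at this
    linarith
  · intro z hz hz' l Q hJ
    have b1 := min_le_left ε1 r
    have b2 := min_le_right ε1 r
    obtain ⟨a1, a2⟩ := hball z (by linarith)
    rcases hsub i z a1 l Q hJ with h | ⟨j, hj, h⟩
    · exact h
    · exact absurd (hnear z (by linarith) (by linarith) j hj) (not_lt.mpr h)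
  · intro z hz l Q hJ
    have b2 := min_le_right ε1 r
    obtain ⟨a1, a2⟩ := hball z (by linarith)
    obtain ⟨lp, Qp, hJp, hp⟩ := hpen T η hη0 z a1.le a2
    have hJ' := hJ.add hJp.neg.ljet
    have hJw : LJet (w i) z (l + -lp) (Q + -Qp) := by
      have e : (fun y => w i y + pen η Λ T k y + -pen η Λ T k y) = w i := by ext y; ring
      rwa [e] at hJ'
    obtain ⟨v, hv, hle⟩ := (hsup i z a1).2 _ _ hJw
    refine ⟨v, hv, ?_⟩
    have := hp i v hv
    rw [Ham_eq, HL_add, HL_neg] at hle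
    simp only [_root_.add_apply, _root_.neg_apply] at hle
    rw [Ham_eq]
    linarith

end Comparison

section TestLink

variable {d q m : ℕ} {Uset : Set (EuclideanSpace ℝ (Fin q))}
    {b : EuclideanSpace ℝ (Fin d) → Fin m → EuclideanSpace ℝ (Fin q) → EuclideanSpace ℝ (Fin d)}
    {σ : EuclideanSpace ℝ (Fin d) → Fin m → EuclideanSpace ℝ (Fin q) → Matrix (Fin d) (Fin d) ℝ}
    {f : EuclideanSpace ℝ (Fin d) → Fin m → EuclideanSpace ℝ (Fin q) → ℝ}
    {c : EuclideanSpace ℝ (Fin d) → Fin m → Fin m → ℝ}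
    {g : EuclideanSpace ℝ (Fin d) → Fin m → ℝ}
    {L1 L2 M2 : ℝ}

open scoped Manifold in
theorem exists_test {w : ℝ × EuclideanSpace ℝ (Fin d) → ℝ} (hw : Continuous w)
    {z l Q} (hJ : UJet w z l Q) {ε : ℝ} (hε : 0 < ε) :
    ∃ θ : ℝ × EuclideanSpace ℝ (Fin d) → ℝ, ContDiff ℝ 2 θ ∧ J2 θ z l (Q + (2 * ε) • euB d) ∧
      ∀ y, w y - θ y ≤ w z - θ z := by
  obtain ⟨r, hr, hball⟩ := Metric.eventually_nhds_iff.mp (hJ ε hε)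
  set P : ℝ × EuclideanSpace ℝ (Fin d) → ℝ := fun y =>
    l (y - z) + (1 / 2) * Q (y - z) (y - z) + ε * euB d (y - z) (y - z) with hP
  have hPc : ContDiff ℝ 2 P := by
    have e : ContDiff ℝ 2 fun y : ℝ × EuclideanSpace ℝ (Fin d) => y - z := contDiff_id.sub contDiff_const
    have e1 : ContDiff ℝ 2 fun y => l (y - z) := l.contDiff.comp e
    have e2 : ContDiff ℝ 2 fun y => Q (y - z) (y - z) := (Q.contDiff.comp e).clm_apply e
    have e3 : ContDiff ℝ 2 fun y => euB d (y - z) (y - z) := ((euB d).contDiff.comp e).clm_apply e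
    exact (e1.add (contDiff_const.mul e2)).add (contDiff_const.mul e3)
  set t : ℝ × EuclideanSpace ℝ (Fin d) → Set ℝ := fun y =>
    {a | w y - w z ≤ a ∧ (dist y z ≤ r / 2 → a = P y)} with ht
  have hPw : ∀ y, dist y z < r → w y - w z ≤ P y := by
    intro y hy
    have := hball (y := y - z) (by simpa [dist_eq_norm] using hy)
    rw [add_sub_cancel] at this
    have e := mul_le_mul_of_nonneg_left (euB_ge (d := d) (y - z)) hε.le
    simp only [hP]
    linarith
  obtain ⟨θ, hθ⟩ := exists_contMDiffMap_forall_mem_convex_of_local (n := 2)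
    𝓘(ℝ, ℝ × EuclideanSpace ℝ (Fin d)) (t := t) (by
      intro y a ha a' ha' s s' hs hs' hss
      refine ⟨?_, fun hy => ?_⟩
      · have h1 := mul_le_mul_of_nonneg_left ha.1 hs
        have h2 := mul_le_mul_of_nonneg_left ha'.1 hs'
        simp only [smul_eq_mul]
        have : w y - w z = s * (w y - w z) + s' * (w y - w z) := by rw [← add_mul, hss, one_mul]
        linarith
      · rw [ha.2 hy, ha'.2 hy, smul_eq_mul, smul_eq_mul, ← add_mul, hss, one_mul]) (by
      intro y
      by_cases hy : dist y z < r
      · refine ⟨Metric.ball z r, Metric.isOpen_ball.mem_nhds hy, P, hPc.contMDiff.contMDiffOn, fun y' hy' => ?_⟩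
        exact ⟨hPw y' hy', fun _ => rfl⟩
      · refine ⟨{y' | r / 2 < dist y' z ∧ w y' < w y + 1}, ?_, fun _ => w y + 1 - w z, contMDiffOn_const, fun y' hy' => ?_⟩
        · refine IsOpen.mem_nhds ?_ ?_
          · exact (isOpen_lt continuous_const (continuous_id.dist continuous_const)).inter
              (isOpen_lt hw continuous_const)
          · refine ⟨?_, by linarith⟩
            push Not at hy
            linarith
        · refine ⟨by linarith [hy'.2], fun h => ?_⟩
          linarith [hy'.1])
  have hθz : θ z = 0 := by
    rw [(hθ z).2 (by simp; linarith)]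
    simp [hP]
  refine ⟨θ, θ.contMDiff.contDiff, ?_, fun y => ?_⟩
  · have : (fun _ : ℝ × EuclideanSpace ℝ (Fin d) => (0:ℝ)) =o[𝓝 0] fun h : ℝ × EuclideanSpace ℝ (Fin d) => ‖h‖ ^ 2 :=
      Asymptotics.isLittleO_zero _ _
    refine this.congr' ?_ (EventuallyEq.refl _ _)
    have : ∀ᶠ k : ℝ × EuclideanSpace ℝ (Fin d) in 𝓝 0, dist k 0 < r / 2 := Metric.ball_mem_nhds _ (by linarith)
    filter_upwards [this] with k hk
    rw [hθz, (hθ (z + k)).2 (by simpa [dist_eq_norm] using hk.le)]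
    simp only [hP, add_sub_cancel_left, _root_.add_apply, _root_.smul_apply, smul_eq_mul]
    ring
  · have := (hθ y).1
    rw [hθz]
    linarith

theorem Lop_eq {θ : ℝ × EuclideanSpace ℝ (Fin d) → ℝ} (hθ : ContDiff ℝ 2 θ) (i : Fin m) (t : ℝ)
    (x : EuclideanSpace ℝ (Fin d)) (u : EuclideanSpace ℝ (Fin q)) :
    Lop b σ i u (fun y => θ (t, y)) x + f x i u =
      Ham b σ f i (t, x) (fderiv ℝ θ (t, x)) (fderiv ℝ (fderiv ℝ θ) (t, x)) u := by
  have e1 : ∀ y v, fderiv ℝ (fun y => θ (t, y)) y v = fderiv ℝ θ (t, y) (0, v) := by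
    intro y v
    have := ((hθ.differentiable (by norm_num) (t, y)).hasFDerivAt).comp y (hasFDerivAt_prodMk_right t y)
    have e := this.fderiv
    change fderiv ℝ (θ ∘ fun y => (t, y)) y v = _
    rw [e]; simp
  have e2 : ∀ v, fderiv ℝ (fun y => fderiv ℝ θ (t, y) (0, v)) x v = fderiv ℝ (fderiv ℝ θ) (t, x) (0, v) (0, v) := by
    intro v
    have hc : ContDiff ℝ 1 (fderiv ℝ θ) := hθ.fderiv_right (by norm_num)
    have h := ((hc.differentiable (by norm_num) (t, x)).hasFDerivAt).comp x (hasFDerivAt_prodMk_right t x)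
    have h2 := h.clm_apply (hasFDerivAt_const ((0 : ℝ), v) x)
    have e := h2.fderiv
    change fderiv ℝ (fun y => (fderiv ℝ θ ∘ fun y => (t, y)) y (0, v)) x v = _
    rw [e]; simp
  unfold Lop Ham
  simp only [e1]
  congr 2
  congr 1
  refine Finset.sum_congr rfl fun k _ => ?_
  exact e2 _

theorem Ham_cont (h1 : H1Hyp Uset b σ f c g L1 L2 M2) (i : Fin m) (z : ℝ × EuclideanSpace ℝ (Fin d)) (l Q) :
    Continuous fun u => Ham b σ f i z l Q u := by
  have a1 : Continuous fun u => b z.2 i u := (h1.bCont i).comp (Continuous.prodMk_right z.2)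
  have a2 : ∀ k, Continuous fun u => scol σ z.2 i u k := fun k => (scol_cont h1 i k).comp (Continuous.prodMk_right z.2)
  have a3 : Continuous fun u => f z.2 i u := (h1.fCont i).comp (Continuous.prodMk_right z.2)
  unfold Ham
  refine ((l.continuous.comp (continuous_const.prodMk a1)).add (continuous_const.mul ?_)).add a3
  refine continuous_finsetSum _ fun k _ => ?_
  have : Continuous fun u => ((0 : ℝ), scol σ z.2 i u k) := continuous_const.prodMk (a2 k)
  exact (Q.continuous.comp this).clm_apply this

theorem sInf_le_iff_U (h1 : H1Hyp Uset b σ f c g L1 L2 M2) {F : EuclideanSpace ℝ (Fin q) → ℝ} (hF : Continuous F) (a : ℝ) :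
    sInf (F '' Uset) ≤ a ↔ ∃ u ∈ Uset, F u ≤ a := by
  obtain ⟨u0, hu0, e, hle⟩ := h1.Ucompact.exists_sInf_image_eq_and_le h1.Unonempty hF.continuousOn
  rw [e]
  constructor
  · intro h; exact ⟨u0, hu0, h⟩
  · rintro ⟨u, hu, h⟩; exact (hle u hu).trans h

theorem le_sInf_iff_U (h1 : H1Hyp Uset b σ f c g L1 L2 M2) {F : EuclideanSpace ℝ (Fin q) → ℝ} (hF : Continuous F) (a : ℝ) :
    a ≤ sInf (F '' Uset) ↔ ∀ u ∈ Uset, a ≤ F u := by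
  obtain ⟨u0, hu0, e, hle⟩ := h1.Ucompact.exists_sInf_image_eq_and_le h1.Unonempty hF.continuousOn
  rw [e]
  constructor
  · intro h u hu; exact h.trans (hle u hu)
  · intro h; exact h u0 hu0

theorem Ham_congr (i : Fin m) (z : ℝ × EuclideanSpace ℝ (Fin d)) {l Q Q'} (h : ∀ v, Q v v = Q' v v) (u) :
    Ham b σ f i z l Q u = Ham b σ f i z l Q' u := by
  unfold Ham; simp only [h]

/-- jets of a `C²` function are unique -/
theorem J2.unique {E : Type*} [NormedAddCommGroup E] [NormedSpace ℝ E] {θ : E → ℝ} {z : E} {l Q l' Q'}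
    (h : J2 θ z l Q) (h' : J2 θ z l' Q') : l = l' ∧ ∀ v, Q v v = Q' v v := by
  obtain ⟨e1, e2⟩ := jets_compare h.ujet h'.ljet
  obtain ⟨_, e3⟩ := jets_compare h'.ujet h.ljet
  exact ⟨e1, fun v => le_antisymm (e3 v) (e2 v)⟩

theorem par_sub_of_jet (h1 : H1Hyp Uset b σ f c g L1 L2 M2) {V : ℝ → EuclideanSpace ℝ (Fin d) → Fin m → ℝ}
    (h : JetSub Uset b σ f c (fun i z => V z.1 z.2 i)) : ParabolicSub Uset b σ f c V := by
  intro t ht x i θ hθ hmax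
  have hJ := J2.of_contDiff hθ (t, x)
  have hU : UJet (fun z : ℝ × EuclideanSpace ℝ (Fin d) => V z.1 z.2 i) (t, x) _ _ :=
    ((hJ.const_add (V t x i - θ (t, x))).ujet).mono (by
      have : ∀ᶠ y : ℝ × EuclideanSpace ℝ (Fin d) in 𝓝 (t, x), 0 < y.1 :=
        continuous_fst.continuousAt.eventually (lt_mem_nhds ht)
      filter_upwards [this] with y hy
      have := hmax y.1 hy y.2
      linarith) (by simp)
  rcases h i (t, x) ht _ _ hU with h | h
  · left
    simp only [Lop_eq hθ]
    rw [le_sInf_iff_U h1 (Ham_cont h1 i (t, x) _ _)]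
    exact h
  · exact Or.inr h

theorem par_super_of_jet (h1 : H1Hyp Uset b σ f c g L1 L2 M2) {V : ℝ → EuclideanSpace ℝ (Fin d) → Fin m → ℝ}
    (h : JetSuper Uset b σ f c (fun i z => V z.1 z.2 i)) : ParabolicSuper Uset b σ f c V := by
  intro t ht x i θ hθ hmax
  have hJ := J2.of_contDiff hθ (t, x)
  have hU : LJet (fun z : ℝ × EuclideanSpace ℝ (Fin d) => V z.1 z.2 i) (t, x) _ _ :=
    ((hJ.const_add (V t x i - θ (t, x))).ljet).mono (by
      have : ∀ᶠ y : ℝ × EuclideanSpace ℝ (Fin d) in 𝓝 (t, x), 0 < y.1 :=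
        continuous_fst.continuousAt.eventually (lt_mem_nhds ht)
      filter_upwards [this] with y hy
      have := hmax y.1 hy y.2
      linarith) (by simp)
  obtain ⟨ho, hp⟩ := h i (t, x) ht
  refine ⟨?_, ho⟩
  simp only [Lop_eq hθ]
  rw [sInf_le_iff_U h1 (Ham_cont h1 i (t, x) _ _)]
  exact hp _ _ hU

theorem Ham_eps (h1 : H1Hyp Uset b σ f c g L1 L2 M2) (i : Fin m) (z : ℝ × EuclideanSpace ℝ (Fin d)) :
    ∃ K : ℝ, 0 ≤ K ∧ ∀ l Q, ∀ a : ℝ, ∀ u ∈ Uset,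
      |Ham b σ f i z l (Q + a • euB d) u - Ham b σ f i z l Q u| ≤ |a| * K := by
  obtain ⟨M, hM1, hM⟩ := coef_growth h1
  set K := (1 / 2) * ((d : ℝ) * (M * (1 + ‖z.2‖)) ^ 2) with hK
  refine ⟨K, by positivity, fun l Q a u hu => ?_⟩
  have e : Ham b σ f i z l (Q + a • euB d) u - Ham b σ f i z l Q u =
      a * ((1 / 2) * ∑ k, ‖scol σ z.2 i u k‖ ^ 2) := by
    unfold Ham
    have : ∀ k, (Q + a • euB d) (0, scol σ z.2 i u k) (0, scol σ z.2 i u k) =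
        Q (0, scol σ z.2 i u k) (0, scol σ z.2 i u k) + a * ‖scol σ z.2 i u k‖ ^ 2 := by
      intro k
      simp only [_root_.add_apply, _root_.smul_apply, smul_eq_mul]
      rw [euB_self]; simp
    simp only [this, Finset.sum_add_distrib, ← Finset.mul_sum]
    ring
  rw [e, abs_mul]
  refine mul_le_mul_of_nonneg_left ?_ (abs_nonneg a)
  rw [abs_of_nonneg (by positivity), hK]
  refine mul_le_mul_of_nonneg_left ?_ (by norm_num)
  calc _ ≤ ∑ k : Fin d, (M * (1 + ‖z.2‖)) ^ 2 :=
        Finset.sum_le_sum fun k _ => pow_le_pow_left₀ (norm_nonneg _) ((hM z.2 i u hu).2.1 k) 2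
    _ = _ := by simp

/-- if `Ham` with all `ε`-perturbations is above then so is `Ham` -/
theorem le_of_eps {a b K : ℝ} (hK : 0 ≤ K) (h : ∀ ε : ℝ, 0 < ε → a ≤ b + ε * K) : a ≤ b := by
  refine le_of_forall_pos_le_add fun δ hδ => ?_
  have := h (δ / (K + 1)) (by positivity)
  have e : δ / (K + 1) * K ≤ δ := by
    rw [div_mul_eq_mul_div, div_le_iff₀ (by linarith)]
    nlinarith
  linarith

theorem jet_of_par_sub (h1 : H1Hyp Uset b σ f c g L1 L2 M2) {W : ℝ → EuclideanSpace ℝ (Fin d) → Fin m → ℝ}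
    {w : Fin m → ℝ × EuclideanSpace ℝ (Fin d) → ℝ} (hw : ∀ i, Continuous (w i))
    (hwW : ∀ i z, 0 ≤ z.1 → w i z = W z.1 z.2 i)
    (h : ParabolicSub Uset b σ f c W) : JetSub Uset b σ f c w := by
  intro i z hz l Q hJ
  by_cases ho : ∃ j, j ≠ i ∧ w i z ≤ w j z - c z.2 i j
  · exact Or.inr ho
  left
  intro u hu
  obtain ⟨K, hK0, hK⟩ := Ham_eps h1 i z
  refine le_of_eps (K := 2 * K) (by positivity) fun ε hε => ?_
  obtain ⟨θ, hθ, hθJ, hmax⟩ := exists_test (hw i) hJ hε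
  rcases h z.1 hz z.2 i θ hθ (fun s hs y => by
    have := hmax (s, y)
    rwa [hwW i z hz.le, hwW i (s, y) hs.le] at this) with h | h
  · simp only [Lop_eq hθ] at h
    rw [le_sInf_iff_U h1 (Ham_cont h1 i (z.1, z.2) _ _)] at h
    obtain ⟨e1, e2⟩ := hθJ.unique (J2.of_contDiff hθ z)
    have := h u hu
    rw [← e1, ← Ham_congr i _ e2] at this
    have h3 := (abs_le.mp (hK l Q (2 * ε) u hu)).2
    rw [abs_of_pos (by linarith)] at h3
    change _ ≤ Ham b σ f i z l (Q + (2 * ε) • euB d) u at this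
    linarith
  · exfalso; apply ho
    obtain ⟨j, hj, h⟩ := h
    refine ⟨j, hj, ?_⟩
    rwa [hwW i z hz.le, hwW j z hz.le]

theorem LJet.neg' {E : Type*} [NormedAddCommGroup E] [NormedSpace ℝ E] {w : E → ℝ} {z : E} {l Q}
    (h : LJet w z l Q) : UJet (fun y => - w y) z (-l) (-Q) := by
  intro ε hε
  filter_upwards [h ε hε] with k hk
  simp only [_root_.neg_apply]
  linarith

theorem exists_touch {w : ℝ × EuclideanSpace ℝ (Fin d) → ℝ} (hw : Continuous w) (z : ℝ × EuclideanSpace ℝ (Fin d))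
    {s : Set (ℝ × EuclideanSpace ℝ (Fin d))} (hs : s ∈ 𝓝 z) : ∃ y ∈ s, ∃ l Q, LJet w y l Q := by
  have h1 : ∀ᶠ y in 𝓝 z, w z - 1 < w y := hw.continuousAt.eventually (lt_mem_nhds (by linarith))
  obtain ⟨r, hr, hb⟩ := Metric.nhds_basis_closedBall.mem_iff.mp (inter_mem hs h1)
  set F : ℝ × EuclideanSpace ℝ (Fin d) → ℝ := fun y => w y - (-(2 / r ^ 2)) * euB d (y - z) (y - z)
  have hF : Continuous F := by
    have e : Continuous fun y : ℝ × EuclideanSpace ℝ (Fin d) => y - z := continuous_id.sub continuous_const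
    exact hw.sub (continuous_const.mul (((euB d).continuous.comp e).clm_apply e))
  obtain ⟨y, hy, hmin⟩ := (isCompact_closedBall z r).exists_isMinOn ⟨z, Metric.mem_closedBall_self hr.le⟩ hF.continuousOn
  have hyr : dist y z < r := by
    rcases lt_or_eq_of_le (Metric.mem_closedBall.mp hy) with h | h
    · exact h
    exfalso
    have a1 := hmin (Metric.mem_closedBall_self hr.le)
    have a2 := (hb hy).2
    simp only [F, Set.mem_ofPred_eq, sub_self, map_zero] at a1 a2
    have a3 := euB_ge (d := d) (y - z)
    rw [← dist_eq_norm, h] at a3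
    have a4 : 2 ≤ 2 / r ^ 2 * euB d (y - z) (y - z) := by
      calc (2:ℝ) = 2 / r ^ 2 * r ^ 2 := by field_simp
        _ ≤ _ := mul_le_mul_of_nonneg_left a3 (by positivity)
    linarith
  refine ⟨y, (hb hy).1, ?_⟩
  have hU : UJet (fun y => - F y) y 0 0 := by
    refine ((J2.const y (- F y)).ujet).mono ?_ rfl
    filter_upwards [Metric.isOpen_ball.mem_nhds (Metric.mem_ball.mpr hyr)] with x hx
    have := hmin (Metric.ball_subset_closedBall hx)
    simpa using this
  have hU2 : UJet (fun y => - w y) y _ _ := UJet.add_euB (c0 := z) (δ := (2 / r ^ 2)) (l := 0) (Q := 0) (by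
    refine hU.mono (Eventually.of_forall fun x => ?_) ?_
    · simp only [F]; linarith
    · simp only [F]; linarith)
  exact ⟨_, _, hU2.neg⟩

theorem jet_of_par_super (h1 : H1Hyp Uset b σ f c g L1 L2 M2) {W : ℝ → EuclideanSpace ℝ (Fin d) → Fin m → ℝ}
    {w : Fin m → ℝ × EuclideanSpace ℝ (Fin d) → ℝ} (hw : ∀ i, Continuous (w i))
    (hwW : ∀ i z, 0 ≤ z.1 → w i z = W z.1 z.2 i)
    (h : ParabolicSuper Uset b σ f c W) : JetSuper Uset b σ f c w := by
  have key : ∀ i z, 0 < z.1 → ∀ l Q, LJet (w i) z l Q → ∀ ε : ℝ, 0 < ε →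
      (∃ u ∈ Uset, Ham b σ f i z l (Q + (-(2 * ε)) • euB d) u ≤ l (1, 0)) ∧ ∀ j, j ≠ i → w j z - c z.2 i j ≤ w i z := by
    intro i z hz l Q hJ ε hε
    obtain ⟨θ, hθ, hθJ, hmax⟩ := exists_test (hw i).neg hJ.neg' hε
    have hθn := hθ.neg
    obtain ⟨h2, h3⟩ := h z.1 hz z.2 i (fun y => - θ y) hθn (fun s hs y => by
      have := hmax (s, y)
      have e1 := hwW i z hz.le
      have e2 := hwW i (s, y) hs.le
      change - w i (s, y) - θ (s, y) ≤ - w i z - θ z at this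
      simp only at e2
      rw [e1, e2] at this
      linarith)
    refine ⟨?_, fun j hj => ?_⟩
    · simp only [Lop_eq hθn] at h2
      rw [sInf_le_iff_U h1 (Ham_cont h1 i (z.1, z.2) _ _)] at h2
      obtain ⟨u, hu, h2⟩ := h2
      refine ⟨u, hu, ?_⟩
      obtain ⟨e1, e2⟩ := hθJ.neg.unique (J2.of_contDiff hθn z)
      rw [← e1, ← Ham_congr i _ e2] at h2
      rw [neg_neg] at h2
      rw [Ham_congr (Q' := -(-Q + (2 * ε) • euB d))]
      · exact h2
      · intro v; simp only [_root_.add_apply, _root_.smul_apply, _root_.neg_apply, smul_eq_mul]; ring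
    · rw [hwW i z hz.le, hwW j z hz.le]; exact h3 j hj
  intro i z hz
  refine ⟨fun j hj => ?_, fun l Q hJ => ?_⟩
  · by_contra hcon
    push Not at hcon
    have hopen : IsOpen {y : ℝ × EuclideanSpace ℝ (Fin d) | 0 < y.1 ∧ w i y < w j y - c y.2 i j} :=
      (isOpen_lt continuous_const continuous_fst).inter
        (isOpen_lt (hw i) ((hw j).sub ((h1.cCont i j).comp continuous_snd)))
    obtain ⟨y, hy, l, Q, hJ⟩ := exists_touch (hw i) z (hopen.mem_nhds ⟨hz, hcon⟩)
    have := (key i y hy.1 l Q hJ 1 one_pos).2 j hj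
    linarith [hy.2]
  · obtain ⟨K, hK0, hK⟩ := Ham_eps h1 i z
    rw [← sInf_le_iff_U h1 (Ham_cont h1 i z l Q)]
    refine le_of_eps (K := 2 * K) (by positivity) fun ε hε => ?_
    obtain ⟨u, hu, hle⟩ := (key i z hz l Q hJ ε hε).1
    rw [sInf_le_iff_U h1 (Ham_cont h1 i z l Q)]
    refine ⟨u, hu, ?_⟩
    have h3 := (abs_le.mp (hK l Q (-(2 * ε)) u hu)).1
    rw [abs_neg, abs_of_pos (by linarith)] at h3
    linarith

end TestLink

section Barriers

variable {d q m : ℕ} {Uset : Set (EuclideanSpace ℝ (Fin q))}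
    {b : EuclideanSpace ℝ (Fin d) → Fin m → EuclideanSpace ℝ (Fin q) → EuclideanSpace ℝ (Fin d)}
    {σ : EuclideanSpace ℝ (Fin d) → Fin m → EuclideanSpace ℝ (Fin q) → Matrix (Fin d) (Fin d) ℝ}
    {f : EuclideanSpace ℝ (Fin d) → Fin m → EuclideanSpace ℝ (Fin q) → ℝ}
    {c : EuclideanSpace ℝ (Fin d) → Fin m → Fin m → ℝ}
    {g : EuclideanSpace ℝ (Fin d) → Fin m → ℝ}
    {L1 L2 M2 : ℝ}

theorem smooth_super (h1 : H1Hyp Uset b σ f c g L1 L2 M2) {w : Fin m → ℝ × EuclideanSpace ℝ (Fin d) → ℝ}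
    (ho : ∀ i j z, 0 < z.1 → j ≠ i → w j z - c z.2 i j ≤ w i z)
    (hp : ∀ i z, 0 < z.1 → ∃ l Q, J2 (w i) z l Q ∧ ∀ u ∈ Uset, Ham b σ f i z l Q u ≤ l (1, 0)) :
    JetSuper Uset b σ f c w := by
  intro i z hz
  refine ⟨fun j hj => ho i j z hz hj, fun l Q hJ => ?_⟩
  obtain ⟨l', Q', hJ', hu⟩ := hp i z hz
  obtain ⟨e1, e2⟩ := jets_compare hJ'.ujet hJ
  obtain ⟨u, hU⟩ := h1.Unonempty
  refine ⟨u, hU, ?_⟩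
  subst e1
  refine le_trans ?_ (hu u hU)
  rw [Ham_eq, Ham_eq]
  have := HL_mono (b := b) (σ := σ) i z (l := l') e2 u
  linarith

theorem smooth_sub {w : Fin m → ℝ × EuclideanSpace ℝ (Fin d) → ℝ}
    (hp : ∀ i z, 0 < z.1 → ∃ l Q, J2 (w i) z l Q ∧ ∀ u ∈ Uset, l (1, 0) ≤ Ham b σ f i z l Q u) :
    JetSub Uset b σ f c w := by
  intro i z hz l Q hJ
  left
  intro u hU
  obtain ⟨l', Q', hJ', hu⟩ := hp i z hz
  obtain ⟨e1, e2⟩ := jets_compare hJ hJ'.ljet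
  subst e1
  refine le_trans (hu u hU) ?_
  rw [Ham_eq, Ham_eq]
  have := HL_mono (b := b) (σ := σ) i z (l := l) e2 u
  linarith

theorem eb_one (x0 : EuclideanSpace ℝ (Fin d)) (Λ : ℝ) (z) :
    eb x0 Λ 1 z = Real.exp (Λ * z.1) * (1 + ‖z.2 - x0‖ ^ 2) := by
  have := eb_eq x0 Λ 1 z
  rw [Nat.cast_one, pow_one] at this
  exact this

theorem eb_ge (x0 : EuclideanSpace ℝ (Fin d)) {Λ : ℝ} (hΛ : 0 ≤ Λ) {z : ℝ × EuclideanSpace ℝ (Fin d)} (hz : 0 ≤ z.1) :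
    1 + ‖z.2 - x0‖ ^ 2 ≤ eb x0 Λ 1 z := by
  rw [eb_one]
  have : 1 ≤ Real.exp (Λ * z.1) := Real.one_le_exp (by positivity)
  nlinarith [sq_nonneg ‖z.2 - x0‖]

theorem grow_shift (x0 x : EuclideanSpace ℝ (Fin d)) :
    (1 + ‖x‖) ^ 2 ≤ 4 * (1 + ‖x0‖ ^ 2) * (1 + ‖x - x0‖ ^ 2) := by
  have e : ‖x‖ ≤ ‖x - x0‖ + ‖x0‖ := by simpa using norm_add_le (x - x0) x0
  have e2 : ‖x‖ ^ 2 ≤ (‖x - x0‖ + ‖x0‖) ^ 2 := pow_le_pow_left₀ (norm_nonneg _) e 2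
  nlinarith [sq_nonneg (‖x - x0‖ - ‖x0‖), sq_nonneg (1 - ‖x‖), sq_nonneg (‖x - x0‖ * ‖x0‖), norm_nonneg x]

theorem eb_le (x0 : EuclideanSpace ℝ (Fin d)) {Λ T : ℝ} (hΛ : 0 ≤ Λ) {z : ℝ × EuclideanSpace ℝ (Fin d)} (hz : z.1 ≤ T) :
    eb x0 Λ 1 z ≤ Real.exp (Λ * T) * (4 * (1 + ‖x0‖ ^ 2)) * (1 + ‖z.2‖ ^ 2) := by
  rw [eb_one, mul_assoc]
  refine mul_le_mul (Real.exp_le_exp.mpr (mul_le_mul_of_nonneg_left hz hΛ)) ?_ (by positivity) (Real.exp_pos _).le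
  have e : ‖z.2 - x0‖ ≤ ‖z.2‖ + ‖x0‖ := norm_sub_le _ _
  have e2 : ‖z.2 - x0‖ ^ 2 ≤ (‖z.2‖ + ‖x0‖) ^ 2 := pow_le_pow_left₀ (norm_nonneg _) e 2
  nlinarith [sq_nonneg (‖z.2‖ - ‖x0‖), sq_nonneg (‖z.2‖ * ‖x0‖), sq_nonneg ‖z.2‖, sq_nonneg ‖x0‖]

theorem quad_maj {h : EuclideanSpace ℝ (Fin d) → ℝ} (hc : Continuous h) {C : ℝ} (hC : ∀ x, |h x| ≤ C * (1 + ‖x‖ ^ 2))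
    (x0 : EuclideanSpace ℝ (Fin d)) {ε : ℝ} (hε : 0 < ε) :
    ∃ K : ℝ, 0 ≤ K ∧ ∀ x, h x ≤ h x0 + ε + K * ‖x - x0‖ ^ 2 := by
  have hev : ∀ᶠ x in 𝓝 x0, h x < h x0 + ε := hc.continuousAt.eventually (gt_mem_nhds (by linarith))
  obtain ⟨δ, hδ, hb⟩ := Metric.eventually_nhds_iff.mp hev
  set N := 4 * (1 + ‖x0‖ ^ 2) with hN
  have hN0 : 0 ≤ N := by positivity
  refine ⟨(|C| * N + |h x0|) * (1 / δ ^ 2 + 1), by positivity, fun x => ?_⟩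
  by_cases hx : dist x x0 < δ
  · have := hb hx
    have : 0 ≤ (|C| * N + |h x0|) * (1 / δ ^ 2 + 1) * ‖x - x0‖ ^ 2 := by positivity
    linarith
  · push Not at hx
    rw [dist_eq_norm] at hx
    have e1 : 1 + ‖x - x0‖ ^ 2 ≤ (1 / δ ^ 2 + 1) * ‖x - x0‖ ^ 2 := by
      have : δ ^ 2 ≤ ‖x - x0‖ ^ 2 := pow_le_pow_left₀ hδ.le hx 2
      have : 1 ≤ 1 / δ ^ 2 * ‖x - x0‖ ^ 2 := by
        rw [one_div, inv_mul_eq_div, le_div_iff₀ (by positivity)]; linarith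
      linarith
    have e2 : 1 + ‖x‖ ^ 2 ≤ N * (1 + ‖x - x0‖ ^ 2) := by
      have := grow_shift x0 x
      nlinarith [norm_nonneg x]
    have e3 : h x ≤ |C| * (N * (1 + ‖x - x0‖ ^ 2)) := by
      calc h x ≤ C * (1 + ‖x‖ ^ 2) := (le_abs_self _).trans (hC x)
        _ ≤ |C| * (1 + ‖x‖ ^ 2) := mul_le_mul_of_nonneg_right (le_abs_self _) (by positivity)
        _ ≤ _ := mul_le_mul_of_nonneg_left e2 (abs_nonneg _)
    have e4 : -h x0 ≤ |h x0| * (1 + ‖x - x0‖ ^ 2) := by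
      have := neg_le_abs (h x0)
      nlinarith [abs_nonneg (h x0), sq_nonneg ‖x - x0‖]
    have e5 : (|C| * N + |h x0|) * (1 + ‖x - x0‖ ^ 2) ≤ (|C| * N + |h x0|) * ((1 / δ ^ 2 + 1) * ‖x - x0‖ ^ 2) :=
      mul_le_mul_of_nonneg_left e1 (by positivity)
    nlinarith

theorem quad_maj_fin {h : Fin m → EuclideanSpace ℝ (Fin d) → ℝ} (hc : ∀ i, Continuous (h i)) {C : ℝ}
    (hC : ∀ i x, |h i x| ≤ C * (1 + ‖x‖ ^ 2))
    (x0 : EuclideanSpace ℝ (Fin d)) {ε : ℝ} (hε : 0 < ε) :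
    ∃ K : ℝ, 1 ≤ K ∧ ∀ i x, h i x ≤ h i x0 + ε + K * ‖x - x0‖ ^ 2 := by
  choose K hK0 hK using fun i => quad_maj (hc i) (hC i) x0 hε
  refine ⟨1 + ∑ i, K i, ?_, fun i x => ?_⟩
  · have := Finset.sum_nonneg fun i (_ : i ∈ Finset.univ) => hK0 i
    linarith
  · have e := Finset.single_le_sum (fun i _ => hK0 i) (Finset.mem_univ i)
    have := hK i x
    have := mul_le_mul_of_nonneg_right (show K i ≤ 1 + ∑ i, K i by linarith) (sq_nonneg ‖x - x0‖)
    linarith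

theorem strict_pot (h1 : H1Hyp Uset b σ f c g L1 L2 M2) (x0 : EuclideanSpace ℝ (Fin d)) {η : ℝ} (hη : 0 < η) :
    ∃ a : Fin m → ℝ, (∀ i, g x0 i ≤ a i) ∧ (∀ i, a i ≤ g x0 i + η) ∧ ∀ i j, j ≠ i → a j - a i < c x0 i j := by
  have key : ∀ A : Finset (Fin m), ∃ h : Fin m → ℕ, ∀ i ∈ A, ∀ j ∈ A, j ≠ i → g x0 j - c x0 i j = g x0 i → h j < h i := by
    intro A
    induction A using Finset.strongInduction with
    | H A ih =>
      rcases A.eq_empty_or_nonempty with rfl | hA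
      · exact ⟨fun _ => 0, by simp⟩
      · obtain ⟨i, hi, hi2⟩ := no_loop h1 x0 (A : Set (Fin m)) (by simpa using hA) (fun i => g x0 i)
        obtain ⟨h, hh⟩ := ih (A.erase i) (Finset.erase_ssubset (by simpa using hi))
        refine ⟨fun j => if j = i then 0 else h j + 1, fun k hk j hj hne htight => ?_⟩
        by_cases hki : k = i
        · subst hki
          have := hi2 j (by simpa using hj) hne
          linarith
        · by_cases hji : j = i
          · simp [hki, hji]
          · simp only [hki, hji, if_false]
            have := hh k (by simp [hki, hk]) j (by simp [hji, hj]) hne htight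
            omega
  obtain ⟨h, hh⟩ := key Finset.univ
  have hev : ∀ᶠ ε : ℝ in 𝓝[>] 0, ∀ i j, (ε * h i ≤ η) ∧ (j ≠ i → g x0 j - c x0 i j < g x0 i → ε * h j < g x0 i - g x0 j + c x0 i j) := by
    refine eventually_all.mpr fun i => eventually_all.mpr fun j => ?_
    have lim : ∀ n : ℕ, Tendsto (fun ε : ℝ => ε * n) (𝓝[>] 0) (𝓝 0) := by
      intro n
      have : Continuous fun ε : ℝ => ε * n := by fun_prop
      have := this.tendsto 0
      rw [zero_mul] at this
      exact this.mono_left nhdsWithin_le_nhds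
    refine ((lim (h i)).eventually (ge_mem_nhds hη)).and ?_
    by_cases hs : g x0 j - c x0 i j < g x0 i
    · filter_upwards [(lim (h j)).eventually (gt_mem_nhds (show (0:ℝ) < g x0 i - g x0 j + c x0 i j by linarith))] with ε he _ _
      exact he
    · exact Eventually.of_forall fun ε _ h => absurd h hs
  obtain ⟨ε, hε, hpos⟩ := (hev.and self_mem_nhdsWithin).exists
  have hpos : 0 < ε := hpos
  refine ⟨fun i => g x0 i + ε * h i, fun i => ?_, fun i => ?_, fun i j hne => ?_⟩
  · have : 0 ≤ ε * h i := by positivity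
    linarith
  · linarith [(hε i i).1]
  · have hnn : 0 ≤ ε * h i := by positivity
    rcases lt_or_eq_of_le (h1.gIneq x0 i j hne) with hs | hs
    · linarith [(hε i j).2 hne hs]
    · have : (h j : ℝ) < h i := by exact_mod_cast hh i (Finset.mem_univ _) j (Finset.mem_univ _) hne hs
      have := mul_lt_mul_of_pos_left this hpos
      linarith

theorem lower_barrier (h1 : H1Hyp Uset b σ f c g L1 L2 M2) (x0 : EuclideanSpace ℝ (Fin d)) {ε : ℝ} (hε : 0 < ε) :
    ∃ v : Fin m → ℝ × EuclideanSpace ℝ (Fin d) → ℝ, (∀ i, Continuous (v i)) ∧ JetSub Uset b σ f c v ∧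
      (∀ i z, z.1 ≤ 0 → v i z ≤ g z.2 i) ∧ (∀ i, g x0 i - ε ≤ v i (0, x0)) ∧
      (∃ C : ℝ, ∀ i z, v i z ≤ C) ∧
      (∀ T : ℝ, ∃ C : ℝ, ∀ i z, z.1 ≤ T → -(C * (1 + ‖z.2‖ ^ 2)) ≤ v i z) := by
  obtain ⟨M, hM1, hM⟩ := coef_growth h1
  obtain ⟨Λ0, hΛ0, hbar⟩ := expbar h1 x0 1 (by norm_num)
  obtain ⟨K, hK1, hK⟩ := quad_maj_fin (m := m) (h := fun i x => - g x i) (fun i => (h1.gCont i).neg) (C := M2)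
    (fun i x => by rw [abs_neg]; exact h1.gGrowth x i) x0 hε
  set N := 4 * (1 + ‖x0‖ ^ 2) with hN
  have hN0 : 0 ≤ N := by positivity
  set Λ := Λ0 + M * N with hΛ
  have hΛp : 0 ≤ Λ := by positivity
  have hgm : ∀ z : ℝ × EuclideanSpace ℝ (Fin d), 1 ≤ eb x0 Λ 1 (max z.1 0, z.2) := fun z => by
    have := eb_ge x0 hΛp (z := (max z.1 0, z.2)) (le_max_right _ _)
    nlinarith [sq_nonneg ‖z.2 - x0‖]
  refine ⟨fun j z => g x0 j - ε + (-K) * (-1 + eb x0 Λ 1 (max z.1 0, z.2)), fun j => ?_, ?_, ?_, ?_, ?_, ?_⟩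
  · have : Continuous fun z : ℝ × EuclideanSpace ℝ (Fin d) => (max z.1 0, z.2) := by fun_prop
    exact continuous_const.add (continuous_const.mul (continuous_const.add ((eb_cont x0 Λ 1).comp this)))
  · refine smooth_sub fun j z hz => ?_
    obtain ⟨l, Q, hJ, hl, hH⟩ := hbar Λ z
    have hJ2 := ((hJ.const_add (-1)).const_mul (-K)).const_add (g x0 j - ε)
    refine ⟨(-K) • l, (-K) • Q, ?_, ?_⟩
    · refine J2.mk (hJ2.ujet.mono ?_ ?_) (hJ2.ljet.mono ?_ ?_)
      all_goals try (simp only [max_eq_left hz.le])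
      all_goals
        have : ∀ᶠ y : ℝ × EuclideanSpace ℝ (Fin d) in 𝓝 z, 0 < y.1 :=
          continuous_fst.continuousAt.eventually (lt_mem_nhds hz)
        filter_upwards [this] with y hy
        simp only [max_eq_left hy.le, le_refl]
    · intro u hu
      rw [Ham_eq, HL_smul]
      simp only [_root_.smul_apply, smul_eq_mul, hl]
      have a1 := (abs_le.mp (hH j u hu)).2
      have a2 := (abs_le.mp (hM z.2 j u hu).2.2).1
      have a3 := grow_shift x0 z.2
      have a4 := eb_ge x0 hΛp hz.le
      have a5 : M * (1 + ‖z.2‖) ≤ M * N * eb x0 Λ 1 z := by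
        rw [mul_assoc]
        refine mul_le_mul_of_nonneg_left ?_ (by linarith)
        have : 1 + ‖z.2‖ ≤ (1 + ‖z.2‖) ^ 2 := by nlinarith [norm_nonneg z.2]
        exact (this.trans a3).trans (mul_le_mul_of_nonneg_left a4 hN0)
      have a6 : M * N * eb x0 Λ 1 z ≤ K * (M * N * eb x0 Λ 1 z) := by
        have : 0 ≤ M * N * eb x0 Λ 1 z := by have := eb_pos x0 Λ 1 z; positivity
        nlinarith
      have a7 := mul_le_mul_of_nonneg_left a1 (show 0 ≤ K by linarith)
      have a8 : K * (Λ * eb x0 Λ 1 z) = K * (Λ0 * eb x0 Λ 1 z) + K * (M * N * eb x0 Λ 1 z) := by rw [hΛ]; ring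
      linarith
  · intro i z hz
    have := hK i z.2
    simp only [max_eq_right hz, eb_one, mul_zero, Real.exp_zero, one_mul]
    linarith
  · intro i
    simp [eb_one]
  · refine ⟨∑ i, |g x0 i|, fun i z => ?_⟩
    have e1 := Finset.single_le_sum (fun i _ => abs_nonneg (g x0 i)) (Finset.mem_univ i)
    have e2 := le_abs_self (g x0 i)
    have e3 := hgm z
    have : 0 ≤ K * (-1 + eb x0 Λ 1 (max z.1 0, z.2)) := mul_nonneg (by linarith) (by linarith)
    simp only at e1 e3 ⊢
    linarith
  · intro T
    refine ⟨∑ i, |g x0 i| + ε + K * (Real.exp (Λ * max T 0) * (4 * (1 + ‖x0‖ ^ 2))), fun i z hz => ?_⟩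
    have e1 := Finset.single_le_sum (fun i _ => abs_nonneg (g x0 i)) (Finset.mem_univ i)
    have e2 := neg_le_abs (g x0 i)
    have e4 := eb_le x0 hΛp (T := max T 0) (z := (max z.1 0, z.2)) (max_le_max_right 0 hz)
    have e5 := mul_le_mul_of_nonneg_left e4 (show 0 ≤ K by linarith)
    have e6 : 0 ≤ (∑ i, |g x0 i| + ε) * ‖z.2‖ ^ 2 := by positivity
    simp only at e1 e5 ⊢
    linarith

theorem bump_b1 {E F : Type*} [NormedAddCommGroup E] [NormedSpace ℝ E] [NormedAddCommGroup F] [NormedSpace ℝ F] {χ : E → F} (hχc : ContDiff ℝ 1 χ)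
    (hs : HasCompactSupport χ) : ∃ C1 : ℝ,  (∀ z, ‖fderiv ℝ χ z‖ ≤ C1) ∧ HasCompactSupport (fderiv ℝ χ) :=by
  have := (hs.fderiv ℝ)
  obtain ⟨C1, hC1⟩ := (hs.fderiv ℝ).exists_bound_of_continuous (hχc.continuous_fderiv one_ne_zero)
  exact ⟨C1, hC1, this⟩
theorem bump_b2 {E : Type*} [NormedAddCommGroup E] [NormedSpace ℝ E] {χ : E → ℝ} (hχc : ContDiff ℝ 2 χ) : ContDiff ℝ 1 (fderiv ℝ χ) := hχc.fderiv_right (by norm_num)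
theorem bump_b3 {E : Type*} [NormedAddCommGroup E] [NormedSpace ℝ E] {χ : E → ℝ} (hχc : ContDiff ℝ 2 χ) 
    (hs : HasCompactSupport χ) : ∃ C1 : ℝ, (∀ z, ‖fderiv ℝ χ z‖ ≤ C1) ∧
      ∃ C2 : ℝ, (∀ z, ‖fderiv ℝ (fderiv ℝ χ) z‖ ≤ C2) := by
  obtain ⟨C, hC, hs1⟩ := bump_b1 (hχc.of_le (by norm_num)) hs
  obtain ⟨C', hC', hs1'⟩ := bump_b1 (bump_b2 hχc) hs1
  exact ⟨C, hC, C', hC'⟩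

theorem bump_bdd {E : Type*} [NormedAddCommGroup E] [NormedSpace ℝ E] {χ : E → ℝ} (hχc : ContDiff ℝ 2 χ)
    (hs : HasCompactSupport χ) : ∃ C1 : ℝ, 0 ≤ C1 ∧ (∀ z, ‖fderiv ℝ χ z‖ ≤ C1) ∧
      ∃ C2 : ℝ, 0 ≤ C2 ∧ (∀ z, ‖fderiv ℝ (fderiv ℝ χ) z‖ ≤ C2) := by
  obtain ⟨C1, hC1, C2, hC2⟩ := bump_b3 hχc hs
  exact ⟨max C1 0, le_max_right _ _, fun z => (hC1 z).trans (le_max_left _ _), max C2 0,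
    le_max_right _ _, fun z => (hC2 z).trans (le_max_left _ _)⟩

theorem bump0 (z0 : ℝ × EuclideanSpace ℝ (Fin d)) {ρ : ℝ} (hρ : 0 < ρ) :
    ∃ χ : ℝ × EuclideanSpace ℝ (Fin d) → ℝ, ContDiff ℝ 2 χ ∧ HasCompactSupport χ ∧ (∀ z, 0 ≤ χ z) ∧ (∀ z, χ z ≤ 1) ∧ χ z0 = 1 ∧
      (∀ z, ρ ≤ dist z z0 → χ z = 0)  := by
  obtain ⟨χ, hr⟩ : ∃ χ : ContDiffBump z0, χ.rOut = ρ := ⟨⟨ρ / 2, ρ, by linarith, by linarith⟩, rfl⟩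
  have hχc : ContDiff ℝ 2 χ := χ.contDiff
  exact ⟨χ, hχc, χ.hasCompactSupport, fun z => χ.nonneg, fun z => χ.le_one,
    χ.one_of_mem_closedBall (Metric.mem_closedBall_self χ.rIn_pos.le),
    fun z hz => χ.zero_of_le_dist (hr.le.trans hz)⟩
theorem exists_bump (z0 : ℝ × EuclideanSpace ℝ (Fin d)) {ρ : ℝ} (hρ : 0 < ρ) :
    ∃ χ : ℝ × EuclideanSpace ℝ (Fin d) → ℝ, ContDiff ℝ 2 χ ∧ (∀ z, 0 ≤ χ z) ∧ (∀ z, χ z ≤ 1) ∧ χ z0 = 1 ∧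
      (∀ z, ρ ≤ dist z z0 → χ z = 0) ∧ ∃ C1 : ℝ, 0 ≤ C1 ∧ (∀ z, ‖fderiv ℝ χ z‖ ≤ C1) ∧
      ∃ C2 : ℝ, 0 ≤ C2 ∧ (∀ z, ‖fderiv ℝ (fderiv ℝ χ) z‖ ≤ C2) := by
  obtain ⟨χ, hχc, hs, h1, h2, h3, h4⟩ := bump0 z0 hρ
  exact ⟨χ, hχc, h1, h2, h3, h4, bump_bdd hχc hs⟩

set_option maxHeartbeats 1000000 in
theorem upper_barrier (h1 : H1Hyp Uset b σ f c g L1 L2 M2) (x0 : EuclideanSpace ℝ (Fin d)) {ε : ℝ} (hε : 0 < ε) :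
    ∃ w : Fin m → ℝ × EuclideanSpace ℝ (Fin d) → ℝ, (∀ i, Continuous (w i)) ∧ JetSuper Uset b σ f c w ∧
      (∀ i x, g x i ≤ w i (0, x)) ∧ (∀ i, w i (0, x0) ≤ g x0 i + ε) ∧
      (∃ C : ℝ, ∀ i z, 0 ≤ z.1 → -C ≤ w i z) ∧
      (∀ T : ℝ, ∃ C : ℝ, ∀ i z, 0 ≤ z.1 → z.1 ≤ T → w i z ≤ C * (1 + ‖z.2‖ ^ 2)) := by
  obtain ⟨M, hM1, hM⟩ := coef_growth h1
  obtain ⟨Λ0, hΛ0, hbar⟩ := expbar h1 x0 1 (by norm_num)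
  obtain ⟨a, ha1, ha2, ha3⟩ := strict_pot h1 x0 (η := ε / 2) (by linarith)
  have hev : ∀ᶠ x in 𝓝 x0, ∀ i j, j ≠ i → a j - a i < c x i j := by
    refine eventually_all.mpr fun i => eventually_all.mpr fun j => ?_
    by_cases hne : j ≠ i
    · filter_upwards [(h1.cCont i j).continuousAt.eventually (lt_mem_nhds (ha3 i j hne))] with x hx _
      exact hx
    · exact Eventually.of_forall fun x h => absurd h hne
  obtain ⟨ρ, hρ, hball⟩ := Metric.eventually_nhds_iff.mp hev
  obtain ⟨χ, hχc, hχ0, hχ1, hχx, hχs', C1, hC1p, hC1, C2, hC2p, hC2⟩ := exists_bump ((0 : ℝ), x0) hρ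
  have hχs : ∀ z, χ z ≠ 0 → dist z.2 x0 < ρ := by
    intro z hz
    by_contra hcon
    push Not at hcon
    refine hz (hχs' z (hcon.trans ?_))
    rw [Prod.dist_eq]; exact le_max_right _ _
  have hg2 : ∀ i x, |g x i + (-a i) * χ (0, x)| ≤ (M2 + ∑ i, |a i|) * (1 + ‖x‖ ^ 2) := by
    intro i x
    have e1 := Finset.single_le_sum (fun i _ => abs_nonneg (a i)) (Finset.mem_univ i)
    have e2 : |(-a i) * χ (0, x)| ≤ |a i| := by
      rw [abs_mul, abs_neg, abs_of_nonneg (hχ0 _)]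
      exact mul_le_of_le_one_right (abs_nonneg _) (hχ1 _)
    have e3 := h1.gGrowth x i
    have e4 := abs_add_le (g x i) ((-a i) * χ (0, x))
    have e5 : 0 ≤ (∑ i, |a i|) * ‖x‖ ^ 2 := by positivity
    linarith
  obtain ⟨K, hK1, hK⟩ := quad_maj_fin (m := m) (h := fun i x => g x i + (-a i) * χ (0, x))
    (fun i => (h1.gCont i).add (continuous_const.mul (hχc.continuous.comp (by fun_prop)))) hg2 x0
    (ε := ε / 2) (by linarith)
  set N := 4 * (1 + ‖x0‖ ^ 2) with hN
  have hN0 : 0 ≤ N := by positivity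
  set S := ∑ i, |a i| with hS
  have hS0 : 0 ≤ S := Finset.sum_nonneg fun i _ => abs_nonneg _
  have haS : ∀ i, |a i| ≤ S := fun i => Finset.single_le_sum (f := fun i => |a i|) (fun i _ => abs_nonneg (a i)) (Finset.mem_univ i)
  set D := C1 + C1 * M + d * C2 * M ^ 2 with hD
  have hD0 : 0 ≤ D := by positivity
  set Λ := Λ0 + (M + S * D) * N with hΛ
  have hΛp : 0 ≤ Λ := by positivity
  refine ⟨fun j z => ε / 2 + (a j * χ z + K * (-1 + eb x0 Λ 1 z)), fun j => ?_, ?_, ?_, ?_, ?_, ?_⟩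
  · exact continuous_const.add ((continuous_const.mul hχc.continuous).add
      (continuous_const.mul (continuous_const.add (eb_cont x0 Λ 1))))
  · refine smooth_super h1 (fun i j z hz hne => ?_) fun j z hz => ?_
    · have : (a j - a i) * χ z ≤ c z.2 i j := by
        by_cases h0 : χ z = 0
        · rw [h0, mul_zero]; exact h1.cNonneg _ _ _
        · rcases le_or_gt (a j - a i) 0 with hn | hp
          · exact (mul_nonpos_of_nonpos_of_nonneg hn (hχ0 z)).trans (h1.cNonneg _ _ _)
          · exact (mul_le_of_le_one_right hp.le (hχ1 z)).trans (hball (hχs z h0) i j hne).le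
      linarith
    · obtain ⟨l, Q, hJ, hl, hH⟩ := hbar Λ z
      have hJχ := J2.of_contDiff hχc z
      have hJ2 := ((hJχ.const_mul (a j)).add ((hJ.const_add (-1)).const_mul K)).const_add (ε / 2)
      refine ⟨_, _, hJ2, fun u hu => ?_⟩
      rw [Ham_eq, HL_add, HL_smul, HL_smul]
      simp only [_root_.add_apply, _root_.smul_apply, smul_eq_mul, hl]
      have a1 := (abs_le.mp (hH j u hu)).2
      have a2 := (abs_le.mp (hM z.2 j u hu).2.2).2
      have a3 := grow_shift x0 z.2
      have a4 := eb_ge x0 hΛp hz.le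
      have a34 : (1 + ‖z.2‖) ^ 2 ≤ N * eb x0 Λ 1 z := a3.trans (mul_le_mul_of_nonneg_left a4 hN0)
      have hx1 : 1 + ‖z.2‖ ≤ (1 + ‖z.2‖) ^ 2 := by nlinarith [norm_nonneg z.2]
      have hx2 : 1 ≤ (1 + ‖z.2‖) ^ 2 := by nlinarith [norm_nonneg z.2]
      have b1 : |fderiv ℝ χ z (1, 0)| ≤ C1 * (1 + ‖z.2‖) ^ 2 := by
        have := (fderiv ℝ χ z).le_opNorm (1, 0)
        have e : ‖((1 : ℝ), (0 : EuclideanSpace ℝ (Fin d)))‖ = 1 := by simp [Prod.norm_def]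
        rw [e, mul_one] at this
        calc _ ≤ ‖fderiv ℝ χ z‖ := this
          _ ≤ C1 := hC1 z
          _ ≤ _ := le_mul_of_one_le_right hC1p hx2
      have b2 : |fderiv ℝ χ z (0, b z.2 j u)| ≤ C1 * M * (1 + ‖z.2‖) ^ 2 := by
        have := (fderiv ℝ χ z).le_opNorm (0, b z.2 j u)
        have e : ‖((0 : ℝ), b z.2 j u)‖ = ‖b z.2 j u‖ := by simp [Prod.norm_def]
        rw [e] at this
        calc _ ≤ ‖fderiv ℝ χ z‖ * ‖b z.2 j u‖ := this
          _ ≤ C1 * (M * (1 + ‖z.2‖)) := mul_le_mul (hC1 z) (hM z.2 j u hu).1 (norm_nonneg _) hC1p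
          _ ≤ C1 * (M * (1 + ‖z.2‖) ^ 2) := by gcongr
          _ = _ := by ring
      have b3 : |∑ k, fderiv ℝ (fderiv ℝ χ) z (0, scol σ z.2 j u k) (0, scol σ z.2 j u k)| ≤ d * C2 * M ^ 2 * (1 + ‖z.2‖) ^ 2 := by
        calc _ ≤ ∑ k, |fderiv ℝ (fderiv ℝ χ) z (0, scol σ z.2 j u k) (0, scol σ z.2 j u k)| := Finset.abs_sum_le_sum_abs _ _
          _ ≤ ∑ k : Fin d, C2 * (M * (1 + ‖z.2‖)) * (M * (1 + ‖z.2‖)) := by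
            refine Finset.sum_le_sum fun k _ => ?_
            have := (fderiv ℝ (fderiv ℝ χ) z).le_opNorm₂ (0, scol σ z.2 j u k) (0, scol σ z.2 j u k)
            have e : ‖((0 : ℝ), scol σ z.2 j u k)‖ = ‖scol σ z.2 j u k‖ := by simp [Prod.norm_def]
            rw [e] at this
            have e2 := (hM z.2 j u hu).2.1 k
            refine le_trans this ?_
            have := hC2 z
            gcongr
          _ = _ := by simp; ring
      have b4 : |HL b σ j z (fderiv ℝ χ z) (fderiv ℝ (fderiv ℝ χ) z) u - fderiv ℝ χ z (1, 0)| ≤ D * (1 + ‖z.2‖) ^ 2 := by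
        unfold HL
        rw [abs_le] at b1 b2 b3 ⊢
        have hpp : 0 ≤ d * C2 * M ^ 2 * (1 + ‖z.2‖) ^ 2 := by positivity
        rw [hD]
        constructor <;> linarith [b1.1, b1.2, b2.1, b2.2, b3.1, b3.2]
      have b5 : a j * (HL b σ j z (fderiv ℝ χ z) (fderiv ℝ (fderiv ℝ χ) z) u - fderiv ℝ χ z (1, 0)) ≤ S * D * (N * eb x0 Λ 1 z) := by
        calc _ ≤ |a j * (HL b σ j z (fderiv ℝ χ z) (fderiv ℝ (fderiv ℝ χ) z) u - fderiv ℝ χ z (1, 0))| := le_abs_self _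
          _ ≤ S * (D * (1 + ‖z.2‖) ^ 2) := by
            rw [abs_mul]; exact mul_le_mul (haS j) b4 (abs_nonneg _) hS0
          _ ≤ S * (D * (N * eb x0 Λ 1 z)) := by gcongr
          _ = _ := by ring
      have a5 : M * (1 + ‖z.2‖) ≤ M * (N * eb x0 Λ 1 z) :=
        mul_le_mul_of_nonneg_left (hx1.trans a34) (by linarith)
      have a6 : (M + S * D) * (N * eb x0 Λ 1 z) ≤ K * ((M + S * D) * (N * eb x0 Λ 1 z)) := by
        have := eb_pos x0 Λ 1 z
        exact le_mul_of_one_le_left (by positivity) hK1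
      have a7 := mul_le_mul_of_nonneg_left a1 (show 0 ≤ K by linarith)
      have a8 : K * (Λ * eb x0 Λ 1 z) = K * (Λ0 * eb x0 Λ 1 z) + K * ((M + S * D) * (N * eb x0 Λ 1 z)) := by rw [hΛ]; ring
      linarith
  · intro i x
    have := hK i x
    rw [hχx] at this
    simp only [eb_one, mul_zero, Real.exp_zero, one_mul]
    linarith [ha1 i]
  · intro i
    simp [eb_one, hχx]
    linarith [ha2 i]
  · refine ⟨S, fun i z hz => ?_⟩
    have e3 := eb_ge x0 hΛp hz
    have e4 : 0 ≤ K * (-1 + eb x0 Λ 1 z) := mul_nonneg (by linarith) (by nlinarith [sq_nonneg ‖z.2 - x0‖])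
    have e5 : -S ≤ a i * χ z := by
      have : |a i * χ z| ≤ S := by
        rw [abs_mul, abs_of_nonneg (hχ0 z)]
        exact (mul_le_of_le_one_right (abs_nonneg _) (hχ1 z)).trans (haS i)
      exact (abs_le.mp this).1
    linarith
  · intro T
    refine ⟨ε + S + K * (Real.exp (Λ * T) * (4 * (1 + ‖x0‖ ^ 2))), fun i z hz hzT => ?_⟩
    have e4 := eb_le x0 hΛp hzT
    have e5 := mul_le_mul_of_nonneg_left e4 (show 0 ≤ K by linarith)
    have e5' : a i * χ z ≤ S := by
      have : |a i * χ z| ≤ S := by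
        rw [abs_mul, abs_of_nonneg (hχ0 z)]
        exact (mul_le_of_le_one_right (abs_nonneg _) (hχ1 z)).trans (haS i)
      exact (abs_le.mp this).2
    have e6 : 0 ≤ (ε + S) * ‖z.2‖ ^ 2 := by positivity
    linarith

end Barriers

section PerronA

variable {d q m : ℕ} {Uset : Set (EuclideanSpace ℝ (Fin q))}
    {b : EuclideanSpace ℝ (Fin d) → Fin m → EuclideanSpace ℝ (Fin q) → EuclideanSpace ℝ (Fin d)}
    {σ : EuclideanSpace ℝ (Fin d) → Fin m → EuclideanSpace ℝ (Fin q) → Matrix (Fin d) (Fin d) ℝ}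
    {f : EuclideanSpace ℝ (Fin d) → Fin m → EuclideanSpace ℝ (Fin q) → ℝ}
    {c : EuclideanSpace ℝ (Fin d) → Fin m → Fin m → ℝ}
    {g : EuclideanSpace ℝ (Fin d) → Fin m → ℝ}
    {L1 L2 M2 : ℝ}

/-- upper semicontinuous envelope -/
def env {Z : Type*} [TopologicalSpace Z] (F : Z → ℝ) (z : Z) : ℝ := sInf {a | ∀ᶠ y in 𝓝 z, F y ≤ a}

/-- lower semicontinuous envelope -/
def lenv {Z : Type*} [TopologicalSpace Z] (F : Z → ℝ) (z : Z) : ℝ := - env (fun y => - F y) z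

section Env
variable {Z : Type*} [TopologicalSpace Z] {F : Z → ℝ}

theorem env_bdd (z : Z) : BddBelow {a | ∀ᶠ y in 𝓝 z, F y ≤ a} :=
  ⟨F z, fun a (ha : ∀ᶠ y in 𝓝 z, F y ≤ a) => ha.self_of_nhds⟩

theorem env_le' {z : Z} {a : ℝ} (h : ∀ᶠ y in 𝓝 z, F y ≤ a) : env F z ≤ a := csInf_le (env_bdd z) h

theorem env_le {z : Z} {G : Z → ℝ} (hG : ContinuousAt G z) (h : ∀ᶠ y in 𝓝 z, F y ≤ G y) : env F z ≤ G z := by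
  refine le_of_forall_gt_imp_ge_of_dense fun a ha => env_le' ?_
  filter_upwards [h, hG.eventually (gt_mem_nhds ha)] with y h1 h2
  exact h1.trans h2.le

theorem le_env {z : Z} (hb : ∃ a, ∀ᶠ y in 𝓝 z, F y ≤ a) : F z ≤ env F z :=
  le_csInf hb fun a (ha : ∀ᶠ y in 𝓝 z, F y ≤ a) => ha.self_of_nhds

theorem env_lt {z : Z} {a : ℝ} (hb : ∃ a, ∀ᶠ y in 𝓝 z, F y ≤ a) (h : env F z < a) :
    ∃ a' < a, ∀ᶠ y in 𝓝 z, F y ≤ a' := by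
  obtain ⟨a', h1, h2⟩ := exists_lt_of_csInf_lt hb h
  exact ⟨a', h2, h1⟩

theorem env_usc (hb : ∀ z, ∃ a, ∀ᶠ y in 𝓝 z, F y ≤ a) : UpperSemicontinuous (env F) := by
  intro z a ha
  obtain ⟨a', h1, h2⟩ := env_lt (hb z) ha
  filter_upwards [eventually_eventually_nhds.mpr h2] with y hy
  exact (env_le' hy).trans_lt h1

theorem lt_env {z : Z} {a : ℝ} (h : a < env F z) : ∃ᶠ y in 𝓝 z, a < F y := by
  intro hcon
  have : env F z ≤ a := env_le' (by
    filter_upwards [hcon] with y hy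
    exact not_lt.mp hy)
  linarith

theorem le_lenv {z : Z} {G : Z → ℝ} (hG : ContinuousAt G z) (h : ∀ᶠ y in 𝓝 z, G y ≤ F y) : G z ≤ lenv F z := by
  have := env_le (F := fun y => - F y) hG.neg (by filter_upwards [h] with y hy; simpa using hy)
  unfold lenv
  simp only [Pi.neg_apply] at this
  linarith

theorem lenv_le {z : Z} (hb : ∃ a, ∀ᶠ y in 𝓝 z, a ≤ F y) : lenv F z ≤ F z := by
  obtain ⟨a, ha⟩ := hb
  have := le_env (F := fun y => - F y) (z := z) ⟨-a, by filter_upwards [ha] with y hy; linarith⟩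
  unfold lenv
  linarith

theorem lenv_lsc (hb : ∀ z, ∃ a, ∀ᶠ y in 𝓝 z, a ≤ F y) : LowerSemicontinuous (lenv F) := by
  have := env_usc (F := fun y => - F y) (fun z => by
    obtain ⟨a, ha⟩ := hb z
    exact ⟨-a, by filter_upwards [ha] with y hy; linarith⟩)
  intro z a ha
  unfold lenv at ha ⊢
  filter_upwards [this z (-a) (by linarith)] with y hy
  linarith

end Env

/-- the polynomial test function -/
def pol (z : ℝ × EuclideanSpace ℝ (Fin d)) (l : ℝ × EuclideanSpace ℝ (Fin d) →L[ℝ] ℝ)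
    (Q : ℝ × EuclideanSpace ℝ (Fin d) →L[ℝ] ℝ × EuclideanSpace ℝ (Fin d) →L[ℝ] ℝ) (γ : ℝ)
    (y : ℝ × EuclideanSpace ℝ (Fin d)) : ℝ :=
  l (y - z) + (1 / 2) * Q (y - z) (y - z) + γ * euB d (y - z) (y - z)

theorem pol_contDiff (z : ℝ × EuclideanSpace ℝ (Fin d)) (l Q) (γ : ℝ) : ContDiff ℝ 2 (pol z l Q γ) := by
  have e : ContDiff ℝ 2 fun y : ℝ × EuclideanSpace ℝ (Fin d) => y - z := contDiff_id.sub contDiff_const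
  have e1 : ContDiff ℝ 2 fun y => l (y - z) := l.contDiff.comp e
  have e2 : ContDiff ℝ 2 fun y => Q (y - z) (y - z) := (Q.contDiff.comp e).clm_apply e
  have e3 : ContDiff ℝ 2 fun y => euB d (y - z) (y - z) := ((euB d).contDiff.comp e).clm_apply e
  exact (e1.add (contDiff_const.mul e2)).add (contDiff_const.mul e3)

theorem pol_self (z : ℝ × EuclideanSpace ℝ (Fin d)) (l Q) (γ : ℝ) : pol z l Q γ z = 0 := by
  simp [pol]

theorem pol_J2 (z : ℝ × EuclideanSpace ℝ (Fin d)) (l Q) (γ : ℝ) :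
    J2 (pol z l Q γ) z l (Q + (2 * γ) • euB d) := by
  have : (fun _ : ℝ × EuclideanSpace ℝ (Fin d) => (0:ℝ)) =o[𝓝 0] fun h : ℝ × EuclideanSpace ℝ (Fin d) => ‖h‖ ^ 2 :=
      Asymptotics.isLittleO_zero _ _
  refine this.congr_left fun k => ?_
  rw [pol_self]
  simp only [pol, add_sub_cancel_left, _root_.add_apply, _root_.smul_apply, smul_eq_mul]
  ring

theorem Ham_cont_zu (h1 : H1Hyp Uset b σ f c g L1 L2 M2) {θ : ℝ × EuclideanSpace ℝ (Fin d) → ℝ} (hθ : ContDiff ℝ 2 θ)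
    (i : Fin m) :
    Continuous fun p : (ℝ × EuclideanSpace ℝ (Fin d)) × EuclideanSpace ℝ (Fin q) =>
      Ham b σ f i p.1 (fderiv ℝ θ p.1) (fderiv ℝ (fderiv ℝ θ) p.1) p.2 - fderiv ℝ θ p.1 (1, 0) := by
  have hfc : ContDiff ℝ 1 (fderiv ℝ θ) := hθ.fderiv_right (by norm_num)
  have c1 : Continuous fun p : (ℝ × EuclideanSpace ℝ (Fin d)) × EuclideanSpace ℝ (Fin q) => fderiv ℝ θ p.1 :=
    hfc.continuous.comp continuous_fst
  have c2 : Continuous fun p : (ℝ × EuclideanSpace ℝ (Fin d)) × EuclideanSpace ℝ (Fin q) => fderiv ℝ (fderiv ℝ θ) p.1 :=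
    (hfc.continuous_fderiv one_ne_zero).comp continuous_fst
  have cx : Continuous fun p : (ℝ × EuclideanSpace ℝ (Fin d)) × EuclideanSpace ℝ (Fin q) => (p.1.2, p.2) := by fun_prop
  have cb := (h1.bCont i).comp cx
  have cf := (h1.fCont i).comp cx
  have cs := fun k => (scol_cont h1 i k).comp cx
  unfold Ham
  refine Continuous.sub (Continuous.add (Continuous.add (c1.clm_apply (continuous_const.prodMk cb))
    (continuous_const.mul (continuous_finsetSum _ fun k _ => ?_))) cf) (c1.clm_apply continuous_const)
  exact (c2.clm_apply (continuous_const.prodMk (cs k))).clm_apply (continuous_const.prodMk (cs k))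

theorem Ham_pol (i : Fin m) (z : ℝ × EuclideanSpace ℝ (Fin d)) (l Q) (γ : ℝ) (u) :
    fderiv ℝ (pol z l Q γ) z = l ∧
    Ham b σ f i z (fderiv ℝ (pol z l Q γ) z) (fderiv ℝ (fderiv ℝ (pol z l Q γ)) z) u = Ham b σ f i z l (Q + (2 * γ) • euB d) u := by
  obtain ⟨e1, e2⟩ := (J2.of_contDiff (pol_contDiff z l Q γ) z).unique (pol_J2 z l Q γ)
  refine ⟨e1, ?_⟩
  rw [e1, Ham_congr i z e2]

theorem pol_upper {w : ℝ × EuclideanSpace ℝ (Fin d) → ℝ} {z l Q} (hJ : UJet w z l Q) {γ : ℝ} (hγ : 0 < γ) :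
    ∀ᶠ y in 𝓝 z, w y ≤ w z + pol z l Q (2 * γ) y - γ * ‖y - z‖ ^ 2 := by
  obtain ⟨r, hr, hball⟩ := Metric.eventually_nhds_iff.mp (hJ γ hγ)
  refine Metric.eventually_nhds_iff.mpr ⟨r, hr, fun y hy => ?_⟩
  have := hball (y := y - z) (by simpa [dist_eq_norm] using hy)
  rw [add_sub_cancel] at this
  have e := mul_le_mul_of_nonneg_left (euB_ge (d := d) (y - z)) hγ.le
  simp only [pol]
  linarith

theorem pol_lower {w : ℝ × EuclideanSpace ℝ (Fin d) → ℝ} {z l Q} (hJ : LJet w z l Q) {γ : ℝ} (hγ : 0 < γ) :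
    ∀ᶠ y in 𝓝 z, w z + pol z l Q (-(2 * γ)) y + γ * ‖y - z‖ ^ 2 ≤ w y := by
  obtain ⟨r, hr, hball⟩ := Metric.eventually_nhds_iff.mp (hJ γ hγ)
  refine Metric.eventually_nhds_iff.mpr ⟨r, hr, fun y hy => ?_⟩
  have := hball (y := y - z) (by simpa [dist_eq_norm] using hy)
  rw [add_sub_cancel] at this
  have e := mul_le_mul_of_nonneg_left (euB_ge (d := d) (y - z)) hγ.le
  simp only [pol]
  linarith

/-- the Perron class -/
def SubCl (Uset : Set (EuclideanSpace ℝ (Fin q)))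
    (b : EuclideanSpace ℝ (Fin d) → Fin m → EuclideanSpace ℝ (Fin q) → EuclideanSpace ℝ (Fin d))
    (σ : EuclideanSpace ℝ (Fin d) → Fin m → EuclideanSpace ℝ (Fin q) → Matrix (Fin d) (Fin d) ℝ)
    (f : EuclideanSpace ℝ (Fin d) → Fin m → EuclideanSpace ℝ (Fin q) → ℝ)
    (c : EuclideanSpace ℝ (Fin d) → Fin m → Fin m → ℝ)
    (g : EuclideanSpace ℝ (Fin d) → Fin m → ℝ)
    (v : Fin m → ℝ × EuclideanSpace ℝ (Fin d) → ℝ) : Prop :=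
  (∀ i, UpperSemicontinuous (v i)) ∧ JetSub Uset b σ f c v ∧ (∀ i z, z.1 ≤ 0 → v i z ≤ g z.2 i) ∧
    ∀ T : ℝ, ∃ C : ℝ, ∃ k : ℕ, ∀ i z, 0 ≤ z.1 → z.1 ≤ T → v i z ≤ C * (1 + ‖z.2‖ ^ 2) ^ k

theorem sub_le_upper (h1 : H1Hyp Uset b σ f c g L1 L2 M2) {v w : Fin m → ℝ × EuclideanSpace ℝ (Fin d) → ℝ}
    (hv : SubCl Uset b σ f c g v) (hw : ∀ i, Continuous (w i)) (hsup : JetSuper Uset b σ f c w)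
    (hg : ∀ i x, g x i ≤ w i (0, x)) (hC : ∃ C : ℝ, ∀ i z, 0 ≤ z.1 → -C ≤ w i z) :
    ∀ i z, 0 ≤ z.1 → v i z ≤ w i z := by
  intro i z hz
  obtain ⟨h2, h3, h4, h5⟩ := hv
  obtain ⟨C, k, hCk⟩ := h5 (z.1 + 1)
  obtain ⟨C', hC'⟩ := hC
  have hp : ∀ x : EuclideanSpace ℝ (Fin d), 1 ≤ (1 + ‖x‖ ^ 2) ^ k := fun x => one_le_pow₀ (by nlinarith [sq_nonneg ‖x‖])
  refine comparison h1 h2 (fun i => (hw i).lowerSemicontinuous) h3 hsup (T := z.1 + 1) (C := |C| + |C'|) (k := k)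
    (fun i y hy hy' => ?_) (fun i y hy hy' => ?_) (fun i x => (h4 i (0, x) le_rfl).trans (hg i x)) i z hz (by linarith)
  · refine (hCk i y hy hy').trans (mul_le_mul_of_nonneg_right ?_ (by positivity))
    linarith [le_abs_self C, abs_nonneg C']
  · refine le_trans ?_ (hC' i y hy)
    have := hp y.2
    have : C' ≤ (|C| + |C'|) * (1 + ‖y.2‖ ^ 2) ^ k := by
      have e : |C| + |C'| ≤ (|C| + |C'|) * (1 + ‖y.2‖ ^ 2) ^ k := le_mul_of_one_le_right (by positivity) this
      linarith [le_abs_self C', abs_nonneg C]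
    linarith

theorem update_mem {V : Fin m → ℝ × EuclideanSpace ℝ (Fin d) → ℝ}
    (hV : SubCl Uset b σ f c g V) (i : Fin m) {N : ℝ × EuclideanSpace ℝ (Fin d) → ℝ} (hN : UpperSemicontinuous N)
    (hVN : ∀ z, V i z ≤ N z) (h0 : ∀ z, z.1 ≤ 0 → N z ≤ g z.2 i)
    (hgr : ∃ B : ℝ, ∀ z, 0 ≤ z.1 → N z ≤ B ∨ ∃ j, N z ≤ V j z)
    (hJ : ∀ z, 0 < z.1 → V i z < N z → ∀ l Q, UJet N z l Q →
      (∀ u ∈ Uset, l (1, 0) ≤ Ham b σ f i z l Q u) ∨ ∃ j, j ≠ i ∧ N z ≤ V j z - c z.2 i j) :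
    SubCl Uset b σ f c g (Function.update V i N) := by
  obtain ⟨h2, h3, h4, h5⟩ := hV
  have hle : ∀ k z, V k z ≤ Function.update V i N k z := by
    intro k z
    by_cases hk : k = i
    · subst hk; rw [Function.update_self]; exact hVN z
    · rw [Function.update_of_ne hk]
  refine ⟨fun k => ?_, fun k z hz l Q hU => ?_, fun k z hz => ?_, fun T => ?_⟩
  · by_cases hk : k = i
    · subst hk; rw [Function.update_self]; exact hN
    · rw [Function.update_of_ne hk]; exact h2 k
  · have main : Function.update V i N k z = V k z → (∀ u ∈ Uset, l (1, 0) ≤ Ham b σ f k z l Q u) ∨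
        ∃ j, j ≠ k ∧ Function.update V i N k z ≤ Function.update V i N j z - c z.2 k j := by
      intro e
      rcases h3 k z hz l Q (hU.mono (Eventually.of_forall fun y => hle k y) e.symm) with h | ⟨j, hj, h⟩
      · exact Or.inl h
      · exact Or.inr ⟨j, hj, by rw [e]; linarith [hle j z]⟩
    by_cases hk : k = i
    · subst hk
      rcases (hVN z).lt_or_eq with hlt | heq
      · rw [Function.update_self] at hU
        rcases hJ z hz hlt l Q hU with h | ⟨j, hj, h⟩
        · exact Or.inl h
        · refine Or.inr ⟨j, hj, ?_⟩
          rw [Function.update_self, Function.update_of_ne hj]; exact h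
      · exact main (by rw [Function.update_self, heq])
    · exact main (by rw [Function.update_of_ne hk])
  · by_cases hk : k = i
    · subst hk; rw [Function.update_self]; exact h0 z hz
    · rw [Function.update_of_ne hk]; exact h4 k z hz
  · obtain ⟨C, n, hC⟩ := h5 T
    obtain ⟨B, hB⟩ := hgr
    refine ⟨|C| + |B|, n, fun k z hz hzT => ?_⟩
    have hp : 1 ≤ (1 + ‖z.2‖ ^ 2) ^ n := one_le_pow₀ (by nlinarith [sq_nonneg ‖z.2‖])
    have key : ∀ j, V j z ≤ (|C| + |B|) * (1 + ‖z.2‖ ^ 2) ^ n := fun j => by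
      refine (hC j z hz hzT).trans (mul_le_mul_of_nonneg_right ?_ (by positivity))
      linarith [le_abs_self C, abs_nonneg B]
    by_cases hk : k = i
    · subst hk; rw [Function.update_self]
      rcases hB z hz with h | ⟨j, h⟩
      · have e : |C| + |B| ≤ (|C| + |B|) * (1 + ‖z.2‖ ^ 2) ^ n := le_mul_of_one_le_right (by positivity) hp
        linarith [le_abs_self B, abs_nonneg C]
      · exact h.trans (key j)
    · rw [Function.update_of_ne hk]; exact key k

end PerronA

section PerronB

variable {d q m : ℕ} {Uset : Set (EuclideanSpace ℝ (Fin q))}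
    {b : EuclideanSpace ℝ (Fin d) → Fin m → EuclideanSpace ℝ (Fin q) → EuclideanSpace ℝ (Fin d)}
    {σ : EuclideanSpace ℝ (Fin d) → Fin m → EuclideanSpace ℝ (Fin q) → Matrix (Fin d) (Fin d) ℝ}
    {f : EuclideanSpace ℝ (Fin d) → Fin m → EuclideanSpace ℝ (Fin q) → ℝ}
    {c : EuclideanSpace ℝ (Fin d) → Fin m → Fin m → ℝ}
    {g : EuclideanSpace ℝ (Fin d) → Fin m → ℝ}
    {L1 L2 M2 : ℝ}

theorem perron_jetsub (h1 : H1Hyp Uset b σ f c g L1 L2 M2) {P : (Fin m → ℝ × EuclideanSpace ℝ (Fin d) → ℝ) → Prop}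
    (hP : ∀ v, P v → (∀ i, UpperSemicontinuous (v i)) ∧ JetSub Uset b σ f c v)
    {U : Fin m → ℝ × EuclideanSpace ℝ (Fin d) → ℝ} (hU : ∀ i, UpperSemicontinuous (U i))
    (hle : ∀ v, P v → ∀ i z, v i z ≤ U i z)
    (hap : ∀ i z a, a < U i z → ∃ᶠ y in 𝓝 z, ∃ v, P v ∧ a < v i y) : JetSub Uset b σ f c U := by
  intro i z hz l Q hJ
  by_contra hcon
  push Not at hcon
  obtain ⟨⟨u0, hu0, hlt⟩, hobs⟩ := hcon
  obtain ⟨K, hK0, hK⟩ := Ham_eps h1 i z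
  set κ := l (1, 0) - Ham b σ f i z l Q u0 with hκ
  have hκ0 : 0 < κ := by linarith
  set γ := κ / (8 * (K + 1)) with hγ
  have hγ0 : 0 < γ := by positivity
  have hγK : 4 * γ * K < κ := by
    have : γ * (8 * (K + 1)) = κ := by rw [hγ]; field_simp
    nlinarith
  set θ := pol z l Q (2 * γ) with hθd
  have hθ : ContDiff ℝ 2 θ := pol_contDiff z l Q (2 * γ)
  have hHz : Ham b σ f i z (fderiv ℝ θ z) (fderiv ℝ (fderiv ℝ θ) z) u0 - fderiv ℝ θ z (1, 0) < 0 := by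
    obtain ⟨e1, e2⟩ := Ham_pol (b := b) (σ := σ) (f := f) i z l Q (2 * γ) u0
    rw [hθd, e2, e1]
    have := (abs_le.mp (hK l Q (2 * (2 * γ)) u0 hu0)).2
    rw [abs_of_pos (by positivity)] at this
    linarith
  have E1 : ∀ᶠ y in 𝓝 z, Ham b σ f i y (fderiv ℝ θ y) (fderiv ℝ (fderiv ℝ θ) y) u0 - fderiv ℝ θ y (1, 0) < 0 := by
    have hc : Continuous fun y : ℝ × EuclideanSpace ℝ (Fin d) =>
        Ham b σ f i y (fderiv ℝ θ y) (fderiv ℝ (fderiv ℝ θ) y) u0 - fderiv ℝ θ y (1, 0) :=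
      (Ham_cont_zu h1 hθ i).comp (continuous_id.prodMk continuous_const)
    exact hc.continuousAt.eventually (gt_mem_nhds hHz)
  obtain ⟨η, hη0, hη⟩ : ∃ η : ℝ, 0 < η ∧ ∀ j, j ≠ i → U j z - c z.2 i j + 4 * η < U i z := by
    have : ∀ᶠ η : ℝ in 𝓝[>] 0, ∀ j, j ≠ i → U j z - c z.2 i j + 4 * η < U i z := by
      refine eventually_all.mpr fun j => ?_
      by_cases hj : j = i
      · simp [hj]
      · have hc : Continuous fun η : ℝ => U j z - c z.2 i j + 4 * η := by fun_prop
        have h0 : U j z - c z.2 i j + 4 * 0 < U i z := by linarith [hobs j hj]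
        have := (hc.continuousAt (x := 0)).eventually (gt_mem_nhds h0)
        filter_upwards [this.filter_mono nhdsWithin_le_nhds] with η h _
        exact h
    obtain ⟨η, h, h'⟩ := (this.and self_mem_nhdsWithin).exists
    exact ⟨η, h', h⟩
  have E2 : ∀ᶠ y in 𝓝 z, ∀ j, j ≠ i → U j y - c y.2 i j < U j z - c z.2 i j + η := by
    refine eventually_all.mpr fun j => ?_
    have a1 := hU j z (U j z + η / 2) (by linarith)
    have hc : Continuous fun y : ℝ × EuclideanSpace ℝ (Fin d) => c y.2 i j := (h1.cCont i j).comp continuous_snd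
    have a2 := hc.continuousAt.eventually (lt_mem_nhds (a := c z.2 i j - η / 2) (b := c z.2 i j) (by linarith))
    filter_upwards [a1, a2] with y b1 b2 _
    linarith
  have hθc : ContinuousAt θ z := hθ.continuous.continuousAt
  have hθz : θ z = 0 := pol_self z l Q (2 * γ)
  have E3 : ∀ᶠ y in 𝓝 z, -η < θ y := hθc.eventually (lt_mem_nhds (by rw [hθz]; linarith))
  have E4 : ∀ᶠ y : ℝ × EuclideanSpace ℝ (Fin d) in 𝓝 z, 0 < y.1 :=
    continuous_fst.continuousAt.eventually (lt_mem_nhds hz)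
  have E5 := pol_upper hJ hγ0
  obtain ⟨r, hr, hball⟩ := Metric.nhds_basis_closedBall.eventually_iff.mp
    (E1.and (E2.and (E3.and (E4.and E5))))
  set η' := min η (γ * r ^ 2 / 2) with hη'
  have hη'0 : 0 < η' := lt_min hη0 (by positivity)
  have E6 : ∀ᶠ y in 𝓝 z, θ y < η' := hθc.eventually (gt_mem_nhds (by rw [hθz]; exact hη'0))
  obtain ⟨y0, ⟨v, hPv, hv0⟩, hy0, hyb⟩ := ((hap i z (U i z - η') (by linarith)).and_eventually
    (E6.and (Metric.closedBall_mem_nhds z hr))).exists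
  obtain ⟨husc, hsub⟩ := hP v hPv
  have hus : UpperSemicontinuousOn (fun y => v i y + - θ y) (Metric.closedBall z r) :=
    ((husc i).upperSemicontinuousOn _).add (hθ.continuous.neg.continuousOn.upperSemicontinuousOn)
  obtain ⟨y, hyr, hmax⟩ := UpperSemicontinuousOn.exists_isMaxOn ⟨y0, hyb⟩ (isCompact_closedBall z r) hus
  have hm := hmax hyb
  simp only [Set.mem_ofPred_eq] at hm
  obtain ⟨B1, B2, B3, B4, B5⟩ := hball hyr
  have hvU := hle v hPv i y
  have hsmall : γ * ‖y - z‖ ^ 2 < γ * r ^ 2 := by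
    have : 2 * η' ≤ γ * r ^ 2 := by
      have := min_le_right η (γ * r ^ 2 / 2)
      linarith
    change _ ≤ U i z + θ y - _ at B5
    linarith
  have hlt' : ‖y - z‖ < r := by
    have := lt_of_mul_lt_mul_left hsmall hγ0.le
    exact lt_of_pow_lt_pow_left₀ 2 hr.le this
  have hJv : UJet (v i) y (fderiv ℝ θ y) (fderiv ℝ (fderiv ℝ θ) y) := by
    refine (((J2.of_contDiff hθ y).const_add (v i y - θ y)).ujet).mono ?_ (by simp)
    filter_upwards [Metric.isOpen_ball.mem_nhds (show y ∈ Metric.ball z r by rwa [Metric.mem_ball, dist_eq_norm])] with y' hy'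
    have := hmax (Metric.ball_subset_closedBall hy')
    simp only [Set.mem_ofPred_eq] at this
    linarith
  rcases hsub i y B4 _ _ hJv with h | ⟨j, hj, h⟩
  · have := h u0 hu0
    linarith
  · have a1 := hη j hj
    have a2 := B2 j hj
    have a3 := hle v hPv j y
    have a4 : η' ≤ η := min_le_left _ _
    linarith

theorem perron_exists (h1 : H1Hyp Uset b σ f c g L1 L2 M2) :
    ∃ V : Fin m → ℝ × EuclideanSpace ℝ (Fin d) → ℝ, SubCl Uset b σ f c g V ∧
      ∀ v, SubCl Uset b σ f c g v → ∀ i z, v i z ≤ V i z := by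
  obtain ⟨v0, hv0c, hv0s, hv0g, -, ⟨C0, hC0⟩, -⟩ := lower_barrier h1 (0 : EuclideanSpace ℝ (Fin d)) (ε := 1) one_pos
  have hv0 : SubCl Uset b σ f c g v0 :=
    ⟨fun i => (hv0c i).upperSemicontinuous, hv0s, hv0g, fun T => ⟨C0, 0, fun i z _ _ => by simpa using hC0 i z⟩⟩
  obtain ⟨w0, hw0c, hw0s, hw0g, -, hw0b, hw0gr⟩ := upper_barrier h1 (0 : EuclideanSpace ℝ (Fin d)) (ε := 1) one_pos
  have hb1 : ∀ v, SubCl Uset b σ f c g v → ∀ i z, 0 ≤ z.1 → v i z ≤ w0 i z := fun v hv =>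
    sub_le_upper h1 hv hw0c hw0s hw0g hw0b
  set V0 : Fin m → ℝ × EuclideanSpace ℝ (Fin d) → ℝ :=
    fun i z => sSup {a | ∃ v, SubCl Uset b σ f c g v ∧ a = v i z} with hV0
  have hne : ∀ i z, {a | ∃ v, SubCl Uset b σ f c g v ∧ a = v i z}.Nonempty := fun i z => ⟨_, v0, hv0, rfl⟩
  have hV0le : ∀ i z a, (∀ v, SubCl Uset b σ f c g v → v i z ≤ a) → V0 i z ≤ a := by
    intro i z a h
    refine csSup_le (hne i z) ?_
    rintro _ ⟨v, hv, rfl⟩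
    exact h v hv
  have hbdd : ∀ i z, BddAbove {a | ∃ v, SubCl Uset b σ f c g v ∧ a = v i z} := by
    intro i z
    rcases le_total z.1 0 with h | h
    · refine ⟨g z.2 i, ?_⟩
      rintro _ ⟨v, hv, rfl⟩
      exact hv.2.2.1 i z h
    · refine ⟨w0 i z, ?_⟩
      rintro _ ⟨v, hv, rfl⟩
      exact hb1 v hv i z h
  have hleV0 : ∀ v, SubCl Uset b σ f c g v → ∀ i z, v i z ≤ V0 i z := fun v hv i z =>
    le_csSup (hbdd i z) ⟨v, hv, rfl⟩
  have hgc : ∀ i, Continuous fun z : ℝ × EuclideanSpace ℝ (Fin d) => g z.2 i := fun i =>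
    (h1.gCont i).comp continuous_snd
  have hloc : ∀ i z, ∃ a, ∀ᶠ y in 𝓝 z, V0 i y ≤ a := by
    intro i z
    have hc : Continuous fun y : ℝ × EuclideanSpace ℝ (Fin d) => max (g y.2 i) (w0 i y) := (hgc i).max (hw0c i)
    refine ⟨max (g z.2 i) (w0 i z) + 1, ?_⟩
    filter_upwards [hc.continuousAt.eventually (gt_mem_nhds (lt_add_one (max (g z.2 i) (w0 i z))))] with y hy
    refine le_trans ?_ hy.le
    rcases le_total y.1 0 with h | h
    · exact (hV0le i y _ fun v hv => hv.2.2.1 i y h).trans (le_max_left _ _)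
    · exact (hV0le i y _ fun v hv => hb1 v hv i y h).trans (le_max_right _ _)
  have hVle : ∀ v, SubCl Uset b σ f c g v → ∀ i z, v i z ≤ env (V0 i) z := fun v hv i z =>
    (hleV0 v hv i z).trans (le_env (hloc i z))
  have hg0 : ∀ (i : Fin m) (z : ℝ × EuclideanSpace ℝ (Fin d)), z.1 ≤ 0 → env (V0 i) z ≤ g z.2 i := by
    intro i z hz
    rcases hz.lt_or_eq with hz | hz
    · refine env_le (G := fun z : ℝ × EuclideanSpace ℝ (Fin d) => g z.2 i) (hgc i).continuousAt ?_
      filter_upwards [continuous_fst.continuousAt.eventually (gt_mem_nhds hz)] with y hy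
      exact hV0le i y _ fun v hv => hv.2.2.1 i y (le_of_lt hy)
    · refine le_of_forall_pos_le_add fun ε hε => ?_
      obtain ⟨w, hwc, hws, hwg, hwε, hwb, -⟩ := upper_barrier h1 z.2 hε
      have := env_le (F := V0 i) (z := z) (G := fun y => max (g y.2 i) (w i y)) ((hgc i).max (hwc i)).continuousAt (by
        refine Eventually.of_forall fun y => ?_
        rcases le_total y.1 0 with h | h
        · exact (hV0le i y _ fun v hv => hv.2.2.1 i y h).trans (le_max_left _ _)
        · exact (hV0le i y _ fun v hv => sub_le_upper h1 hv hwc hws hwg hwb i y h).trans (le_max_right _ _))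
      refine this.trans (max_le (by linarith) ?_)
      have hz' : z = (0, z.2) := by rw [← hz]
      rw [hz']
      exact hwε i
  refine ⟨fun i => env (V0 i), ⟨fun i => env_usc (hloc i), ?_, hg0, fun T => ?_⟩, hVle⟩
  · refine perron_jetsub h1 (P := SubCl Uset b σ f c g) (fun v hv => ⟨hv.1, hv.2.1⟩) (fun i => env_usc (hloc i)) hVle ?_
    intro i z a ha
    refine (lt_env ha).mono fun y hy => ?_
    obtain ⟨_, ⟨v, hv, rfl⟩, h⟩ := exists_lt_of_lt_csSup (hne i y) hy
    exact ⟨v, hv, h⟩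
  · obtain ⟨C, hC⟩ := hw0gr T
    refine ⟨max C M2, 1, fun i z hz hzT => ?_⟩
    rw [pow_one]
    rcases hz.eq_or_lt with h | h
    · have a1 := hg0 i z h.symm.le
      have a2 := (abs_le.mp (h1.gGrowth z.2 i)).2
      refine (a1.trans a2).trans (mul_le_mul_of_nonneg_right (le_max_right _ _) (by positivity))
    · have a1 : env (V0 i) z ≤ w0 i z := env_le (hw0c i).continuousAt (by
        filter_upwards [continuous_fst.continuousAt.eventually (lt_mem_nhds h)] with y hy
        exact hV0le i y _ fun v hv => hb1 v hv i y (le_of_lt hy))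
      exact (a1.trans (hC i z hz hzT)).trans (mul_le_mul_of_nonneg_right (le_max_left _ _) (by positivity))

end PerronB

section PerronC

variable {d q m : ℕ} {Uset : Set (EuclideanSpace ℝ (Fin q))}
    {b : EuclideanSpace ℝ (Fin d) → Fin m → EuclideanSpace ℝ (Fin q) → EuclideanSpace ℝ (Fin d)}
    {σ : EuclideanSpace ℝ (Fin d) → Fin m → EuclideanSpace ℝ (Fin q) → Matrix (Fin d) (Fin d) ℝ}
    {f : EuclideanSpace ℝ (Fin d) → Fin m → EuclideanSpace ℝ (Fin q) → ℝ}
    {c : EuclideanSpace ℝ (Fin d) → Fin m → Fin m → ℝ}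
    {g : EuclideanSpace ℝ (Fin d) → Fin m → ℝ}
    {L1 L2 M2 : ℝ}

theorem max_obst (h1 : H1Hyp Uset b σ f c g L1 L2 M2) {V : Fin m → ℝ × EuclideanSpace ℝ (Fin d) → ℝ}
    (hV : SubCl Uset b σ f c g V) (hmax : ∀ v, SubCl Uset b σ f c g v → ∀ i z, v i z ≤ V i z)
    (i j : Fin m) (hj : j ≠ i) (z : ℝ × EuclideanSpace ℝ (Fin d)) : V j z - c z.2 i j ≤ V i z := by
  have hcc : Continuous fun y : ℝ × EuclideanSpace ℝ (Fin d) => - c y.2 i j := ((h1.cCont i j).comp continuous_snd).neg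
  have husc : UpperSemicontinuous fun y => max (V i y) (V j y + - c y.2 i j) :=
    (hV.1 i).sup ((hV.1 j).add hcc.upperSemicontinuous)
  have := hmax _ (update_mem hV i husc (fun z => le_max_left _ _) ?_ ?_ ?_) i z
  · rw [Function.update_self] at this
    have := (le_max_right _ _).trans this
    linarith
  · intro y hy
    refine max_le (hV.2.2.1 i y hy) ?_
    have := hV.2.2.1 j y hy
    have := h1.gIneq y.2 i j hj
    linarith
  · refine ⟨0, fun y hy => Or.inr ?_⟩
    rcases max_choice (V i y) (V j y + - c y.2 i j) with h | h
    · exact ⟨i, h.le⟩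
    · refine ⟨j, ?_⟩
      rw [h]
      linarith [h1.cNonneg y.2 i j]
  · intro y hy hlt l Q _
    refine Or.inr ⟨j, hj, ?_⟩
    rcases max_choice (V i y) (V j y + - c y.2 i j) with h | h
    · rw [h] at hlt; exact absurd hlt (lt_irrefl _)
    · rw [h]; linarith

theorem lenv_obst (h1 : H1Hyp Uset b σ f c g L1 L2 M2) {V : Fin m → ℝ × EuclideanSpace ℝ (Fin d) → ℝ}
    (hb : ∀ i z, ∃ a, ∀ᶠ y in 𝓝 z, a ≤ V i y)
    (ho : ∀ i j, j ≠ i → ∀ z, V j z - c z.2 i j ≤ V i z)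
    (i j : Fin m) (hj : j ≠ i) (z : ℝ × EuclideanSpace ℝ (Fin d)) :
    lenv (V j) z - c z.2 i j ≤ lenv (V i) z := by
  refine le_of_forall_pos_le_add fun ε hε => ?_
  have hc : Continuous fun y : ℝ × EuclideanSpace ℝ (Fin d) => c y.2 i j := (h1.cCont i j).comp continuous_snd
  have a2 := hc.continuousAt.eventually (gt_mem_nhds (show c z.2 i j < c z.2 i j + ε / 2 by linarith))
  have a1 := lenv_lsc (hb j) z (lenv (V j) z - ε / 2) (by linarith)
  have := le_lenv (F := V i) (z := z) (G := fun _ => lenv (V j) z - c z.2 i j - ε) continuousAt_const (by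
    filter_upwards [a1, a2] with y b1 b2
    have := ho i j hj y
    have := lenv_le (hb j y)
    linarith)
  linarith

theorem max_super_pde (h1 : H1Hyp Uset b σ f c g L1 L2 M2) {V : Fin m → ℝ × EuclideanSpace ℝ (Fin d) → ℝ}
    (hV : SubCl Uset b σ f c g V) (hmax : ∀ v, SubCl Uset b σ f c g v → ∀ i z, v i z ≤ V i z)
    (hb : ∀ i z, ∃ a, ∀ᶠ y in 𝓝 z, a ≤ V i y) (i : Fin m) (z : ℝ × EuclideanSpace ℝ (Fin d)) (hz : 0 < z.1)
    (l Q) (hJ : LJet (lenv (V i)) z l Q) : ∃ u ∈ Uset, Ham b σ f i z l Q u ≤ l (1, 0) := by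
  by_contra hcon
  push Not at hcon
  obtain ⟨K, hK0, hK⟩ := Ham_eps h1 i z
  obtain ⟨κ, hκ0, hκ⟩ : ∃ κ : ℝ, 0 < κ ∧ ∀ u ∈ Uset, l (1, 0) + κ ≤ Ham b σ f i z l Q u := by
    obtain ⟨u, hu, hmin⟩ := h1.Ucompact.exists_isMinOn h1.Unonempty (Ham_cont h1 i z l Q).continuousOn
    refine ⟨Ham b σ f i z l Q u - l (1, 0), by linarith [hcon u hu], fun u' hu' => ?_⟩
    have := hmin hu'
    simp only [Set.mem_ofPred_eq] at this
    linarith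
  set γ := κ / (8 * (K + 1)) with hγ
  have hγ0 : 0 < γ := by positivity
  have hγK : 4 * γ * K < κ := by
    have : γ * (8 * (K + 1)) = κ := by rw [hγ]; field_simp
    nlinarith
  set θ := pol z l Q (-(2 * γ)) with hθd
  have hθ : ContDiff ℝ 2 θ := pol_contDiff z l Q (-(2 * γ))
  have hHz : ∀ u ∈ Uset, 0 < Ham b σ f i z (fderiv ℝ θ z) (fderiv ℝ (fderiv ℝ θ) z) u - fderiv ℝ θ z (1, 0) := by
    intro u hu
    obtain ⟨e1, e2⟩ := Ham_pol (b := b) (σ := σ) (f := f) i z l Q (-(2 * γ)) u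
    rw [hθd, e2, e1]
    have := (abs_le.mp (hK l Q (2 * (-(2 * γ))) u hu)).1
    rw [abs_of_neg (by linarith)] at this
    have := hκ u hu
    linarith
  have E1 : ∀ᶠ y in 𝓝 z, ∀ u ∈ Uset,
      0 < Ham b σ f i y (fderiv ℝ θ y) (fderiv ℝ (fderiv ℝ θ) y) u - fderiv ℝ θ y (1, 0) := by
    refine h1.Ucompact.eventually_forall_of_forall_eventually fun u hu => ?_
    exact (Ham_cont_zu h1 hθ i).continuousAt.eventually (lt_mem_nhds (hHz u hu))
  have hθz : θ z = 0 := pol_self z l Q (-(2 * γ))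
  have E4 : ∀ᶠ y : ℝ × EuclideanSpace ℝ (Fin d) in 𝓝 z, 0 < y.1 :=
    continuous_fst.continuousAt.eventually (lt_mem_nhds hz)
  have E5 := pol_lower hJ hγ0
  obtain ⟨r, hr, hball⟩ := Metric.nhds_basis_closedBall.eventually_iff.mp (E1.and (E4.and E5))
  set δ := γ * (r / 2) ^ 2 with hδ
  have hδ0 : 0 < δ := by positivity
  set a := lenv (V i) z + δ with ha
  classical
  set N : ℝ × EuclideanSpace ℝ (Fin d) → ℝ :=
    fun y => if y ∈ Metric.closedBall z r then max (V i y) (a + θ y) else V i y with hN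
  have hNin : ∀ y ∈ Metric.closedBall z r, N y = max (V i y) (a + θ y) := fun y hy => by
    simp only [hN]; rw [if_pos hy]
  have hNout : ∀ y, r / 2 ≤ dist y z → N y = V i y := by
    intro y hy
    by_cases hyr : y ∈ Metric.closedBall z r
    · rw [hNin y hyr]
      refine max_eq_left ?_
      obtain ⟨-, -, B5⟩ := hball hyr
      have := lenv_le (hb i y)
      change lenv (V i) z + θ y + _ ≤ _ at B5
      rw [dist_eq_norm] at hy
      have : δ ≤ γ * ‖y - z‖ ^ 2 := by
        rw [hδ]; gcongr
      linarith
    · simp only [hN]; rw [if_neg hyr]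
  have hlocin : ∀ y, dist y z < r → ∀ᶠ y' in 𝓝 y, N y' = max (V i y') (a + θ y') := by
    intro y hy
    filter_upwards [Metric.isOpen_ball.mem_nhds (Metric.mem_ball.mpr hy)] with y' hy'
    exact hNin y' (Metric.ball_subset_closedBall hy')
  have hθa : Continuous fun y => a + θ y := continuous_const.add hθ.continuous
  have husc : UpperSemicontinuous N := by
    intro y s hs
    by_cases hy : dist y z < r
    · have e := hlocin y hy
      have hs' : max (V i y) (a + θ y) < s := by rwa [← e.self_of_nhds]
      filter_upwards [e, ((hV.1 i).sup hθa.upperSemicontinuous) y s hs'] with y' e' h'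
      rw [e']; exact h'
    · have hfar : r / 2 < dist y z := by linarith [not_lt.mp hy]
      rw [hNout y hfar.le] at hs
      have hd : Continuous fun y' : ℝ × EuclideanSpace ℝ (Fin d) => dist y' z := by fun_prop
      filter_upwards [hV.1 i y s hs, hd.continuousAt.eventually (lt_mem_nhds hfar)] with y' h' hd'
      rw [hNout y' hd'.le]; exact h'
  have hVN : ∀ y, V i y ≤ N y := by
    intro y
    simp only [hN]
    split_ifs
    · exact le_max_left _ _
    · exact le_rfl
  obtain ⟨B, hB⟩ := (isCompact_closedBall z r).bddAbove_image hθa.continuousOn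
  have key := hmax _ (update_mem hV i husc hVN ?_ ?_ ?_) i
  · simp only [Function.update_self] at key
    have := le_lenv (F := V i) (z := z) (G := fun y => a + θ y) hθa.continuousAt (by
      filter_upwards [Metric.closedBall_mem_nhds z hr] with y hy
      have h := key y
      rw [hNin y hy] at h
      exact (le_max_right _ _).trans h)
    simp only [hθz] at this
    linarith
  · intro y hy
    by_cases hyr : y ∈ Metric.closedBall z r
    · have := (hball hyr).2.1
      linarith
    · simp only [hN]; rw [if_neg hyr]; exact hV.2.2.1 i y hy
  · refine ⟨B, fun y _ => ?_⟩
    by_cases hyr : y ∈ Metric.closedBall z r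
    · rw [hNin y hyr]
      rcases max_choice (V i y) (a + θ y) with h | h
      · exact Or.inr ⟨i, h.le⟩
      · rw [h]; exact Or.inl (hB ⟨y, hyr, rfl⟩)
    · refine Or.inr ⟨i, ?_⟩
      simp only [hN]; rw [if_neg hyr]
  · intro y hy hlt l' Q' hU
    left
    have hyr : dist y z < r / 2 := by
      by_contra hc
      rw [hNout y (not_lt.mp hc)] at hlt
      exact lt_irrefl _ hlt
    have e := hlocin y (by linarith)
    have ey := e.self_of_nhds
    have hNy : N y = a + θ y := by
      rcases max_choice (V i y) (a + θ y) with h | h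
      · rw [ey, h] at hlt; exact absurd hlt (lt_irrefl _)
      · rw [ey, h]
    have hL : LJet N y (fderiv ℝ θ y) (fderiv ℝ (fderiv ℝ θ) y) :=
      (((J2.of_contDiff hθ y).const_add a).ljet).mono (by
        filter_upwards [e] with y' e'
        rw [e']; exact le_max_right _ _) hNy
    obtain ⟨f1, f2⟩ := jets_compare hU hL
    intro u hu
    have h2 := (hball (Metric.mem_closedBall.mpr (show dist y z ≤ r by linarith))).1 u hu
    have h3 := HL_mono (b := b) (σ := σ) i y (l := l') f2 u
    rw [← f1, Ham_eq] at h2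
    rw [Ham_eq]
    linarith

end PerronC

section PerronD

variable {d q m : ℕ} {Uset : Set (EuclideanSpace ℝ (Fin q))}
    {b : EuclideanSpace ℝ (Fin d) → Fin m → EuclideanSpace ℝ (Fin q) → EuclideanSpace ℝ (Fin d)}
    {σ : EuclideanSpace ℝ (Fin d) → Fin m → EuclideanSpace ℝ (Fin q) → Matrix (Fin d) (Fin d) ℝ}
    {f : EuclideanSpace ℝ (Fin d) → Fin m → EuclideanSpace ℝ (Fin q) → ℝ}
    {c : EuclideanSpace ℝ (Fin d) → Fin m → Fin m → ℝ}
    {g : EuclideanSpace ℝ (Fin d) → Fin m → ℝ}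
    {L1 L2 M2 : ℝ}

theorem perron_sol (h1 : H1Hyp Uset b σ f c g L1 L2 M2) :
    ∃ V L : Fin m → ℝ × EuclideanSpace ℝ (Fin d) → ℝ,
      (∀ i, UpperSemicontinuous (V i)) ∧ (∀ i, LowerSemicontinuous (L i)) ∧
      (∀ i z, 0 ≤ z.1 → V i z = L i z) ∧ JetSub Uset b σ f c V ∧ JetSuper Uset b σ f c L ∧
      (∀ i x, V i (0, x) = g x i) ∧
      (∀ T : ℝ, ∃ C : ℝ, 0 ≤ C ∧ ∀ i z, 0 ≤ z.1 → z.1 ≤ T → |V i z| ≤ C * (1 + ‖z.2‖ ^ 2)) := by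
  obtain ⟨V, hV, hmax⟩ := perron_exists h1
  have hcl : ∀ v : Fin m → ℝ × EuclideanSpace ℝ (Fin d) → ℝ, (∀ i, Continuous (v i)) → JetSub Uset b σ f c v →
      (∀ i z, z.1 ≤ 0 → v i z ≤ g z.2 i) → (∃ C : ℝ, ∀ i z, v i z ≤ C) → ∀ i z, v i z ≤ V i z := by
    rintro v hc hs hg ⟨C, hC⟩
    exact hmax v ⟨fun i => (hc i).upperSemicontinuous, hs, hg, fun T => ⟨C, 0, fun i z _ _ => by simpa using hC i z⟩⟩
  have hLge : ∀ v : Fin m → ℝ × EuclideanSpace ℝ (Fin d) → ℝ, (∀ i, Continuous (v i)) →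
      (∀ i z, v i z ≤ V i z) → ∀ i z, v i z ≤ lenv (V i) z := fun v hc hv i z =>
    le_lenv (hc i).continuousAt (Eventually.of_forall fun y => hv i y)
  obtain ⟨v0, hv0c, hv0s, hv0g, -, hv0C, hv0gr⟩ := lower_barrier h1 (0 : EuclideanSpace ℝ (Fin d)) (ε := 1) one_pos
  have hv0V := hcl v0 hv0c hv0s hv0g hv0C
  have hv0L := hLge v0 hv0c hv0V
  obtain ⟨w0, hw0c, hw0s, hw0g, -, hw0b, hw0gr⟩ := upper_barrier h1 (0 : EuclideanSpace ℝ (Fin d)) (ε := 1) one_pos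
  have hVw0 := sub_le_upper h1 hV hw0c hw0s hw0g hw0b
  have hb : ∀ i z, ∃ a, ∀ᶠ y in 𝓝 z, a ≤ V i y := by
    intro i z
    refine ⟨v0 i z - 1, ?_⟩
    filter_upwards [(hv0c i).continuousAt.eventually (lt_mem_nhds (sub_one_lt (v0 i z)))] with y hy
    exact hy.le.trans (hv0V i y)
  have hlsc : ∀ i, LowerSemicontinuous (lenv (V i)) := fun i => lenv_lsc (hb i)
  have hsup : JetSuper Uset b σ f c (fun i => lenv (V i)) := fun i z hz =>
    ⟨fun j hj => lenv_obst h1 hb (fun i j hj z => max_obst h1 hV hmax i j hj z) i j hj z,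
      fun l Q hJ => max_super_pde h1 hV hmax hb i z hz l Q hJ⟩
  have hL0 : ∀ i x, g x i ≤ lenv (V i) (0, x) := by
    intro i x
    refine le_of_forall_pos_le_add fun ε hε => ?_
    obtain ⟨v, hvc, hvs, hvg, hve, hvC, -⟩ := lower_barrier h1 x hε
    have := hLge v hvc (hcl v hvc hvs hvg hvC) i (0, x)
    have := hve i
    linarith
  have hgr : ∀ T : ℝ, ∃ C : ℝ, 0 ≤ C ∧ ∀ i z, 0 ≤ z.1 → z.1 ≤ T →
      V i z ≤ C * (1 + ‖z.2‖ ^ 2) ∧ -(C * (1 + ‖z.2‖ ^ 2)) ≤ lenv (V i) z := by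
    intro T
    obtain ⟨C, hC⟩ := hv0gr T
    obtain ⟨C', hC'⟩ := hw0gr T
    refine ⟨|C| + |C'|, by positivity, fun i z hz hzT => ⟨?_, ?_⟩⟩
    · refine ((hVw0 i z hz).trans (hC' i z hz hzT)).trans (mul_le_mul_of_nonneg_right ?_ (by positivity))
      linarith [le_abs_self C', abs_nonneg C]
    · refine le_trans (neg_le_neg (mul_le_mul_of_nonneg_right ?_ (by positivity))) ((hC i z hzT).trans (hv0L i z))
      linarith [le_abs_self C, abs_nonneg C']
  have hVL : ∀ i z, 0 ≤ z.1 → V i z = lenv (V i) z := by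
    intro i z hz
    refine le_antisymm ?_ (lenv_le (hb i z))
    obtain ⟨C, -, hC⟩ := hgr (z.1 + 1)
    refine comparison h1 hV.1 hlsc hV.2.1 hsup (T := z.1 + 1) (C := C) (k := 1)
      (fun i y hy hyT => ?_) (fun i y hy hyT => ?_) (fun i x => (hV.2.2.1 i (0, x) le_rfl).trans (hL0 i x)) i z hz (by linarith)
    · rw [pow_one]; exact (hC i y hy hyT).1
    · rw [pow_one]; exact (hC i y hy hyT).2
  refine ⟨V, fun i => lenv (V i), hV.1, hlsc, hVL, hV.2.1, hsup, fun i x => ?_, fun T => ?_⟩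
  · refine le_antisymm (hV.2.2.1 i (0, x) le_rfl) ?_
    rw [hVL i (0, x) le_rfl]
    exact hL0 i x
  · obtain ⟨C, hC0, hC⟩ := hgr T
    refine ⟨C, hC0, fun i z hz hzT => abs_le.mpr ⟨?_, (hC i z hz hzT).1⟩⟩
    rw [hVL i z hz]
    exact (hC i z hz hzT).2

theorem grow_conv {s qT C : ℝ} (hs : 0 ≤ s) (hq : 1 ≤ qT) (hC : 0 ≤ C) :
    C * (1 + s ^ qT) ≤ 2 * C * (1 + s ^ 2) ^ (⌈qT⌉₊ + 1) := by
  have h1 : 1 ≤ 1 + s ^ 2 := by nlinarith [sq_nonneg s]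
  have h2 : s ^ qT ≤ (1 + s ^ 2) ^ (⌈qT⌉₊ + 1) := by
    calc s ^ qT ≤ (1 + s ^ 2) ^ qT := Real.rpow_le_rpow hs (by nlinarith [sq_nonneg (s - 1)]) (by linarith)
      _ ≤ (1 + s ^ 2) ^ (((⌈qT⌉₊ + 1 : ℕ) : ℝ)) := by
          refine Real.rpow_le_rpow_of_exponent_le h1 ?_
          push_cast
          linarith [Nat.le_ceil qT]
      _ = _ := Real.rpow_natCast _ _
  have h3 : 1 ≤ (1 + s ^ 2) ^ (⌈qT⌉₊ + 1) := one_le_pow₀ h1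
  nlinarith

theorem main_aux (h1 : H1Hyp Uset b σ f c g L1 L2 M2) :
    ∃ V : ℝ → EuclideanSpace ℝ (Fin d) → Fin m → ℝ,
      ParSolClass Uset b σ f c g V ∧
      ∀ W : ℝ → EuclideanSpace ℝ (Fin d) → Fin m → ℝ,
        ParSolClass Uset b σ f c g W → ∀ t : ℝ, 0 ≤ t → ∀ x i, W t x i = V t x i := by
  obtain ⟨V, L, hVu, hLl, hVL, hVs, hLs, hV0, hVg⟩ := perron_sol h1
  have hVs' : JetSuper Uset b σ f c V := by
    intro i z hz
    obtain ⟨a1, a2⟩ := hLs i z hz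
    refine ⟨fun j hj => ?_, fun l Q hJ => a2 l Q (hJ.mono ?_ (hVL i z hz.le).symm)⟩
    · rw [hVL i z hz.le, hVL j z hz.le]; exact a1 j hj
    · filter_upwards [continuous_fst.continuousAt.eventually (lt_mem_nhds hz)] with y hy
      exact (hVL i y (le_of_lt hy)).le
  refine ⟨fun t x i => V i (t, x), ⟨fun i => ?_, par_super_of_jet h1 hVs', par_sub_of_jet h1 hVs,
    fun x i => hV0 i x, fun T hT => ?_⟩, ?_⟩
  · refine continuousOn_iff_lower_upperSemicontinuousOn.mpr ⟨?_, (hVu i).upperSemicontinuousOn _⟩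
    intro y hy s hs
    have hs' : s < L i y := by rw [← hVL i y hy]; exact hs
    filter_upwards [(hLl i y s hs').filter_mono nhdsWithin_le_nhds, self_mem_nhdsWithin] with y' h h'
    rw [← hVL i y' h'] at h
    exact h
  · obtain ⟨C, hC0, hC⟩ := hVg T
    refine ⟨C, hC0, 2, by norm_num, fun t ht x i => ?_⟩
    rw [Real.rpow_two]
    exact hC i (t, x) ht.1 ht.2
  · rintro W ⟨hWc, hWsup, hWsub, hW0, hWg⟩ t ht x i
    set w : Fin m → ℝ × EuclideanSpace ℝ (Fin d) → ℝ := fun i z => W (max z.1 0) z.2 i with hw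
    have hwc : ∀ i, Continuous (w i) := by
      intro i
      have hc : Continuous fun z : ℝ × EuclideanSpace ℝ (Fin d) => (max z.1 0, z.2) := by fun_prop
      exact (hWc i).comp_continuous hc fun z => show (0:ℝ) ≤ max z.1 0 from le_max_right _ _
    have hwW : ∀ i z, 0 ≤ z.1 → w i z = W z.1 z.2 i := by
      intro i z hz
      simp only [hw, max_eq_left hz]
    have s1 := jet_of_par_sub h1 hwc hwW hWsub
    have s2 := jet_of_par_super h1 hwc hwW hWsup
    obtain ⟨C, hC0, hC⟩ := hVg (t + 1)
    obtain ⟨C', hC'0, qT, hq, hC'⟩ := hWg (t + 1) (by linarith)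
    have p1 : ∀ x : EuclideanSpace ℝ (Fin d), 1 ≤ 1 + ‖x‖ ^ 2 := fun x => by nlinarith [sq_nonneg ‖x‖]
    have bV : ∀ i z, 0 ≤ z.1 → z.1 ≤ t + 1 → |V i z| ≤ (C + 2 * C') * (1 + ‖z.2‖ ^ 2) ^ (⌈qT⌉₊ + 1) := by
      intro i z hz hzT
      have a1 : 1 + ‖z.2‖ ^ 2 ≤ (1 + ‖z.2‖ ^ 2) ^ (⌈qT⌉₊ + 1) := le_self_pow₀ (p1 z.2) (by omega)
      have a2 : 1 ≤ (1 + ‖z.2‖ ^ 2) ^ (⌈qT⌉₊ + 1) := one_le_pow₀ (p1 z.2)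
      have := hC i z hz hzT
      have := mul_le_mul_of_nonneg_left a1 hC0
      nlinarith
    have bW : ∀ i z, 0 ≤ z.1 → z.1 ≤ t + 1 → |w i z| ≤ (C + 2 * C') * (1 + ‖z.2‖ ^ 2) ^ (⌈qT⌉₊ + 1) := by
      intro i z hz hzT
      have a2 : 1 ≤ (1 + ‖z.2‖ ^ 2) ^ (⌈qT⌉₊ + 1) := one_le_pow₀ (p1 z.2)
      rw [hwW i z hz]
      have := hC' z.1 ⟨hz, hzT⟩ z.2 i
      have := grow_conv (norm_nonneg z.2) hq hC'0
      nlinarith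
    have hw0 : ∀ i x, w i (0, x) = g x i := fun i x => by
      rw [hwW i (0, x) le_rfl]; exact hW0 x i
    have hL0 : ∀ i x, L i (0, x) = g x i := fun i x => by rw [← hVL i (0, x) le_rfl, hV0]
    have c1 := comparison h1 (fun i => (hwc i).upperSemicontinuous) hLl s1 hLs (T := t + 1) 
      (fun i z hz hzT => (abs_le.mp (bW i z hz hzT)).2)
      (fun i z hz hzT => by rw [← hVL i z hz]; exact (abs_le.mp (bV i z hz hzT)).1)
      (fun i x => by rw [hw0, hL0]) i (t, x) ht (by simp)
    have c2 := comparison h1 hVu (fun i => (hwc i).lowerSemicontinuous) hVs s2 (T := t + 1) 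
      (fun i z hz hzT => (abs_le.mp (bV i z hz hzT)).2)
      (fun i z hz hzT => (abs_le.mp (bW i z hz hzT)).1)
      (fun i x => by rw [hw0, hV0]) i (t, x) ht (by simp)
    rw [← hVL i (t, x) ht] at c1
    rw [hwW i (t, x) ht] at c1 c2
    exact le_antisymm c1 c2

end PerronD

/-- Theorem 2.1(i): under Assumption (H1) there exists a unique continuous
viscosity solution, with polynomial growth on every finite horizon, to the forward parabolic
system of quasi variational inequalities with initial condition `g`. -/
theorem parabolic_system_existence_uniqueness
    {d q m : ℕ} (hm : 0 < m)
    (Uset : Set (EuclideanSpace ℝ (Fin q)))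
    (b : EuclideanSpace ℝ (Fin d) → Fin m → EuclideanSpace ℝ (Fin q) → EuclideanSpace ℝ (Fin d))
    (σ : EuclideanSpace ℝ (Fin d) → Fin m → EuclideanSpace ℝ (Fin q) → Matrix (Fin d) (Fin d) ℝ)
    (f : EuclideanSpace ℝ (Fin d) → Fin m → EuclideanSpace ℝ (Fin q) → ℝ)
    (c : EuclideanSpace ℝ (Fin d) → Fin m → Fin m → ℝ)
    (g : EuclideanSpace ℝ (Fin d) → Fin m → ℝ)
    (L1 L2 M2 : ℝ)
    (h1 : H1Hyp Uset b σ f c g L1 L2 M2) :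
    ∃ V : ℝ → EuclideanSpace ℝ (Fin d) → Fin m → ℝ,
      ParSolClass Uset b σ f c g V ∧
      ∀ W : ℝ → EuclideanSpace ℝ (Fin d) → Fin m → ℝ,
        ParSolClass Uset b σ f c g W → ∀ t : ℝ, 0 ≤ t → ∀ x i, W t x i = V t x i := by
  exact main_aux h1
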